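/- arXiv:2411.18661 — 9 statements merged into one kernel-verified Lean document; each statement's English description precedes it below -/
import Mathlib

section
/- Let T be a 2-dimensional pseudo-representation of a group G over a commutative ring R in which 2 is invertible, with respect to an element c ∈ G with c² = 1. Define det(T) : G → R by det(T)(σ) = (1/2)(T(σ)² − T(σ²)). Then det(T)(σ) · det(T)(σ⁻¹) = 1 for every σ ∈ G (so det(T) takes values in R^×), and det(T)(στ) = det(T)(σ) · det(T)(τ) for all σ, τ ∈ G; that is, det(T) is a group homomorphism G → R^×. -/
/-- The determinant of a 2-dimensional pseudo-representation is a group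
homomorphism `G → Rˣ`: it is multiplicative and `det T σ * det T σ⁻¹ = 1`. -/
theorem stmt_0 {R : Type*} [CommRing R] [Invertible (2 : R)]
    {G : Type*} [Group G]
    (T : G → R) (c : G)
    (hc : c ^ 2 = 1) (hT1 : T 1 = 2) (hTc : T c = 0)
    (hcomm : ∀ σ τ : G, T (σ * τ) = T (τ * σ))
    (hrel : ∀ γ δ η : G,
      T (γ * δ * η) + T (γ * η * δ) - T (γ * η) * T δ - T (η * δ) * T γ
        - T (δ * γ) * T η + T γ * T δ * T η = 0)
    (detT : G → R) (hdet : ∀ σ : G, 2 * detT σ = T σ ^ 2 - T (σ ^ 2)) :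
    (∀ σ : G, detT σ * detT σ⁻¹ = 1) ∧
      (∀ σ τ : G, detT (σ * τ) = detT σ * detT τ) := by
  have cancel : ∀ x y : R, 2 * x = 2 * y → x = y := fun x y h =>
    (isUnit_of_invertible (2 : R)).mul_left_cancel h
  -- A relation with a repeated argument expresses the trace of `a * a * b`.
  have trace_sq_mul : ∀ a b : G,
      2 * T (a * a * b) = 2 * T (a * b) * T a + T (a * a) * T b - T a ^ 2 * T b := by
    intro a b
    have h := hrel a a b
    have h1 : T (a * b * a) = T (a * a * b) := by rw [hcomm, ← mul_assoc]
    rw [h1, hcomm b a] at h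
    linear_combination h
  have mul : ∀ σ τ : G, detT (σ * τ) = detT σ * detT τ := by
    intro a b
    have hab := hrel a b (a * b)
    have h1 : T (a * b * (a * b)) = T ((a * b) ^ 2) := by rw [sq]
    have h2 : T (a * (a * b) * b) = T (a * a * (b * b)) := by simp only [mul_assoc]
    have h3 : T (a * (a * b)) = T (a * a * b) := by rw [mul_assoc]
    have h4 : T (a * b * b) = T (b * b * a) := by rw [mul_assoc, hcomm]
    have h5 : T (a * (b * b)) = T (b * b * a) := hcomm _ _
    have h6 := trace_sq_mul a b
    have h7 := trace_sq_mul b a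
    have h8 := trace_sq_mul a (b * b)
    have ha := hdet a
    have hb := hdet b
    have hd := hdet (a * b)
    rw [h1, h2, h3, h4, hcomm b a] at hab
    rw [hcomm b a] at h7
    rw [h5] at h8
    rw [sq a] at ha
    rw [sq b] at hb
    apply cancel
    apply cancel
    linear_combination 2 * hd - 2 * hab + h8 - T b * h6 - 2 * detT b * ha
      - (T a ^ 2 - T (a * a)) * hb
  refine ⟨fun σ => ?_, mul⟩
  rw [← mul, mul_inv_cancel]
  apply cancel
  rw [hdet, one_pow, hT1]
  norm_num
end

section
/- Let T be a 2-dimensional pseudo-representation of a group G over a commutative ring R in which 2 is invertible, with respect to c ∈ G, and let a, d, y be the associated functions. Then y(σ, τ) = d(τσ) − d(τ)d(σ) for all σ, τ ∈ G. -/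
/-- For a 2-dimensional pseudo-representation, `y σ τ = d (τσ) - d τ * d σ`. -/
theorem stmt_2 {R : Type*} [CommRing R] [Invertible (2 : R)]
    {G : Type*} [Group G]
    (T : G → R) (c : G)
    (hc : c ^ 2 = 1) (hT1 : T 1 = 2) (hTc : T c = 0)
    (hcomm : ∀ σ τ : G, T (σ * τ) = T (τ * σ))
    (hrel : ∀ γ δ η : G,
      T (γ * δ * η) + T (γ * η * δ) - T (γ * η) * T δ - T (η * δ) * T γ
        - T (δ * γ) * T η + T γ * T δ * T η = 0)
    (a d : G → R) (y : G → G → R)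
    (ha : ∀ σ : G, 2 * a σ = T (c * σ) + T σ)
    (hd : ∀ σ : G, 2 * d σ = T σ - T (c * σ))
    (hy : ∀ σ τ : G, y σ τ = a (σ * τ) - a σ * a τ) :
    ∀ σ τ : G, y σ τ = d (τ * σ) - d τ * d σ := by
  intro σ τ
  have key := hrel c σ τ
  rw [hTc, hcomm σ c] at key
  have ha' := ha (σ * τ)
  have hd' := hd (τ * σ)
  rw [← mul_assoc] at ha' hd'
  have h4 : IsUnit (4 : R) := by
    have h := (isUnit_of_invertible (2 : R)).mul (isUnit_of_invertible (2 : R))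
    norm_num at h
    exact h
  apply h4.mul_left_cancel
  rw [hy]
  have haa : 4 * (a σ * a τ) = (T (c * σ) + T σ) * (T (c * τ) + T τ) := by
    rw [← ha, ← ha]; ring
  have hdd : 4 * (d τ * d σ) = (T τ - T (c * τ)) * (T σ - T (c * σ)) := by
    rw [← hd, ← hd]; ring
  linear_combination 2 * ha' - 2 * hd' - haa + hdd + 2 * key + 2 * hcomm σ τ
end

section
/- Let T be a 2-dimensional pseudo-representation of a group G over a commutative ring R in which 2 is invertible, with respect to c ∈ G, and let a, d, y be the associated functions. Then y(στ, δ) = a(σ)·y(τ, δ) + y(σ, δ)·d(τ) for all σ, τ, δ ∈ G. -/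
section PseudoRepresentation

variable {R G : Type*} [CommRing R] [Group G] {T : G → R} {c : G}

/-- The pseudo-representation relation with the element `c` of trace zero in the middle. -/
theorem pseudoRep_mul_involution_mul (hTc : T c = 0)
    (hcomm : ∀ σ τ : G, T (σ * τ) = T (τ * σ))
    (hrel : ∀ γ δ η : G,
      T (γ * δ * η) + T (γ * η * δ) - T (γ * η) * T δ - T (η * δ) * T γ
        - T (δ * γ) * T η + T γ * T δ * T η = 0) (σ τ : G) :
    T (σ * (c * τ)) + T (c * (σ * τ)) = T σ * T (c * τ) + T (c * σ) * T τ := by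
  have h := hrel σ c τ
  rw [hTc, hcomm (σ * τ) c, hcomm τ c, mul_assoc] at h
  linear_combination h

theorem pseudoRep_involution_mul_involution_mul (hc : c ^ 2 = 1) (hTc : T c = 0)
    (hcomm : ∀ σ τ : G, T (σ * τ) = T (τ * σ))
    (hrel : ∀ γ δ η : G,
      T (γ * δ * η) + T (γ * η * δ) - T (γ * η) * T δ - T (η * δ) * T γ
        - T (δ * γ) * T η + T γ * T δ * T η = 0) (σ τ : G) :
    T (c * (σ * (c * τ))) + T (σ * τ) = T (c * σ) * T (c * τ) + T σ * T τ := by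
  have hcc : ∀ x : G, c * (c * x) = x := fun x => by rw [← mul_assoc, ← sq, hc, one_mul]
  have h := pseudoRep_mul_involution_mul hTc hcomm hrel (c * σ) τ
  simpa only [mul_assoc, hcc] using h

end PseudoRepresentation


/-- For a 2-dimensional pseudo-representation, `y (στ) δ = a σ * y τ δ + y σ δ * d τ`. -/
theorem stmt_3 {R : Type*} [CommRing R] [Invertible (2 : R)]
    {G : Type*} [Group G]
    (T : G → R) (c : G)
    (hc : c ^ 2 = 1) (hT1 : T 1 = 2) (hTc : T c = 0)
    (hcomm : ∀ σ τ : G, T (σ * τ) = T (τ * σ))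
    (hrel : ∀ γ δ η : G,
      T (γ * δ * η) + T (γ * η * δ) - T (γ * η) * T δ - T (η * δ) * T γ
        - T (δ * γ) * T η + T γ * T δ * T η = 0)
    (a d : G → R) (y : G → G → R)
    (ha : ∀ σ : G, 2 * a σ = T (c * σ) + T σ)
    (hd : ∀ σ : G, 2 * d σ = T σ - T (c * σ))
    (hy : ∀ σ τ : G, y σ τ = a (σ * τ) - a σ * a τ) :
    ∀ σ τ δ : G, y (σ * τ) δ = a σ * y τ δ + y σ δ * d τ := by
  intro σ τ δ
  have hP := pseudoRep_mul_involution_mul hTc hcomm hrel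
  have hQ := pseudoRep_involution_mul_involution_mul hc hTc hcomm hrel
  have hyT : ∀ x z : G, 4 * y x z =
      T (x * z) + T (c * (x * z)) - T (x * (c * z)) - T (c * (x * (c * z))) := fun x z => by
    rw [hy]
    linear_combination 2 * ha (x * z) - 2 * a z * ha x - (T (c * x) + T x) * ha z
      + hP x z + hQ x z
  have haT : ∀ z : G, 2 * a σ * (T z + T (c * z)) =
      T (σ * z) + T (c * (σ * z)) + T (σ * (c * z)) + T (c * (σ * (c * z))) := fun z => by
    linear_combination (T z + T (c * z)) * ha σ - hP σ z - hQ σ z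
  have hdT : ∀ z : G, 2 * d τ * (T z - T (c * z)) =
      T (z * τ) - T (c * (z * τ)) - T (z * (c * τ)) + T (c * (z * (c * τ))) := fun z => by
    linear_combination (T z - T (c * z)) * hd τ + hP z τ - hQ z τ
  have hcyc : ∀ x z : G, T (δ * (x * z)) = T (x * (z * δ)) := fun x z => by
    rw [hcomm, mul_assoc]
  have hcyc' : ∀ x z : G, T (c * (δ * (x * z))) = T (x * (z * (c * δ))) := fun x z => by
    rw [← mul_assoc, hcomm, mul_assoc]
  have hδσ := hdT (δ * σ)
  have hδcσ := hdT (δ * (c * σ))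
  have h₁ := haT (τ * δ)
  have h₂ := haT (τ * (c * δ))
  have h₃ := hyT (σ * τ) δ
  simp only [mul_assoc, hcyc, hcyc'] at hδσ hδcσ h₁ h₂ h₃
  have hσδ : T (c * (δ * σ)) = T (σ * (c * δ)) := by rw [← mul_assoc, hcomm]
  have h8 : 2 * (2 * (2 * y (σ * τ) δ)) = 2 * (2 * (2 * (a σ * y τ δ + y σ δ * d τ))) := by
    rw [hcomm δ σ, hσδ] at hδσ
    linear_combination 2 * h₃ - 2 * a σ * hyT τ δ - 2 * d τ * hyT σ δ - h₁ + h₂ - hδσ - hδcσ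
  have h2 : IsUnit (2 : R) := isUnit_of_invertible 2
  exact h2.mul_left_cancel (h2.mul_left_cancel (h2.mul_left_cancel h8))
end

section
/- Let T be a 2-dimensional pseudo-representation of a group G over a commutative ring R in which 2 is invertible, with respect to c ∈ G, and let a, d, y be the associated functions. Then y(σ, τδ) = a(δ)·y(σ, τ) + y(σ, δ)·d(τ) for all σ, τ, δ ∈ G. -/
/-- For a 2-dimensional pseudo-representation, `y σ (τδ) = a δ * y σ τ + y σ δ * d τ`. -/
theorem stmt_4 {R : Type*} [CommRing R] [Invertible (2 : R)]
    {G : Type*} [Group G]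
    (T : G → R) (c : G)
    (hc : c ^ 2 = 1) (hT1 : T 1 = 2) (hTc : T c = 0)
    (hcomm : ∀ σ τ : G, T (σ * τ) = T (τ * σ))
    (hrel : ∀ γ δ η : G,
      T (γ * δ * η) + T (γ * η * δ) - T (γ * η) * T δ - T (η * δ) * T γ
        - T (δ * γ) * T η + T γ * T δ * T η = 0)
    (a d : G → R) (y : G → G → R)
    (ha : ∀ σ : G, 2 * a σ = T (c * σ) + T σ)
    (hd : ∀ σ : G, 2 * d σ = T σ - T (c * σ))
    (hy : ∀ σ τ : G, y σ τ = a (σ * τ) - a σ * a τ) :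
    ∀ σ τ δ : G, y σ (τ * δ) = a δ * y σ τ + y σ δ * d τ := by
  have hcc : c * c = 1 := by rw [← sq, hc]
  have hcc' : ∀ x : G, c * (c * x) = x := fun x => by rw [← mul_assoc, hcc, one_mul]
  have h₁ : ∀ x z : G, T (x * (c * z)) + T (c * (x * z)) = T (c * z) * T x + T (c * x) * T z := by
    intro x z
    have h := hrel x c z
    rw [hTc, hcomm (x * z) c, hcomm z c] at h
    simp only [mul_assoc] at h
    linear_combination h
  have h₂ : ∀ x z : G, T (c * (x * (c * z))) + T (x * z) = T (c * z) * T (c * x) + T x * T z := by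
    intro x z
    have h := h₁ (c * x) z
    simpa only [mul_assoc, hcc'] using h
  have hy' : ∀ σ z : G,
      4 * y σ z = T (c * (σ * z)) + T (σ * z) - T (σ * (c * z)) - T (c * (σ * (c * z))) := by
    intro σ z
    rw [hy]
    linear_combination 2 * ha (σ * z) - 2 * a z * ha σ - (T (c * σ) + T σ) * ha z + h₁ σ z + h₂ σ z
  intro σ τ δ
  have rot : ∀ u v w : G, T (u * (v * w)) = T (w * (u * v)) := fun u v w => by
    rw [← mul_assoc, hcomm]
  have e₁ := h₁ (σ * τ) δ
  have e₂ := h₂ (σ * τ) δ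
  have e₃ := h₁ (σ * (c * τ)) δ
  have e₄ := h₂ (σ * (c * τ)) δ
  have f₁ := h₁ τ (δ * σ)
  have f₂ := h₂ τ (δ * σ)
  have f₃ := h₁ τ (δ * (c * σ))
  have f₄ := h₂ τ (δ * (c * σ))
  have r₁ : T (τ * (δ * σ)) = T (σ * (τ * δ)) := rot _ _ _
  have r₂ : T (c * (τ * (δ * σ))) = T (σ * (c * (τ * δ))) := by
    simpa only [mul_assoc] using hcomm (c * τ * δ) σ
  have r₃ : T (τ * (c * (δ * σ))) = T (σ * (τ * (c * δ))) := by
    simpa only [mul_assoc] using hcomm (τ * c * δ) σ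
  have r₄ : T (c * (τ * (c * (δ * σ)))) = T (σ * (c * (τ * (c * δ)))) := by
    simpa only [mul_assoc] using hcomm (c * τ * c * δ) σ
  have s₁ : T (τ * (δ * (c * σ))) = T (c * (σ * (τ * δ))) := by
    simpa only [mul_assoc] using hcomm (τ * δ) (c * σ)
  have s₂ : T (c * (τ * (δ * (c * σ)))) = T (c * (σ * (c * (τ * δ)))) := by
    simpa only [mul_assoc] using hcomm (c * τ * δ) (c * σ)
  have s₃ : T (τ * (c * (δ * (c * σ)))) = T (c * (σ * (τ * (c * δ)))) := by
    simpa only [mul_assoc] using hcomm (τ * c * δ) (c * σ)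
  have s₄ : T (c * (τ * (c * (δ * (c * σ))))) = T (c * (σ * (c * (τ * (c * δ))))) := by
    simpa only [mul_assoc] using hcomm (c * τ * c * δ) (c * σ)
  have t₁ : T (δ * σ) = T (σ * δ) := hcomm _ _
  have t₂ : T (c * (δ * σ)) = T (σ * (c * δ)) := by
    simpa only [mul_assoc] using hcomm (c * δ) σ
  have t₃ : T (δ * (c * σ)) = T (c * (σ * δ)) := by
    simpa only [mul_assoc] using hcomm δ (c * σ)
  have t₄ : T (c * (δ * (c * σ))) = T (c * (σ * (c * δ))) := by
    simpa only [mul_assoc] using hcomm (c * δ) (c * σ)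
  simp only [mul_assoc] at e₁ e₂ e₃ e₄
  rw [r₂, r₃, t₁, t₂] at f₁
  rw [r₁, r₄, t₁, t₂] at f₂
  rw [s₂, s₃, t₃, t₄] at f₃
  rw [s₁, s₄, t₃, t₄] at f₄
  have h2 : IsUnit (2 : R) := isUnit_of_invertible 2
  have h8 : IsUnit (2 ^ 3 : R) := h2.pow 3
  apply h8.mul_left_cancel
  linear_combination 2 * hy' σ (τ * δ) - 2 * a δ * hy' σ τ - 2 * d τ * hy' σ δ
    - (T (c * (σ * τ)) + T (σ * τ) - T (σ * (c * τ)) - T (c * (σ * (c * τ)))) * ha δ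
    - (T (c * (σ * δ)) + T (σ * δ) - T (σ * (c * δ)) - T (c * (σ * (c * δ)))) * hd τ
    + e₁ + e₂ - e₃ - e₄ - f₁ + f₂ - f₃ + f₄
end

section
/- Let T be a 2-dimensional pseudo-representation of a group G over a commutative ring R in which 2 is invertible, with respect to c ∈ G, and let a, d, y be the associated functions. Then y(α, β)·y(σ, τ) = y(α, τ)·y(σ, β) for all α, β, σ, τ ∈ G. -/
/-- Multiplicativity of `T` on the corner cut out by the idempotent `(1 + ε c) / 2`, where `ε` is a
sign. -/
lemma corner_mul {R G : Type*} [CommRing R] [Group G] {T : G → R} {c : G} (hcc : c * c = 1)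
    (hTc : T c = 0) (hcomm : ∀ σ τ : G, T (σ * τ) = T (τ * σ))
    (hrel : ∀ γ δ η : G,
      T (γ * δ * η) + T (γ * η * δ) - T (γ * η) * T δ - T (η * δ) * T γ
        - T (δ * γ) * T η + T γ * T δ * T η = 0)
    {ε : R} (hε : ε * ε = 1) (x y : G) :
    (T x + ε * T (c * x)) * (T y + ε * T (c * y)) =
      T (x * y) + ε * T (c * (x * y)) + ε * T (x * (c * y)) + T (c * (x * (c * y))) := by
  have h₁ := hrel x c y
  have h₂ := hrel (c * x) c y
  have e₁ : c * (c * x) = x := by rw [← mul_assoc, hcc, one_mul]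
  have e₂ : T (c * x * y * c) = T (x * y) := by
    rw [hcomm, ← mul_assoc, ← mul_assoc, hcc, one_mul]
  rw [hcomm (x * y) c, hcomm y c, hTc] at h₁
  rw [e₁, e₂, hcomm y c, hTc] at h₂
  simp only [mul_assoc] at h₁ h₂
  linear_combination -ε * h₁ - h₂ + (T (c * x) * T (c * y)) * hε

/-- The exchange relation `T (eαfβ) T (eσfτ) = T (eαfτ) T (eσfβ)` for the idempotents
`e = (1 + c) / 2` and `f = (1 - c) / 2`, with denominators cleared. -/
lemma offDiag_mul {R G : Type*} [CommRing R] [Group G] {T : G → R} {c : G} (hcc : c * c = 1)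
    (hTc : T c = 0) (hcomm : ∀ σ τ : G, T (σ * τ) = T (τ * σ))
    (hrel : ∀ γ δ η : G,
      T (γ * δ * η) + T (γ * η * δ) - T (γ * η) * T δ - T (η * δ) * T γ
        - T (δ * γ) * T η + T γ * T δ * T η = 0)
    (α β σ τ : G) :
    (T (α * β) + T (c * (α * β)) - T (α * (c * β)) - T (c * (α * (c * β)))) *
      (T (σ * τ) + T (c * (σ * τ)) - T (σ * (c * τ)) - T (c * (σ * (c * τ)))) =
    (T (α * τ) + T (c * (α * τ)) - T (α * (c * τ)) - T (c * (α * (c * τ)))) *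
      (T (σ * β) + T (c * (σ * β)) - T (σ * (c * β)) - T (c * (σ * (c * β)))) := by
  have mul_pos := corner_mul hcc hTc hcomm hrel (ε := 1) (by ring)
  have mul_neg := corner_mul hcc hTc hcomm hrel (ε := -1) (by ring)
  have swap (x y : G) : T (c * (x * (c * y))) = T (c * (y * (c * x))) := by
    rw [← mul_assoc, hcomm, mul_assoc]
  have rot (x y : G) : T (x * (c * y)) = T (c * (y * x)) := by
    rw [hcomm, mul_assoc]
  have rot_left (w : G) : T (α * w) = T (w * α) := hcomm _ _
  have rot_c_left (w : G) : T (c * (α * w)) = T (w * (c * α)) := by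
    rw [← mul_assoc, hcomm]
  have p₁ := mul_pos (α * β) (σ * τ)
  have p₂ := mul_pos (α * β) (σ * (c * τ))
  have p₃ := mul_pos (α * (c * β)) (σ * τ)
  have p₄ := mul_pos (α * (c * β)) (σ * (c * τ))
  have n₁ := mul_neg (β * σ) (τ * α)
  have n₂ := mul_neg (β * σ) (τ * (c * α))
  have n₃ := mul_neg (β * (c * σ)) (τ * α)
  have n₄ := mul_neg (β * (c * σ)) (τ * (c * α))
  rw [rot σ β, hcomm σ β, swap σ β, ← rot β σ, rot α τ, hcomm α τ, swap α τ, ← rot τ α]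
  simp only [mul_assoc, rot_left, rot_c_left] at p₁ p₂ p₃ p₄ n₁ n₂ n₃ n₄ ⊢
  linear_combination p₁ - p₂ - p₃ + p₄ - n₁ - n₂ - n₃ - n₄

/-- For a 2-dimensional pseudo-representation, `y α β * y σ τ = y α τ * y σ β`. -/
theorem stmt_5 {R : Type*} [CommRing R] [Invertible (2 : R)]
    {G : Type*} [Group G]
    (T : G → R) (c : G)
    (hc : c ^ 2 = 1) (hT1 : T 1 = 2) (hTc : T c = 0)
    (hcomm : ∀ σ τ : G, T (σ * τ) = T (τ * σ))
    (hrel : ∀ γ δ η : G,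
      T (γ * δ * η) + T (γ * η * δ) - T (γ * η) * T δ - T (η * δ) * T γ
        - T (δ * γ) * T η + T γ * T δ * T η = 0)
    (a d : G → R) (y : G → G → R)
    (ha : ∀ σ : G, 2 * a σ = T (c * σ) + T σ)
    (hd : ∀ σ : G, 2 * d σ = T σ - T (c * σ))
    (hy : ∀ σ τ : G, y σ τ = a (σ * τ) - a σ * a τ) :
    ∀ α β σ τ : G, y α β * y σ τ = y α τ * y σ β := by
  intro α β σ τ
  have hcc : c * c = 1 := by rw [← sq, hc]
  have y_eq (x z : G) :
      8 * y x z = 2 * (T (x * z) + T (c * (x * z)) - T (x * (c * z)) - T (c * (x * (c * z)))) := by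
    have h := corner_mul hcc hTc hcomm hrel (ε := 1) (by ring) x z
    rw [hy]
    linear_combination 4 * ha (x * z) - 2 * h - 4 * a z * ha x
      - 2 * (T x + T (c * x)) * ha z
  have two_unit : IsUnit (2 : R) := isUnit_of_invertible 2
  have unit : IsUnit (64 : R) := by
    have h := two_unit.pow 6
    norm_num at h
    exact h
  refine unit.mul_left_cancel ?_
  have h := offDiag_mul hcc hTc hcomm hrel α β σ τ
  calc 64 * (y α β * y σ τ) = (8 * y α β) * (8 * y σ τ) := by ring
    _ = (8 * y α τ) * (8 * y σ β) := by
      simp only [y_eq]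
      linear_combination 4 * h
    _ = 64 * (y α τ * y σ β) := by ring
end

section
/- Let R be an integral domain in which 2 is invertible and let T be a 2-dimensional pseudo-representation of a group G over R with respect to c ∈ G, with associated functions a, d, y. If α, β ∈ G satisfy y(α, β) = 0 in R, then for every τ ∈ G, either y(α, τ) = 0 or y(τ, β) = 0. -/
/-- Over an integral domain, if `y α β = 0` then for every `τ`, either
`y α τ = 0` or `y τ β = 0`. -/
theorem stmt_6 {R : Type*} [CommRing R] [IsDomain R] [Invertible (2 : R)]
    {G : Type*} [Group G]
    (T : G → R) (c : G)
    (hc : c ^ 2 = 1) (hT1 : T 1 = 2) (hTc : T c = 0)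
    (hcomm : ∀ σ τ : G, T (σ * τ) = T (τ * σ))
    (hrel : ∀ γ δ η : G,
      T (γ * δ * η) + T (γ * η * δ) - T (γ * η) * T δ - T (η * δ) * T γ
        - T (δ * γ) * T η + T γ * T δ * T η = 0)
    (a d : G → R) (y : G → G → R)
    (ha : ∀ σ : G, 2 * a σ = T (c * σ) + T σ)
    (hd : ∀ σ : G, 2 * d σ = T σ - T (c * σ))
    (hy : ∀ σ τ : G, y σ τ = a (σ * τ) - a σ * a τ)
    (α β : G) (h : y α β = 0) :
    ∀ τ : G, y α τ = 0 ∨ y τ β = 0 := by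
  have h2 : (2 : R) ≠ 0 := Invertible.ne_zero 2
  have hcc : c * c = 1 := by rw [← pow_two, hc]
  have hccm : ∀ x : G, c * (c * x) = x := fun x => by rw [← mul_assoc, hcc, one_mul]
  have hsum : ∀ x z, T (c * (x * z)) + T (x * (c * z)) = T (c * z) * T x + T (c * x) * T z := by
    intro x z
    have e := hrel c x z
    have e₁ : T (c * z * x) = T (x * (c * z)) := hcomm _ _
    rw [e₁, hTc, hcomm x c, mul_assoc] at e
    linear_combination e
  have hsum' : ∀ x z, T (x * z) + T (c * (x * (c * z))) = T (c * z) * T (c * x) + T x * T z := by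
    intro x z
    have e := hsum (c * x) z
    simp only [mul_assoc, hccm] at e
    exact e
  have hamul : ∀ x z, a (x * z) + a (x * (c * z)) = 2 * (a x * a z) := by
    intro x z
    refine mul_left_cancel₀ h2 ?_
    linear_combination ha (x * z) + ha (x * (c * z)) + hsum x z + hsum' x z
      - 2 * a z * ha x - (T (c * x) + T x) * ha z
  have hdmul : ∀ x z, d (x * z) - d (x * (c * z)) = 2 * (d x * d z) := by
    intro x z
    refine mul_left_cancel₀ h2 ?_
    linear_combination hd (x * z) - hd (x * (c * z)) - hsum x z + hsum' x z
      - 2 * d z * hd x - (T x - T (c * x)) * hd z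
  have hya : ∀ σ τ, 2 * y σ τ = a (σ * τ) - a (σ * (c * τ)) := by
    intro σ τ
    linear_combination 2 * hy σ τ + hamul σ τ
  have hyd : ∀ σ τ, 2 * y σ τ = d (τ * σ) + d (τ * (c * σ)) := by
    intro σ τ
    refine mul_left_cancel₀ h2 ?_
    have e₁ : T (τ * σ) = T (σ * τ) := hcomm _ _
    have e₂ : T (c * (τ * σ)) = T (σ * (c * τ)) := by rw [← mul_assoc, hcomm]
    have e₃ : T (τ * (c * σ)) = T (c * (σ * τ)) := by rw [hcomm, mul_assoc]
    have e₄ : T (c * (τ * (c * σ))) = T (c * (σ * (c * τ))) := by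
      rw [← mul_assoc, hcomm, mul_assoc]
    linear_combination 2 * hya σ τ + ha (σ * τ) - ha (σ * (c * τ)) - hd (τ * σ)
      - hd (τ * (c * σ)) - e₁ + e₂ - e₃ + e₄
  have hy' : ∀ σ τ, y σ τ = d (τ * σ) - d τ * d σ := by
    intro σ τ
    refine mul_left_cancel₀ h2 ?_
    linear_combination hyd σ τ - hdmul τ σ
  have hyamul : ∀ σ τ w, 2 * (y σ τ * a w) = y σ (τ * w) + y σ (τ * (c * w)) := by
    intro σ τ w
    have e := hamul (σ * τ) w
    simp only [mul_assoc] at e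
    linear_combination 2 * a w * hy σ τ - hy σ (τ * w) - hy σ (τ * (c * w))
      - e + a σ * hamul τ w
  have hydmul : ∀ σ τ w, 2 * (y σ τ * d w) = y σ (w * τ) - y σ (w * (c * τ)) := by
    intro σ τ w
    have e := hdmul w (τ * σ)
    have e₁ := hy' σ (w * τ)
    have e₂ := hy' σ (w * (c * τ))
    simp only [mul_assoc] at e e₁ e₂
    linear_combination 2 * d w * hy' σ τ - e₁ + e₂ - e + d σ * hdmul w τ
  have hswap : ∀ σ τ σ' τ', y σ τ * y σ' τ' = y σ τ' * y σ' τ := by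
    intro σ τ σ' τ'
    refine mul_left_cancel₀ (mul_ne_zero h2 h2) ?_
    have e₁ := hyamul σ τ (σ' * τ')
    have e₂ := hyamul σ τ (σ' * (c * τ'))
    have e₃ := hydmul σ τ' (τ * σ')
    have e₄ := hydmul σ τ' (τ * (c * σ'))
    simp only [mul_assoc] at e₁ e₂ e₃ e₄
    linear_combination 2 * y σ τ * hya σ' τ' - 2 * y σ τ' * hyd σ' τ + e₁ - e₂ - e₃ - e₄
  intro τ
  rw [← mul_eq_zero, hswap, h, zero_mul]
end

section
/- Let R be an integral domain in which 2 is invertible, with fraction field K, and let T be a 2-dimensional pseudo-representation of a group G over R with respect to c ∈ G, with associated functions a, d, y. Fix α, β ∈ G. (i) If τ, τ′ ∈ G satisfy y(β, τ) ≠ 0 and y(β, τ′) ≠ 0, then y(α, τ)/y(β, τ) = y(α, τ′)/y(β, τ′) in K. (ii) If τ, τ′ ∈ G satisfy y(τ, β) ≠ 0 and y(τ′, β) ≠ 0, then y(τ, α)/y(τ, β) = y(τ′, α)/y(τ′, β) in K. In particular the elements u(α, β) = y(α, τ)/y(β, τ) and u′(α, β) = y(τ, α)/y(τ, β) of K are independent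 of the choice of τ. -/
/-- For a pseudo-representation `T`, the function `y` behaves like a product
`y σ τ = b σ * b' τ` of off-diagonal matrix entries: its `2 × 2` minors vanish. -/
theorem mul_offDiag_swap {R : Type*} [CommRing R] [IsDomain R]
    {G : Type*} [Group G] (T : G → R) (c : G) (hc : c ^ 2 = 1) (hTc : T c = 0)
    (hcomm : ∀ σ τ : G, T (σ * τ) = T (τ * σ))
    (hrel : ∀ γ δ η : G,
      T (γ * δ * η) + T (γ * η * δ) - T (γ * η) * T δ - T (η * δ) * T γ
        - T (δ * γ) * T η + T γ * T δ * T η = 0)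
    (h2 : (2 : R) ≠ 0) (a d : G → R) (y : G → G → R)
    (ha : ∀ σ : G, 2 * a σ = T (c * σ) + T σ)
    (hd : ∀ σ : G, 2 * d σ = T σ - T (c * σ))
    (hy : ∀ σ τ : G, y σ τ = a (σ * τ) - a σ * a τ) (σ σ' τ τ' : G) :
    y σ τ * y σ' τ' = y σ τ' * y σ' τ := by
  have hcc : ∀ x : G, c * (c * x) = x := fun x => by rw [← mul_assoc, ← sq, hc, one_mul]
  have hT_mul : ∀ s t : G,
      T (c * (s * t)) + T (s * (c * t)) = T (c * t) * T s + T (c * s) * T t := fun s t => by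
    have h := hrel c s t
    rw [hTc, hcomm s c, hcomm (c * t) s, mul_assoc] at h
    linear_combination h
  have hT_conj : ∀ s t : G,
      T (c * (s * (c * t))) + T (s * t) = T s * T t + T (c * s) * T (c * t) := fun s t => by
    have h := hrel c s (c * t)
    rw [hTc, hcomm s c, hcc, hcomm t s, mul_assoc] at h
    linear_combination h
  have ha_mul : ∀ s t : G, 2 * (a s * a t) = a (s * t) + a (s * (c * t)) := fun s t => by
    refine mul_left_cancel₀ h2 ?_
    linear_combination 2 * a t * ha s + (T (c * s) + T s) * ha t - ha (s * t)
      - ha (s * (c * t)) - hT_mul s t - hT_conj s t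
  have hd_mul : ∀ s t : G, 2 * (d s * d t) = d (s * t) - d (s * (c * t)) := fun s t => by
    refine mul_left_cancel₀ h2 ?_
    linear_combination 2 * d t * hd s + (T s - T (c * s)) * hd t - hd (s * t)
      + hd (s * (c * t)) + hT_mul s t - hT_conj s t
  have had : ∀ s t : G, d (t * s) + d (t * (c * s)) = a (s * t) - a (s * (c * t)) :=
    fun s t => by
    have h₁ : T (c * (t * s)) = T (s * (c * t)) := by rw [← mul_assoc, hcomm]
    have h₂ : T (t * (c * s)) = T (c * (s * t)) := by rw [hcomm, mul_assoc]
    have h₃ : T (c * (t * (c * s))) = T (c * (s * (c * t))) := by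
      rw [← mul_assoc, hcomm, mul_assoc]
    refine mul_left_cancel₀ h2 ?_
    linear_combination hd (t * s) + hd (t * (c * s)) - ha (s * t) + ha (s * (c * t))
      + hcomm t s - h₁ + h₂ - h₃
  have hy_two : ∀ s t : G, 2 * y s t = a (s * t) - a (s * (c * t)) := fun s t => by
    linear_combination 2 * hy s t - ha_mul s t
  have hd_y : ∀ s t : G, d (t * s) = d t * d s + y s t := fun s t => by
    refine mul_left_cancel₀ h2 ?_
    linear_combination had s t - hd_mul t s - hy_two s t
  have hy_mul : ∀ s t u : G, y (s * t) u = a s * y t u + y s u * d t := fun s t u => by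
    have h₁ := ha_mul s (t * u)
    have h₂ := ha_mul s (t * (c * u))
    have h₃ := hd_mul t (u * s)
    have h₄ := hd_mul t (u * (c * s))
    have h₅ := had s (t * u)
    have h₆ := had s (t * (c * u))
    have h₇ := hy_two (s * t) u
    simp only [mul_assoc] at h₁ h₂ h₃ h₄ h₅ h₆ h₇
    refine mul_left_cancel₀ h2 (mul_left_cancel₀ h2 ?_)
    linear_combination 2 * h₇ - 2 * a s * hy_two t u - 2 * d t * hy_two s u - h₁ + h₂
      + 2 * d t * had s u - h₃ - h₄ - h₅ + h₆
  have h := hy_mul (σ * τ) σ' τ'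
  rw [mul_assoc, hy_mul, hy_mul, hy_mul, hd_y] at h
  linear_combination y σ' τ' * hy σ τ - h


/-- Over an integral domain, the ratios `y α τ / y β τ` and `y τ α / y τ β`
in the fraction field are independent of the choice of `τ`. -/
theorem stmt_7 {R : Type*} [CommRing R] [IsDomain R] [Invertible (2 : R)]
    {G : Type*} [Group G]
    (T : G → R) (c : G)
    (hc : c ^ 2 = 1) (hT1 : T 1 = 2) (hTc : T c = 0)
    (hcomm : ∀ σ τ : G, T (σ * τ) = T (τ * σ))
    (hrel : ∀ γ δ η : G,
      T (γ * δ * η) + T (γ * η * δ) - T (γ * η) * T δ - T (η * δ) * T γ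
        - T (δ * γ) * T η + T γ * T δ * T η = 0)
    (a d : G → R) (y : G → G → R)
    (ha : ∀ σ : G, 2 * a σ = T (c * σ) + T σ)
    (hd : ∀ σ : G, 2 * d σ = T σ - T (c * σ))
    (hy : ∀ σ τ : G, y σ τ = a (σ * τ) - a σ * a τ)
    (α β : G) :
    (∀ τ τ' : G, y β τ ≠ 0 → y β τ' ≠ 0 →
      algebraMap R (FractionRing R) (y α τ) / algebraMap R (FractionRing R) (y β τ) =
        algebraMap R (FractionRing R) (y α τ') / algebraMap R (FractionRing R) (y β τ')) ∧
    (∀ τ τ' : G, y τ β ≠ 0 → y τ' β ≠ 0 →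
      algebraMap R (FractionRing R) (y τ α) / algebraMap R (FractionRing R) (y τ β) =
        algebraMap R (FractionRing R) (y τ' α) / algebraMap R (FractionRing R) (y τ' β)) := by
  have h2 : (2 : R) ≠ 0 := (isUnit_of_invertible (2 : R)).ne_zero
  have hy_swap : ∀ σ σ' τ τ' : G, y σ τ * y σ' τ' = y σ τ' * y σ' τ :=
    mul_offDiag_swap T c hc hTc hcomm hrel h2 a d y ha hd hy
  have hinj {r : R} (hr : r ≠ 0) : algebraMap R (FractionRing R) r ≠ 0 :=
    (map_ne_zero_iff _ (IsFractionRing.injective R (FractionRing R))).mpr hr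
  refine ⟨fun τ τ' h h' => ?_, fun τ τ' h h' => ?_⟩
  · rw [div_eq_div_iff (hinj h) (hinj h'), ← map_mul, ← map_mul, hy_swap]
  · rw [div_eq_div_iff (hinj h) (hinj h'), ← map_mul, ← map_mul, hy_swap, mul_comm]
end

section
/- Let R be a complete Noetherian local integral domain with fraction field K, and let B be the integral closure of R in K, with i : R ↪ B the inclusion. Then for every prime ideal 𝔭 of B of height d, the contraction i⁻¹(𝔭) = 𝔭 ∩ R is a prime ideal of R of height d. -/
section Heights

theorem PrimeSpectrum.height_comap_of_isIntegral_of_hasGoingDown {A S : Type*} [CommRing A]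
    [CommRing S] [Algebra A S] [Algebra.IsIntegral A S] [Algebra.HasGoingDown A S]
    (P : PrimeSpectrum S) :
    Order.height (PrimeSpectrum.comap (algebraMap A S) P) = Order.height P := by
  apply le_antisymm
  · refine Order.height_le fun l hl ↦ ?_
    have : P.asIdeal.LiesOver l.last.asIdeal := ⟨by rw [hl]; rfl⟩
    obtain ⟨L, hlen, hlast, -⟩ := Ideal.exists_ltSeries_of_hasGoingDown l P.asIdeal
    rw [← hlen]
    exact Order.length_le_height (by rw [hlast])
  · refine Order.height_le_height_apply_of_strictMono _ (fun P Q h ↦ ?_) P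
    exact Ideal.comap_lt_comap_of_integral_mem_sdiff h.le
      (Set.exists_of_ssubset h).choose_spec (Algebra.IsIntegral.isIntegral _)

theorem ringKrullDim_le_of_isIntegral {A S : Type*} [CommRing A] [CommRing S]
    [Algebra A S] [Algebra.IsIntegral A S] : ringKrullDim S ≤ ringKrullDim A :=
  Order.krullDim_le_of_strictMono (PrimeSpectrum.comap (algebraMap A S)) fun _ _ h ↦
    Ideal.comap_lt_comap_of_integral_mem_sdiff h.le
      (Set.exists_of_ssubset h).choose_spec (Algebra.IsIntegral.isIntegral _)

end Heights

section PowerSeriesNormal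

open PowerSeries

theorem PowerSeries.exists_map_eq_of_X_pow_mul_eq {A K : Type*} [CommRing A] [CommRing K]
    (f : A →+* K) {n : ℕ} {u : K⟦X⟧} {g : A⟦X⟧} (h : X ^ n * u = map f g) :
    ∃ g' : A⟦X⟧, u = map f g' := by
  refine ⟨mk fun i ↦ coeff (i + n) g, ?_⟩
  ext i
  have := congrArg (coeff (i + n)) h
  rw [coeff_X_pow_mul, coeff_map] at this
  simpa using this

theorem PowerSeries.exists_map_eq_of_forall_mul_pow {A K : Type*} [CommRing A] [IsDomain A]
    [IsNoetherianRing A] [IsIntegrallyClosed A] [Field K] [Algebra A K] [IsFractionRing A K]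
    {c : A⟦X⟧} (hc : c ≠ 0) {w : K⟦X⟧}
    (hw : ∀ n, ∃ g : A⟦X⟧, map (algebraMap A K) c * w ^ n = map (algebraMap A K) g) :
    ∃ g : A⟦X⟧, map (algebraMap A K) g = w := by
  wlog hc0 : constantCoeff c ≠ 0 generalizing c
  · refine this (c := divXPowOrder c)
      (fun h ↦ hc (by rw [← constantCoeff_divXPowOrder_eq_zero_iff, h, map_zero])) (fun n ↦ ?_)
      (by rwa [ne_eq, constantCoeff_divXPowOrder_eq_zero_iff])
    obtain ⟨g, hg⟩ := hw n
    rw [← X_pow_order_mul_divXPowOrder (f := c), map_mul, map_pow, map_X, mul_assoc] at hg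
    exact exists_map_eq_of_X_pow_mul_eq _ hg
  have key : ∀ w : K⟦X⟧, (∀ n, ∃ g : A⟦X⟧,
      map (algebraMap A K) c * w ^ n = map (algebraMap A K) g) →
      ∃ a : A, algebraMap A K a = constantCoeff w := by
    intro w hw
    have hint : IsIntegral A (constantCoeff w) := by
      apply IsAlmostIntegral.isIntegral
      refine ⟨constantCoeff c, mem_nonZeroDivisors_of_ne_zero hc0, fun n ↦ ?_⟩
      obtain ⟨g, hg⟩ := hw n
      refine ⟨constantCoeff g, ?_⟩
      have := congrArg constantCoeff hg
      rw [map_mul, map_pow] at this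
      simp only [← coeff_zero_eq_constantCoeff_apply, coeff_map] at this ⊢
      rw [← this, Algebra.smul_def]
    exact IsIntegrallyClosed.isIntegral_iff.mp hint
  have step : ∀ n : ℕ, ∀ w : K⟦X⟧, (∀ n, ∃ g : A⟦X⟧,
      map (algebraMap A K) c * w ^ n = map (algebraMap A K) g) →
      ∃ a : A, algebraMap A K a = coeff n w := by
    intro n
    induction n with
    | zero => simpa using key
    | succ n ih =>
      intro w hw
      obtain ⟨a, ha⟩ := key w hw
      obtain ⟨w', hw'⟩ : X ∣ w - C (constantCoeff w) := by simp [X_dvd_iff]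
      have : ∀ n, ∃ g : A⟦X⟧, map (algebraMap A K) c * w' ^ n = map (algebraMap A K) g := by
        intro n
        choose G hG using hw
        have h1 : map (algebraMap A K) c * (w - C (constantCoeff w)) ^ n =
            map (algebraMap A K) (∑ i ∈ Finset.range (n + 1),
              G i * (C (-a)) ^ (n - i) * (n.choose i : A⟦X⟧)) := by
          rw [sub_eq_add_neg, add_pow, Finset.mul_sum, map_sum]
          refine Finset.sum_congr rfl fun i _ ↦ ?_
          simp only [map_mul, ← hG, map_pow, map_natCast, map_C, map_neg, ha]
          ring
        rw [hw', mul_pow, mul_left_comm] at h1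
        exact exists_map_eq_of_X_pow_mul_eq _ h1
      obtain ⟨b, hb⟩ := ih w' this
      refine ⟨b, hb.trans ?_⟩
      have := congrArg (coeff (n + 1)) hw'
      rw [coeff_succ_X_mul] at this
      simpa [coeff_C] using this.symm
  choose a ha using fun n ↦ step n w hw
  exact ⟨mk a, by ext n; simp [ha]⟩

instance PowerSeries.isIntegrallyClosed {A : Type*} [CommRing A] [IsDomain A]
    [IsNoetherianRing A] [IsIntegrallyClosed A] : IsIntegrallyClosed A⟦X⟧ := by
  let K := FractionRing A
  let F := FractionRing A⟦X⟧
  let G := FractionRing K⟦X⟧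
  have hinj : Function.Injective (map (algebraMap A K)) :=
    map_injective _ (IsFractionRing.injective A K)
  let j : F →+* G := IsFractionRing.map hinj
  have hj : ∀ a : A⟦X⟧, j (algebraMap _ F a) = algebraMap _ G (map (algebraMap A K) a) :=
    fun a ↦ IsLocalization.map_eq _ a
  rw [isIntegrallyClosed_iff F]
  intro x hx
  obtain ⟨r, hr, hr'⟩ := hx.isAlmostIntegral
  have hjx : IsIntegral K⟦X⟧ (j x) := by
    obtain ⟨q, hq, hq'⟩ := hx
    refine ⟨q.map (map (algebraMap A K)), hq.map _, ?_⟩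
    have hcomp : j.comp (algebraMap _ F) = (algebraMap _ G).comp (map (algebraMap A K)) :=
      RingHom.ext hj
    rw [Polynomial.eval₂_map, ← hcomp, ← Polynomial.hom_eval₂, hq', map_zero]
  obtain ⟨w, hw⟩ := IsIntegrallyClosed.isIntegral_iff.mp hjx
  obtain ⟨g, hg⟩ := exists_map_eq_of_forall_mul_pow (K := K) (nonZeroDivisors.ne_zero hr) (w := w)
    fun n ↦ by
      obtain ⟨g, hg⟩ := hr' n
      refine ⟨g, IsFractionRing.injective K⟦X⟧ G ?_⟩
      rw [← hj g, hg, Algebra.smul_def, map_mul, map_mul, map_pow, map_pow, hj, hw]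
  exact ⟨g, j.injective (by rw [hj, hg, hw])⟩

end PowerSeriesNormal

section PowerSeriesEval

open PowerSeries

theorem PowerSeries.exists_ringHom_C_X {A R : Type*} [CommRing A] [CommRing R] (I : Ideal R)
    [IsAdicComplete I R] (ψ : A →+* R) {r : R} (hr : r ∈ I) :
    ∃ φ : A⟦X⟧ →+* R, φ.comp C = ψ ∧ φ X = r := by
  have hdvd : ∀ (n : ℕ) {p q : Polynomial A}, (∀ i < n, p.coeff i = q.coeff i) →
      Ideal.Quotient.mk (I ^ n) (p.eval₂ ψ r) = Ideal.Quotient.mk (I ^ n) (q.eval₂ ψ r) := by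
    intro n p q h
    obtain ⟨s, hs⟩ : Polynomial.X ^ n ∣ p - q :=
      Polynomial.X_pow_dvd_iff.mpr fun i hi ↦ by simp [h i hi]
    rw [Ideal.Quotient.eq, ← Polynomial.eval₂_sub, hs, Polynomial.eval₂_mul,
      Polynomial.eval₂_X_pow]
    exact Ideal.mul_mem_right _ _ (Ideal.pow_mem_pow hr n)
  let f : (n : ℕ) → A⟦X⟧ →+* R ⧸ I ^ n := fun n ↦
    { toFun g := Ideal.Quotient.mk (I ^ n) ((trunc n g).eval₂ ψ r)
      map_one' := by
        rw [← map_one (Ideal.Quotient.mk (I ^ n)), ← Polynomial.eval₂_one ψ r]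
        refine hdvd n fun i hi ↦ ?_
        simp [coeff_trunc, hi, coeff_one, Polynomial.coeff_one]
      map_zero' := by simp
      map_add' p q := by simp [Polynomial.eval₂_add]
      map_mul' p q := by
        rw [← map_mul, ← Polynomial.eval₂_mul]
        refine hdvd n fun i hi ↦ ?_
        rw [coeff_trunc, if_pos hi, coeff_mul, Polynomial.coeff_mul]
        refine Finset.sum_congr rfl fun x hx ↦ ?_
        have := Finset.HasAntidiagonal.mem_antidiagonal.mp hx
        rw [coeff_trunc, coeff_trunc, if_pos (by omega), if_pos (by omega)] }
  have hf : ∀ {m n : ℕ} (hle : m ≤ n), (Ideal.Quotient.factorPow I hle).comp (f n) = f m := by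
    intro m n hle
    ext g
    change Ideal.Quotient.mk (I ^ m) _ = Ideal.Quotient.mk (I ^ m) _
    refine hdvd m fun i hi ↦ ?_
    rw [coeff_trunc, coeff_trunc, if_pos hi, if_pos (by omega)]
  refine ⟨IsAdicComplete.liftRingHom I f hf, ?_, ?_⟩
  · ext a
    refine (IsHausdorff.eq_iff_smodEq (I := I)).mpr fun n ↦ ?_
    rw [smul_eq_mul, Ideal.mul_top, SModEq.idealQuotientMk, RingHom.comp_apply,
      IsAdicComplete.mk_liftRingHom, ← Polynomial.eval₂_C ψ r]
    refine hdvd n fun i hi ↦ ?_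
    rw [coeff_trunc, if_pos hi, coeff_C, Polynomial.coeff_C]
  · refine (IsHausdorff.eq_iff_smodEq (I := I)).mpr fun n ↦ ?_
    rw [smul_eq_mul, Ideal.mul_top, SModEq.idealQuotientMk,
      IsAdicComplete.mk_liftRingHom, ← Polynomial.eval₂_X ψ r]
    refine hdvd n fun i hi ↦ ?_
    rw [coeff_trunc, if_pos hi, coeff_X, Polynomial.coeff_X]
    simp [eq_comm]

end PowerSeriesEval

theorem Ideal.mem_smul_top_pi_iff {A ι : Type*} [CommRing A] [Finite ι] {J : Ideal A}
    {x : ι → A} : x ∈ (J • ⊤ : Submodule A (ι → A)) ↔ ∀ i, x i ∈ J := by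
  classical
  have := Fintype.ofFinite ι
  refine ⟨fun h i ↦ ?_, fun h ↦ ?_⟩
  · induction h using Submodule.smul_induction_on' with
    | smul r hr n hn => exact J.mul_mem_right _ hr
    | add x hx y hy h₁ h₂ => exact J.add_mem h₁ h₂
  · rw [pi_eq_sum_univ x]
    exact Submodule.sum_mem _ fun i _ ↦
      Submodule.smul_mem_smul (h i) (Submodule.mem_top (x := fun j ↦ if i = j then (1 : A) else 0))

instance IsPrecomplete.pi {A ι : Type*} [CommRing A] [Finite ι] (I : Ideal A)
    [IsPrecomplete I A] : IsPrecomplete I (ι → A) := by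
  refine ⟨fun f hf ↦ ?_⟩
  have H : ∀ i, ∃ L : A, ∀ n, f n i ≡ L [SMOD (I ^ n • ⊤ : Submodule A A)] := fun i ↦ by
    refine IsPrecomplete.prec inferInstance fun {m n} hmn ↦ ?_
    have := Ideal.mem_smul_top_pi_iff.mp (SModEq.sub_mem.mp (hf hmn)) i
    rw [SModEq.sub_mem, smul_eq_mul, Ideal.mul_top]
    exact this
  choose L hL using H
  refine ⟨L, fun n ↦ SModEq.sub_mem.mpr (Ideal.mem_smul_top_pi_iff.mpr fun i ↦ ?_)⟩
  have := SModEq.sub_mem.mp (hL i n)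
  rwa [smul_eq_mul, Ideal.mul_top] at this

section FiniteModulo

/-- `R ⧸ J` is a finite module along `φ : A →+* R`. -/
def RingHom.IsFiniteModulo {A R : Type*} [CommRing A] [CommRing R] (φ : A →+* R)
    (J : Ideal R) : Prop :=
  ∃ (ι : Type) (_ : Fintype ι) (s : ι → R), ∀ x, ∃ c : ι → A, x - ∑ i, φ (c i) * s i ∈ J

namespace RingHom.IsFiniteModulo

variable {A R : Type*} [CommRing A] [CommRing R] {φ : A →+* R} {J : Ideal R}

theorem finite (h : φ.IsFiniteModulo ⊥) : φ.Finite := by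
  obtain ⟨ι, _, s, hs⟩ := h
  algebraize [φ]
  refine Module.Finite.of_surjective (Fintype.linearCombination A s) fun x ↦ ?_
  obtain ⟨c, hc⟩ := hs x
  refine ⟨c, ?_⟩
  simp only [Fintype.linearCombination_apply, Algebra.smul_def]
  exact (sub_eq_zero.mp hc).symm

theorem of_surjective (h : ∀ x, ∃ a, x - φ a ∈ J) : φ.IsFiniteModulo J :=
  ⟨Unit, inferInstance, 1, fun x ↦ let ⟨a, ha⟩ := h x; ⟨fun _ ↦ a, by simpa using ha⟩⟩

theorem mono {J' : Ideal R} (h : φ.IsFiniteModulo J) (hJ : J ≤ J') : φ.IsFiniteModulo J' :=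
  let ⟨ι, i, s, hs⟩ := h
  ⟨ι, i, s, fun x ↦ (hs x).imp fun _ hc ↦ hJ hc⟩

theorem pow_of_surjective {m : Ideal R} (hm : m.FG) (h : ∀ x, ∃ a, x - φ a ∈ m) (n : ℕ) :
    φ.IsFiniteModulo (m ^ n) := by
  induction n with
  | zero => exact ⟨Empty, inferInstance, Empty.elim, fun x ↦ ⟨Empty.elim, by simp⟩⟩
  | succ n ih =>
    obtain ⟨ι, _, s, hs⟩ := ih
    obtain ⟨k, t, ht⟩ := Submodule.fg_iff_exists_fin_generating_family.mp (hm.pow (n := n))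
    refine ⟨ι ⊕ Fin k, inferInstance, Sum.elim s t, fun x ↦ ?_⟩
    obtain ⟨c, hc⟩ := hs x
    rw [← ht] at hc
    obtain ⟨b, hb⟩ := (Submodule.mem_span_range_iff_exists_fun R).mp hc
    choose a ha using h
    refine ⟨Sum.elim c fun j ↦ a (b j), ?_⟩
    have : x - ∑ i, φ (Sum.elim c (fun j ↦ a (b j)) i) * Sum.elim s t i =
        ∑ j, (b j - φ (a (b j))) * t j := by
      simp only [Fintype.sum_sum_type, Sum.elim_inl, Sum.elim_inr, sub_mul,
        Finset.sum_sub_distrib, ← sub_sub, ← hb, smul_eq_mul]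
    rw [this, pow_succ']
    refine Ideal.sum_mem _ fun j _ ↦ Ideal.mul_mem_mul (ha _) ?_
    rw [← ht]
    exact Submodule.subset_span ⟨j, rfl⟩

theorem of_sup_span_singleton [IsNoetherianRing R] [IsLocalRing R] {a : A}
    [IsPrecomplete (Ideal.span {a}) A] (ha : φ a ∈ IsLocalRing.maximalIdeal R)
    (h : φ.IsFiniteModulo (J ⊔ Ideal.span {φ a})) : φ.IsFiniteModulo J := by
  obtain ⟨ι, _, s, hs⟩ := h
  algebraize [φ]
  have hH : IsHausdorff (Ideal.span {a}) (R ⧸ J) := by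
    rw [← IsHausdorff.map_algebraMap_iff (S := R), Ideal.map_span, Set.image_singleton]
    refine IsHausdorff.of_le_jacobson _ _ ?_
    rw [Ideal.span_singleton_le_iff_mem]
    exact IsLocalRing.maximalIdeal_le_jacobson _ ha
  let f : (ι → A) →ₗ[A] R ⧸ J := Fintype.linearCombination A fun i ↦ Ideal.Quotient.mk J (s i)
  have hf : ∀ c, f c = Ideal.Quotient.mk J (∑ i, φ (c i) * s i) := fun c ↦ by
    simp only [f, Fintype.linearCombination_apply, map_sum]
    rfl
  have : Function.Surjective f := by
    refine surjective_of_mkQ_comp_surjective (I := Ideal.span {a}) fun y ↦ ?_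
    obtain ⟨y, rfl⟩ := Submodule.mkQ_surjective _ y
    obtain ⟨x, rfl⟩ := Ideal.Quotient.mk_surjective y
    obtain ⟨c, hc⟩ := hs x
    refine ⟨c, ?_⟩
    obtain ⟨j, hj, z, hz, hjz⟩ := Submodule.mem_sup.mp hc
    obtain ⟨t, rfl⟩ := Ideal.mem_span_singleton'.mp hz
    rw [LinearMap.comp_apply, ← sub_eq_zero, ← map_sub, Submodule.mkQ_apply,
      Submodule.Quotient.mk_eq_zero, hf, ← map_sub, ← neg_sub, ← hjz, neg_add, map_add,
      Ideal.Quotient.eq_zero_iff_mem.mpr (neg_mem hj), zero_add, map_neg, neg_mem_iff]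
    have : Ideal.Quotient.mk J (t * φ a) = a • Ideal.Quotient.mk J t := by
      rw [mul_comm]
      rfl
    rw [this]
    exact Submodule.smul_mem_smul (Ideal.mem_span_singleton_self a) Submodule.mem_top
  refine ⟨ι, inferInstance, s, fun x ↦ ?_⟩
  obtain ⟨c, hc⟩ := this (Ideal.Quotient.mk J x)
  exact ⟨c, Ideal.Quotient.eq.mp (hc.symm.trans (hf c))⟩

end RingHom.IsFiniteModulo

open PowerSeries in
theorem PowerSeries.ringKrullDim_le_add_one {A : Type*} [CommRing A] [IsNoetherianRing A] :
    ringKrullDim (PowerSeries A) ≤ ringKrullDim A + 1 := by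
  have hX : ((({X} : Finset A⟦X⟧) : Set A⟦X⟧)) ⊆ Ring.jacobson A⟦X⟧ := by
    rw [Finset.coe_singleton, Set.singleton_subset_iff, SetLike.mem_coe, ← Ideal.jacobson_bot]
    exact IsAdicComplete.le_jacobson_bot (Ideal.span {X}) (Ideal.mem_span_singleton_self X)
  refine (ringKrullDim_le_ringKrullDim_quotient_add_card {X} hX).trans ?_
  rw [Finset.card_singleton, Nat.cast_one]
  gcongr
  refine ringKrullDim_le_of_surjective ((Ideal.Quotient.mk _).comp C) fun y ↦ ?_
  obtain ⟨f, rfl⟩ := Ideal.Quotient.mk_surjective y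
  refine ⟨constantCoeff f, Ideal.Quotient.eq.mpr ?_⟩
  rw [Finset.coe_singleton, Ideal.mem_span_singleton, X_dvd_iff]
  simp

theorem RingHom.exists_isFiniteModulo_of_list.{u, v} {V : Type u} {R : Type v} [CommRing V]
    [IsDomain V] [IsNoetherianRing V] [IsIntegrallyClosed V] [CommRing R] [IsNoetherianRing R]
    [IsLocalRing R] [IsAdicComplete (IsLocalRing.maximalIdeal R) R] (ψ : V →+* R) (l : List R)
    (hl : ∀ r ∈ l, r ∈ IsLocalRing.maximalIdeal R) :
    ∃ (A : Type u) (_ : CommRing A) (_ : IsDomain A) (_ : IsNoetherianRing A)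
      (_ : IsIntegrallyClosed A) (φ : A →+* R), ringKrullDim A ≤ ringKrullDim V + l.length ∧
      ∀ J : Ideal R, ψ.IsFiniteModulo (J ⊔ Ideal.span {r | r ∈ l}) → φ.IsFiniteModulo J := by
  induction l with
  | nil => exact ⟨V, _, ‹_›, ‹_›, ‹_›, ψ, by simp, fun J h ↦ by simpa using h⟩
  | cons r l ih =>
    obtain ⟨A, _, _, _, _, φ, hA, hφ⟩ := ih fun r hr ↦ hl r (List.mem_cons_of_mem _ hr)
    obtain ⟨Φ, hΦ, hX⟩ := PowerSeries.exists_ringHom_C_X _ φ (hl r List.mem_cons_self)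
    refine ⟨PowerSeries A, _, inferInstance, inferInstance, inferInstance, Φ, ?_, fun J h ↦ ?_⟩
    · refine PowerSeries.ringKrullDim_le_add_one.trans ?_
      rw [List.length_cons, Nat.cast_add, Nat.cast_one, ← add_assoc]
      gcongr
    · refine .of_sup_span_singleton (a := PowerSeries.X) (by simpa [hX] using hl r) ?_
      have : {x | x ∈ r :: l} = insert r {x | x ∈ l} := by ext; simp
      rw [this, Ideal.span_insert, ← sup_assoc] at h
      obtain ⟨ι, i, s, hs⟩ := hφ _ h
      refine ⟨ι, i, s, fun x ↦ ?_⟩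
      obtain ⟨c, hc⟩ := hs x
      refine ⟨fun i ↦ PowerSeries.C (c i), ?_⟩
      rw [hX]
      convert hc using 4
      rw [← hΦ]
      rfl

end FiniteModulo

section Normalization

open IsLocalRing

theorem IsLocalRing.exists_list_pow_maximalIdeal_le (R : Type*) [CommRing R] [IsNoetherianRing R]
    [IsLocalRing R] :
    ∃ l : List R, (∀ r ∈ l, r ∈ maximalIdeal R) ∧ (l.length : WithBot ℕ∞) = ringKrullDim R ∧
      ∃ N, maximalIdeal R ^ N ≤ Ideal.span {r | r ∈ l} := by
  obtain ⟨s, hs, hcard⟩ :=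
    (maximalIdeal R).exists_finset_card_eq_height_of_isNoetherianRing
  refine ⟨s.toList, fun r hr ↦ hs.1.2 (Ideal.subset_span (Finset.mem_toList.mp hr)), ?_, ?_⟩
  · rw [Finset.length_toList, ← maximalIdeal_height_eq_ringKrullDim, ← hcard]
    rfl
  · have : {r | r ∈ s.toList} = (s : Set R) := by ext; simp
    rw [this]
    refine Ideal.exists_pow_le_of_le_radical_of_fg ?_ (IsNoetherian.noetherian _)
    rw [Ideal.radical_eq_sInf]
    exact le_sInf fun P ⟨hP, hPp⟩ ↦ hs.2 ⟨hPp, hP⟩ (le_maximalIdeal hPp.ne_top)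

theorem IsLocalRing.exists_list_pow_maximalIdeal_le_sup {R : Type*} [CommRing R]
    [IsNoetherianRing R] [IsLocalRing R] {J : Ideal R} (hJ : J ≠ ⊤) :
    ∃ l : List R, (∀ r ∈ l, r ∈ maximalIdeal R) ∧
      (l.length : WithBot ℕ∞) = ringKrullDim (R ⧸ J) ∧
      ∃ N, maximalIdeal R ^ N ≤ Ideal.span {r | r ∈ l} ⊔ J := by
  have : Nontrivial (R ⧸ J) := Ideal.Quotient.nontrivial_iff.mpr hJ
  have : IsLocalRing (R ⧸ J) :=
    IsLocalRing.of_surjective' (Ideal.Quotient.mk J) Ideal.Quotient.mk_surjective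
  have hloc : IsLocalHom (Ideal.Quotient.mk J) :=
    IsLocalHom.of_surjective _ Ideal.Quotient.mk_surjective
  obtain ⟨l, hl, hlen, N, hN⟩ := exists_list_pow_maximalIdeal_le (R ⧸ J)
  let σ : R ⧸ J → R := Function.surjInv Ideal.Quotient.mk_surjective
  have hσ : ∀ y, Ideal.Quotient.mk J (σ y) = y := Function.surjInv_eq _
  refine ⟨l.map σ, fun r hr ↦ ?_, by rwa [List.length_map], N, fun x hx ↦ ?_⟩
  · obtain ⟨y, hy, rfl⟩ := List.mem_map.mp hr
    have := hl y hy
    rw [mem_maximalIdeal, mem_nonunits_iff] at this ⊢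
    exact fun h ↦ this (hσ y ▸ h.map (Ideal.Quotient.mk J))
  · rw [← Ideal.mem_quotient_iff_mem_sup, Ideal.map_span]
    have h1 : Ideal.Quotient.mk J '' {r | r ∈ l.map σ} = {r | r ∈ l} := by
      ext y
      simp [hσ]
    rw [h1]
    apply hN
    have h2 : (maximalIdeal R).map (Ideal.Quotient.mk J) ≤ maximalIdeal (R ⧸ J) :=
      ((local_hom_TFAE (Ideal.Quotient.mk J)).out 0 2).mp hloc
    refine Ideal.pow_right_mono h2 N ?_
    rw [← Ideal.map_pow]
    exact Ideal.mem_map_of_mem _ hx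

/-- There is an integrally closed domain with an injective integral map to `R`. -/
def HasNormalSubring.{u, v} (R : Type v) [CommRing R] : Prop :=
  ∃ (A : Type u) (_ : CommRing A) (_ : IsDomain A) (_ : IsIntegrallyClosed A) (φ : A →+* R),
    Function.Injective φ ∧ φ.IsIntegral

theorem HasNormalSubring.of_isFiniteModulo.{u, v} {V : Type u} {R : Type v} [CommRing V]
    [IsDomain V] [IsNoetherianRing V] [IsIntegrallyClosed V] [CommRing R] [IsNoetherianRing R]
    [IsLocalRing R] [IsDomain R] [IsAdicComplete (maximalIdeal R) R] (ψ : V →+* R) (l : List R)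
    (hl : ∀ r ∈ l, r ∈ maximalIdeal R) (hdim : ringKrullDim V + l.length ≤ ringKrullDim R)
    (h : ψ.IsFiniteModulo (Ideal.span {r | r ∈ l})) : HasNormalSubring.{u} R := by
  obtain ⟨A, _, _, _, _, φ, hA, hφ⟩ := RingHom.exists_isFiniteModulo_of_list ψ l hl
  have hfin : φ.Finite := (hφ ⊥ (by rwa [bot_sup_eq])).finite
  refine ⟨A, _, ‹_›, ‹_›, φ, ?_, hfin.to_isIntegral⟩
  rw [injective_iff_map_eq_zero]
  intro a ha
  by_contra ha0
  have h1 := ringKrullDim_quotient_succ_le_of_nonZeroDivisor (mem_nonZeroDivisors_of_ne_zero ha0)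
  let φ' : A ⧸ Ideal.span {a} →+* R := Ideal.Quotient.lift _ φ fun b hb ↦ by
    obtain ⟨c, rfl⟩ := Ideal.mem_span_singleton'.mp hb
    rw [map_mul, ha, mul_zero]
  have hφ' : φ'.IsIntegral := RingHom.IsIntegral.tower_top (Ideal.Quotient.mk _) φ'
    (by
      have : φ'.comp (Ideal.Quotient.mk _) = φ := RingHom.ext fun _ ↦ rfl
      rw [this]
      exact hfin.to_isIntegral)
  algebraize [φ']
  have h2 := ringKrullDim_le_of_isIntegral (A := A ⧸ Ideal.span {a}) (S := R)
  have h3 : ringKrullDim R + 1 ≤ ringKrullDim R :=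
    (add_le_add_left h2 1).trans (h1.trans (hA.trans hdim))
  obtain ⟨n, hn⟩ : ∃ n : ℕ, ringKrullDim R = n := by
    obtain ⟨l, -, hl, -⟩ := IsLocalRing.exists_list_pow_maximalIdeal_le R
    exact ⟨_, hl.symm⟩
  rw [hn] at h3
  norm_cast at h3
  omega

theorem HasNormalSubring.of_field.{u, v} {V : Type u} {R : Type v} [CommRing V] [CommRing R]
    [IsNoetherianRing R] [IsLocalRing R] [IsDomain R] [IsAdicComplete (maximalIdeal R) R] (ψ : V →+* R)
    (hV : IsField V) (hψ : ∀ x, ∃ a, x - ψ a ∈ maximalIdeal R) : HasNormalSubring.{u} R := by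
  obtain ⟨l, hl, hlen, N, hN⟩ := exists_list_pow_maximalIdeal_le R
  have hdom : IsDomain V := hV.isDomain
  have hnoeth : IsNoetherianRing V := let _ := hV.toField; inferInstance
  have hnormal : IsIntegrallyClosed V := let _ := hV.toField; inferInstance
  refine .of_isFiniteModulo ψ l hl ?_
    ((RingHom.IsFiniteModulo.pow_of_surjective (IsNoetherian.noetherian _) hψ N).mono hN)
  rw [ringKrullDim_eq_zero_of_isField hV, zero_add, hlen]

theorem HasNormalSubring.of_uniformizer.{u, v} {V : Type u} {R : Type v} [CommRing V]
    [IsDomain V] [IsPrincipalIdealRing V] [CommRing R] [IsNoetherianRing R]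
    [IsLocalRing R] [IsDomain R] [IsAdicComplete (maximalIdeal R) R] (ψ : V →+* R)
    (hψ : ∀ x, ∃ a, x - ψ a ∈ maximalIdeal R) {π : V} (hπ : ψ π ∈ maximalIdeal R)
    (hπ0 : ψ π ≠ 0) [IsPrecomplete (Ideal.span {π}) V] : HasNormalSubring.{u} R := by
  obtain ⟨l, hl, hlen, N, hN⟩ := exists_list_pow_maximalIdeal_le_sup (J := Ideal.span {ψ π})
    (fun h ↦ (maximalIdeal.isMaximal R).ne_top
      (top_le_iff.mp (h ▸ (Ideal.span_singleton_le_iff_mem _).mpr hπ)))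
  have : ringKrullDim V ≤ 1 := Ring.krullDimLE_iff.mp inferInstance
  refine .of_isFiniteModulo ψ l hl ?_ (.of_sup_span_singleton hπ
    ((RingHom.IsFiniteModulo.pow_of_surjective (IsNoetherian.noetherian _) hψ N).mono hN))
  rw [hlen, add_comm]
  exact (add_le_add_right this _).trans
    (ringKrullDim_quotient_succ_le_of_nonZeroDivisor (mem_nonZeroDivisors_of_ne_zero hπ0))

theorem height_comap_integralClosure_of_hasNormalSubring {R : Type*} [CommRing R] [IsDomain R]
    (hR : HasNormalSubring R) (P : PrimeSpectrum (integralClosure R (FractionRing R))) :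
    Order.height (PrimeSpectrum.comap (algebraMap R _) P) = Order.height P := by
  obtain ⟨A, _, _, _, φ, hinj, hint⟩ := hR
  algebraize [φ]
  let B := integralClosure R (FractionRing R)
  let _ : Algebra A B := ((algebraMap R B).comp φ).toAlgebra
  have : IsScalarTower A R B := .of_algebraMap_eq' rfl
  have : Algebra.IsIntegral A B := Algebra.IsIntegral.trans R
  have : FaithfulSMul A R := (faithfulSMul_iff_algebraMap_injective A R).mpr hinj
  have : FaithfulSMul R B := (faithfulSMul_iff_algebraMap_injective R B).mpr fun x y h ↦
    IsFractionRing.injective R (FractionRing R) (congrArg (algebraMap B (FractionRing R)) h)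
  have : FaithfulSMul A B := FaithfulSMul.trans A R B
  rw [← PrimeSpectrum.height_comap_of_isIntegral_of_hasGoingDown (A := A) P,
    ← PrimeSpectrum.height_comap_of_isIntegral_of_hasGoingDown (A := A)
      (PrimeSpectrum.comap (algebraMap R B) P)]
  rfl

end Normalization

section ResidueCharZero

open IsLocalRing

theorem Algebra.FormallySmooth.of_charZero (k : Type*) [Field k] [Algebra ℚ k] :
    Algebra.FormallySmooth ℚ k := by
  have : CharZero k := algebraRat.charZero k
  obtain ⟨s, hs⟩ := exists_isTranscendenceBasis ℚ k
  have : Algebra.IsAlgebraic (IntermediateField.adjoin ℚ (Set.range (Subtype.val : s → k))) k :=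
    hs.isAlgebraic_field
  have : CharZero (IntermediateField.adjoin ℚ (Set.range (Subtype.val : s → k))) :=
    algebraRat.charZero _
  exact .of_algebraicIndependent_of_isSeparable hs.1

theorem HasNormalSubring.of_charZero_residueField.{u} {R : Type u} [CommRing R]
    [IsNoetherianRing R] [IsLocalRing R] [IsDomain R] [IsAdicComplete (maximalIdeal R) R]
    [CharZero (R ⧸ maximalIdeal R)] : HasNormalSubring.{u} R := by
  obtain ⟨_⟩ : Nonempty (Algebra ℚ R) := (EqualCharZero.nonempty_algebraRat_iff R).mpr fun I hI ↦
    (Ideal.Quotient.factor (le_maximalIdeal hI)).charZero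
  have : Algebra.FormallySmooth ℚ (R ⧸ maximalIdeal R) :=
    @Algebra.FormallySmooth.of_charZero _ (Ideal.Quotient.field _) _
  obtain ⟨g, hg⟩ := Algebra.FormallySmooth.exists_mkₐ_comp_eq_of_isAdicComplete
    (I := maximalIdeal R) (AlgHom.id ℚ (R ⧸ maximalIdeal R))
  refine .of_field g.toRingHom
    ((Ideal.Quotient.maximal_ideal_iff_isField_quotient _).mp inferInstance) fun x ↦
    ⟨Ideal.Quotient.mk _ x, Ideal.Quotient.eq.mp ?_⟩
  exact (DFunLike.congr_fun hg (Ideal.Quotient.mk _ x)).symm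

end ResidueCharZero

section PBasis

open MvPolynomial

variable (k : Type*) [Field k] (p : ℕ)

/-- Evaluation of polynomials with variables indexed by `k` at the elements of `k`, with the
Frobenius acting on the coefficients. -/
noncomputable def frobeniusEval [ExpChar k p] : MvPolynomial k k →+* k :=
  eval₂Hom (frobenius k p) id

variable {k} in
/-- The ideal of `k[X]` generated by the `X i ^ p - i` for `i ∈ s`. -/
noncomputable def pthRootIdeal (s : Set k) : Ideal (MvPolynomial k k) :=
  Ideal.span {P | ∃ i ∈ s, P = X i ^ p - C i}

/-- `p`-independence of a set of elements of a field. -/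
def IsPIndependent [ExpChar k p] (s : Set k) : Prop :=
  ∀ P ∈ supported k s, frobeniusEval k p P = 0 → P ∈ pthRootIdeal p s

variable {k p}

theorem pthRootIdeal_mono {s t : Set k} (h : s ⊆ t) : pthRootIdeal p s ≤ pthRootIdeal p t :=
  Ideal.span_mono fun _ ⟨i, hi, hP⟩ ↦ ⟨i, h hi, hP⟩

variable [ExpChar k p]

theorem isPIndependent_empty : IsPIndependent k p ∅ := by
  intro P hP h0
  rw [supported_empty, Algebra.mem_bot] at hP
  obtain ⟨a, rfl⟩ := hP
  rw [algebraMap_eq, frobeniusEval, coe_eval₂Hom, eval₂_C] at h0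
  rw [(map_eq_zero _).mp h0, map_zero]
  exact zero_mem _

theorem IsPIndependent.insert [Fact p.Prime] {s : Set k} (hs : IsPIndependent k p s) {a : k}
    (ha : ∀ P ∈ supported k s, frobeniusEval k p P ≠ a) : IsPIndependent k p (insert a s) := by
  intro P hP h0
  let A := supported k s
  let f : A →+* k := (frobeniusEval k p).comp A.val.toRingHom
  have hfC : ∀ x : k, f (algebraMap k A x) = x ^ p := fun x ↦ by
    simp only [f, frobeniusEval, RingHom.comp_apply]
    exact eval₂_C _ _ _
  let L : Subfield k :=
    { f.range with
      inv_mem' := by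
        rintro _ ⟨y, rfl⟩
        by_cases hy : f y = 0
        · exact ⟨0, by rw [hy, map_zero, inv_zero]⟩
        · refine ⟨algebraMap k A (f y)⁻¹ * y ^ (p - 1), ?_⟩
          rw [map_mul, hfC, map_pow]
          have : (f y) ^ p = f y ^ (p - 1) * f y := by
            rw [← pow_succ, Nat.sub_add_cancel (Fact.out : p.Prime).one_le]
          rw [inv_pow, this]
          field_simp }
  have hL : ∀ x : A, f x ∈ L := fun x ↦ ⟨x, rfl⟩
  let fL : A →+* L := f.codRestrict L hL
  have hap : a ^ p ∈ L := ⟨algebraMap k A a, hfC a⟩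
  obtain ⟨q, rfl⟩ : ∃ q : Polynomial A, Polynomial.aeval (X a) q = P := by
    rw [supported_eq_adjoin_X, Set.image_insert_eq, Set.insert_eq, Set.union_comm,
      Algebra.adjoin_union_eq_adjoin_adjoin, ← supported_eq_adjoin_X,
      Subalgebra.mem_restrictScalars, Algebra.adjoin_singleton_eq_range_aeval] at hP
    exact hP
  let g : Polynomial A := Polynomial.X ^ p - Polynomial.C (algebraMap k A a)
  have hg : g.Monic := Polynomial.monic_X_pow_sub_C _ (Fact.out : p.Prime).ne_zero
  have hgP : Polynomial.aeval (X a) g ∈ pthRootIdeal p (Insert.insert a s) := by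
    refine Ideal.subset_span ⟨a, Set.mem_insert _ _, ?_⟩
    rw [Polynomial.aeval_def, Polynomial.eval₂_sub, Polynomial.eval₂_X_pow, Polynomial.eval₂_C]
    rfl
  have hirr : Irreducible (Polynomial.X ^ p - Polynomial.C (⟨a ^ p, hap⟩ : L)) := by
    refine X_pow_sub_C_irreducible_of_prime Fact.out fun b hb ↦ ?_
    have : (b : k) = a := frobenius_inj k p (congrArg Subtype.val hb)
    obtain ⟨y, hy⟩ := b.2
    exact ha y y.2 (hy.trans this)
  have hmin := minpoly.eq_of_irreducible_of_monic hirr (x := a)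
    (by simp [Algebra.algebraMap_eq_smul_one, Subfield.smul_def])
    (Polynomial.monic_X_pow_sub_C _ (Fact.out : p.Prime).ne_zero)
  have heval : ∀ r : Polynomial A,
      frobeniusEval k p (Polynomial.aeval (X a) r) = Polynomial.aeval a (r.map fL) := by
    intro r
    rw [Polynomial.aeval_def, Polynomial.hom_eval₂, Polynomial.aeval_def, Polynomial.eval₂_map]
    congr 1
    simp [frobeniusEval]
  have hmod : (q %ₘ g).map fL = 0 := by
    by_contra hne
    have hroot : Polynomial.aeval a ((q %ₘ g).map fL) = 0 := by
      have h1 : frobeniusEval k p (Polynomial.aeval (X a) g) = 0 := by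
        rw [heval, Polynomial.aeval_def, Polynomial.eval₂_map, Polynomial.eval₂_sub,
          Polynomial.eval₂_X_pow, Polynomial.eval₂_C, sub_eq_zero]
        exact (hfC a).symm
      rwa [← Polynomial.modByMonic_add_div q g, map_add, map_mul, map_add, map_mul, h1, zero_mul,
        add_zero, heval] at h0
    have h1 := minpoly.degree_le_of_ne_zero L a hne hroot
    rw [← hmin, Polynomial.degree_X_pow_sub_C (Fact.out : p.Prime).pos] at h1
    have h2 := (Polynomial.degree_map_le (f := fL)).trans_lt (Polynomial.degree_modByMonic_lt q hg)
    rw [Polynomial.degree_X_pow_sub_C (Fact.out : p.Prime).pos] at h2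
    exact absurd h1 h2.not_ge
  rw [← Polynomial.modByMonic_add_div q g, map_add, map_mul]
  refine Ideal.add_mem _ ?_ (Ideal.mul_mem_right _ _ hgP)
  rw [Polynomial.aeval_eq_sum_range]
  refine Ideal.sum_mem _ fun i _ ↦ ?_
  rw [Algebra.smul_def]
  refine Ideal.mul_mem_right _ _ (pthRootIdeal_mono (Set.subset_insert _ _)
    (hs _ (Subtype.mem _) ?_))
  have := congrArg (fun r ↦ (r.coeff i : k)) hmod
  simp only [Polynomial.coeff_map, Polynomial.coeff_zero, ZeroMemClass.coe_zero] at this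
  exact this

variable (k p) in
theorem exists_pBasis [Fact p.Prime] : ∃ s : Set k, IsPIndependent k p s ∧
    ∀ a, ∃ P ∈ supported k s, frobeniusEval k p P = a := by
  obtain ⟨s, -, hs⟩ := zorn_subset_nonempty {s : Set k | IsPIndependent k p s} (fun c hc hchain hne ↦ by
    refine ⟨⋃₀ c, fun P hP h0 ↦ ?_, fun s hs ↦ Set.subset_sUnion_of_mem hs⟩
    rw [mem_supported] at hP
    obtain ⟨t, ht, hPt⟩ := hchain.directedOn.exists_mem_subset_of_finset_subset_biUnion hne
      (by simpa [Set.sUnion_eq_biUnion] using hP)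
    exact pthRootIdeal_mono (Set.subset_sUnion_of_mem ht) (hc ht P (mem_supported.mpr hPt) h0))
    ∅ isPIndependent_empty
  refine ⟨s, hs.prop, ?_⟩
  by_contra! ⟨a, ha⟩
  have := hs.le_of_ge (hs.prop.insert ha) (Set.subset_insert _ _) (Set.mem_insert _ _)
  refine ha (X a) ((X_mem_supported).mpr this) ?_
  simp [frobeniusEval]

end PBasis

section GhostStages

open WittVector

variable {R : Type*} [CommRing R] {p : ℕ} [Fact p.Prime]

theorem WittVector.ghostComponent_eq_sum (n : ℕ) (a : WittVector p R) :
    ghostComponent n a = ∑ i ∈ Finset.range (n + 1), (p : R) ^ i * a.coeff i ^ p ^ (n - i) := by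
  rw [ghostComponent_apply, wittPolynomial_eq_sum_C_mul_X_pow, map_sum]
  simp

theorem WittVector.ghostComponent_succ_eq_shift (n : ℕ) (a : WittVector p R) :
    ghostComponent (n + 1) a = a.coeff 0 ^ p ^ (n + 1) + p * ghostComponent n (a.shift 1) := by
  rw [ghostComponent_eq_sum, Finset.sum_range_succ', ghostComponent_eq_sum, Finset.mul_sum,
    add_comm]
  congr 1
  · simp
  · refine Finset.sum_congr rfl fun i _ ↦ ?_
    rw [shift_coeff, Nat.add_sub_add_right, pow_succ, add_comm 1 i]
    ring

theorem WittVector.ghostComponent_succ_eq_pow (n : ℕ) (a : WittVector p R) :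
    ghostComponent (n + 1) a =
      ghostComponent n (.mk p fun i ↦ a.coeff i ^ p) + p ^ (n + 1) * a.coeff (n + 1) := by
  rw [ghostComponent_eq_sum, Finset.sum_range_succ, ghostComponent_eq_sum]
  congr 1
  · refine Finset.sum_congr rfl fun i hi ↦ ?_
    have : n + 1 - i = n - i + 1 := by have := Finset.mem_range.mp hi; omega
    rw [coeff_mk, ← pow_mul, ← pow_succ', this]
  · simp

theorem WittVector.ghostComponent_teichmuller_eq (n : ℕ) (x : R) :
    ghostComponent n (teichmuller p x) = x ^ p ^ n := by
  simp

theorem exists_add_pow_pow_eq (p : ℕ) [Fact p.Prime] (n : ℕ) (x y : R) : ∃ z : WittVector p R,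
    (x + y) ^ p ^ (n + 1) = x ^ p ^ (n + 1) + y ^ p ^ (n + 1) + p * ghostComponent n z := by
  let d := teichmuller p (x + y) - teichmuller p x - teichmuller p y
  refine ⟨d.shift 1, ?_⟩
  have h := ghostComponent_succ_eq_shift n d
  have h0 : d.coeff 0 = 0 := by
    change constantCoeff d = 0
    simp only [d, map_sub]
    simp [constantCoeff]
  rw [h0, zero_pow (pow_ne_zero _ (Fact.out : p.Prime).ne_zero), zero_add] at h
  rw [← h]
  simp only [d, map_sub, ghostComponent_teichmuller_eq]
  ring

variable (p) in
/-- The subring generated by the `n`-th ghost components, the set `T` and the ideal `I ^ (n + 1)`. -/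
def ghostStage (I : Ideal R) (T : Set R) (n : ℕ) : Subring R :=
  Subring.closure (Set.range (ghostComponent n : WittVector p R →+* R) ∪ T ∪ ↑(I ^ (n + 1)))

variable {I : Ideal R} {T : Set R}

theorem ghostComponent_mem_ghostStage (n : ℕ) (a : WittVector p R) :
    ghostComponent n a ∈ ghostStage p I T n :=
  Subring.subset_closure (.inl (.inl ⟨a, rfl⟩))

theorem mem_ghostStage_of_mem {n : ℕ} {x : R} (hx : x ∈ T) : x ∈ ghostStage p I T n :=
  Subring.subset_closure (.inl (.inr hx))

theorem mem_ghostStage_of_mem_pow {n : ℕ} {x : R} (hx : x ∈ I ^ (n + 1)) :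
    x ∈ ghostStage p I T n :=
  Subring.subset_closure (.inr hx)

theorem pow_mem_ghostStage (n : ℕ) (x : R) : x ^ p ^ n ∈ ghostStage p I T n := by
  rw [← ghostComponent_teichmuller_eq]
  exact ghostComponent_mem_ghostStage n _

theorem ghostStage_succ_le (hp : (p : R) ∈ I) (n : ℕ) :
    ghostStage p I T (n + 1) ≤ ghostStage p I T n := by
  refine Subring.closure_le.mpr ?_
  rintro x ((⟨a, rfl⟩ | hx) | hx)
  · rw [ghostComponent_succ_eq_pow]
    exact add_mem (ghostComponent_mem_ghostStage n _)
      (mem_ghostStage_of_mem_pow (Ideal.mul_mem_right _ _ (Ideal.pow_mem_pow hp _)))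
  · exact mem_ghostStage_of_mem hx
  · exact mem_ghostStage_of_mem_pow (Ideal.pow_le_pow_right (Nat.le_succ _) hx)

theorem ghostStage_antitone (hp : (p : R) ∈ I) : Antitone (ghostStage p I T) :=
  antitone_nat_of_succ_le (ghostStage_succ_le hp)

/-- The subring `S + q S' + J`, for subrings `S ≤ S'`, an ideal `J` and an integer `q`. -/
def Subring.addMulIdeal (S S' : Subring R) (hS : S ≤ S') (q : ℕ) (J : Ideal R) : Subring R where
  carrier := {x | ∃ y ∈ S, ∃ z ∈ S', x - (y + q * z) ∈ J}
  zero_mem' := ⟨0, zero_mem _, 0, zero_mem _, by simp⟩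
  one_mem' := ⟨1, one_mem _, 0, zero_mem _, by simp⟩
  add_mem' := by
    rintro a b ⟨y, hy, z, hz, h⟩ ⟨y', hy', z', hz', h'⟩
    refine ⟨y + y', add_mem hy hy', z + z', add_mem hz hz', ?_⟩
    convert J.add_mem h h' using 1
    ring
  neg_mem' := by
    rintro a ⟨y, hy, z, hz, h⟩
    refine ⟨-y, neg_mem hy, -z, neg_mem hz, ?_⟩
    convert J.neg_mem h using 1
    ring
  mul_mem' := by
    rintro a b ⟨y, hy, z, hz, h⟩ ⟨y', hy', z', hz', h'⟩
    refine ⟨y * y', mul_mem hy hy', y * z' + z * y' + q * (z * z'), ?_, ?_⟩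
    · exact add_mem (add_mem (mul_mem (hS hy) hz') (mul_mem hz (hS hy')))
        (mul_mem (natCast_mem _ _) (mul_mem hz hz'))
    · convert J.add_mem (J.mul_mem_right b h) (J.mul_mem_left (y + q * z) h') using 1
      ring

theorem Subring.exists_sub_mem_of_le_addMulIdeal {S S' : Subring R} {hS : S ≤ S'} {q : ℕ}
    {J : Ideal R} (h : S' ≤ S.addMulIdeal S' hS q J) {N : ℕ} (hq : (q : R) ^ N ∈ J) {x : R}
    (hx : x ∈ S') : ∃ y ∈ S, x - y ∈ J := by
  have : ∀ n : ℕ, ∃ y ∈ S, ∃ z ∈ S', x - (y + (q : R) ^ n * z) ∈ J := by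
    intro n
    induction n with
    | zero => exact ⟨0, zero_mem _, x, hx, by simp⟩
    | succ n ih =>
      obtain ⟨y, hy, z, hz, hJ⟩ := ih
      obtain ⟨y', hy', z', hz', hJ'⟩ := h hz
      refine ⟨y + q ^ n * y', add_mem hy (mul_mem (pow_mem (natCast_mem _ _) _) hy'), z', hz', ?_⟩
      convert J.add_mem hJ (J.mul_mem_left ((q : R) ^ n) hJ') using 1
      ring
  obtain ⟨y, hy, z, hz, hJ⟩ := this N
  refine ⟨y, hy, ?_⟩
  convert J.add_mem hJ (J.mul_mem_right z hq) using 1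
  ring

theorem ghostStage_exists_succ (hp : (p : R) ∈ I)
    (hT : ∀ x, ∃ y ∈ Subring.closure (Set.range (fun b : R ↦ b ^ p) ∪ T), x - y ∈ I) (n : ℕ)
    {x : R} (hx : x ∈ ghostStage p I T n) :
    ∃ y ∈ ghostStage p I T (n + 1), x - y ∈ I ^ (n + 1) := by
  induction n generalizing x with
  | zero =>
    obtain ⟨y, hy, h⟩ := hT x
    refine ⟨y, Subring.closure_le.mpr ?_ hy, by simpa using h⟩
    rintro _ (⟨b, rfl⟩ | hx)
    · simpa using pow_mem_ghostStage (p := p) (I := I) (T := T) 1 b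
    · exact mem_ghostStage_of_mem hx
  | succ n ih =>
    let G := (ghostStage p I T (n + 1 + 1)).addMulIdeal (ghostStage p I T (n + 1))
      (ghostStage_succ_le hp _) p (I ^ (n + 1 + 1))
    have hG2 : ∀ x ∈ ghostStage p I T (n + 1 + 1), x ∈ G := fun x hx ↦
      ⟨x, hx, 0, zero_mem _, by simp⟩
    have hGp : ∀ z : WittVector p R, p * ghostComponent n z ∈ G := fun z ↦ by
      obtain ⟨y, hy, h⟩ := ih (ghostComponent_mem_ghostStage n z)
      refine ⟨0, zero_mem _, y, hy, ?_⟩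
      rw [zero_add, ← mul_sub, pow_succ' I (n + 1)]
      exact Ideal.mul_mem_mul hp h
    have hGpow : ∀ x ∈ Subring.closure (Set.range (fun b : R ↦ b ^ p) ∪ T),
        x ^ p ^ (n + 1) ∈ G := by
      intro x hx
      induction hx using Subring.closure_induction with
      | mem x hx =>
        obtain (⟨b, rfl⟩ | hx) := hx
        · refine hG2 _ ?_
          simp only [← pow_mul, ← pow_succ']
          exact pow_mem_ghostStage _ _
        · exact pow_mem (hG2 _ (mem_ghostStage_of_mem hx)) _
      | zero => rw [zero_pow (pow_ne_zero _ (Fact.out : p.Prime).ne_zero)]; exact zero_mem _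
      | one => rw [one_pow]; exact one_mem _
      | add x y _ _ hx hy =>
        obtain ⟨z, hz⟩ := exists_add_pow_pow_eq p n x y
        rw [hz]
        exact add_mem (add_mem hx hy) (hGp z)
      | neg x _ hx =>
        rw [neg_pow]
        exact mul_mem (pow_mem (neg_mem (one_mem _)) _) hx
      | mul x y _ _ hx hy =>
        rw [mul_pow]
        exact mul_mem hx hy
    refine Subring.exists_sub_mem_of_le_addMulIdeal (S' := ghostStage p I T (n + 1)) (q := p)
      (hS := ghostStage_succ_le hp _) ?_ (Ideal.pow_mem_pow hp (n + 1 + 1)) hx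
    refine Subring.closure_le.mpr ?_
    rintro x ((⟨a, rfl⟩ | hx) | hx)
    · rw [ghostComponent_succ_eq_shift]
      refine add_mem ?_ (hGp _)
      obtain ⟨y, hy, h⟩ := hT (a.coeff 0)
      obtain ⟨z, hz⟩ := exists_add_pow_pow_eq p n y (a.coeff 0 - y)
      rw [add_sub_cancel] at hz
      rw [hz]
      refine add_mem (add_mem (hGpow y hy) ⟨0, zero_mem _, 0, zero_mem _, ?_⟩) (hGp z)
      rw [mul_zero, add_zero, sub_zero]
      exact Ideal.pow_le_pow_right (Nat.lt_pow_self (Fact.out : p.Prime).one_lt)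
        (Ideal.pow_mem_pow h _)
    · exact hG2 _ (mem_ghostStage_of_mem hx)
    · exact ⟨0, zero_mem _, 0, zero_mem _, by simpa using hx⟩

end GhostStages

section GhostStagesResidue

open WittVector MvPolynomial

theorem natCast_mem_ker {R k : Type*} [CommRing R] [CommRing k] {p : ℕ} [CharP k p] (π : R →+* k) :
    (p : R) ∈ RingHom.ker π := by
  rw [RingHom.mem_ker, map_natCast, CharP.cast_eq_zero]

theorem pow_prime_sub_pow_prime_mem {R : Type*} [CommRing R] {p : ℕ} [Fact p.Prime] {I : Ideal R}
    (hp : (p : R) ∈ I) {n : ℕ} {x y : R} (h : x - y ∈ I ^ (n + 1)) :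
    x ^ p - y ^ p ∈ I ^ (n + 1 + 1) := by
  obtain ⟨r, hr⟩ := exists_add_pow_prime_eq (Fact.out : p.Prime) y (x - y)
  rw [add_sub_cancel] at hr
  have : x ^ p - y ^ p = (x - y) ^ p + p * (x - y) * (y * r) := by
    rw [hr]
    ring
  rw [this]
  refine add_mem ?_ ?_
  · have h2 := Ideal.pow_mem_pow h p
    rw [← pow_mul] at h2
    refine Ideal.pow_le_pow_right ?_ h2
    have := (Fact.out : p.Prime).two_le
    nlinarith
  · rw [pow_succ' I (n + 1)]
    exact Ideal.mul_mem_right _ _ (Ideal.mul_mem_mul hp h)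

variable {R : Type*} [CommRing R] {p : ℕ} [Fact p.Prime] {k : Type*} [Field k] [CharP k p]
  {π : R →+* k} {t : k → R} {s : Set k}

theorem exists_mem_closure_range_pow_sub_mem_ker (ht : ∀ i, π (t i) = i)
    (hs : ∀ a, ∃ P ∈ supported k s, frobeniusEval k p P = a) (x : R) :
    ∃ y ∈ Subring.closure (Set.range (fun b : R ↦ b ^ p) ∪ t '' s), x - y ∈ RingHom.ker π := by
  obtain ⟨P, hP, hPx⟩ := hs (π x)
  suffices ∃ y ∈ Subring.closure (Set.range (fun b : R ↦ b ^ p) ∪ t '' s),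
      π y = frobeniusEval k p P by
    obtain ⟨y, hy, h⟩ := this
    exact ⟨y, hy, by rw [RingHom.mem_ker, map_sub, h, hPx, sub_self]⟩
  clear hPx
  induction hP using Algebra.adjoin_induction with
  | mem P hP =>
    obtain ⟨i, hi, rfl⟩ := hP
    refine ⟨t i, Subring.subset_closure (.inr ⟨i, hi, rfl⟩), ?_⟩
    simp [frobeniusEval, ht]
  | algebraMap c =>
    refine ⟨t c ^ p, Subring.subset_closure (.inl ⟨t c, rfl⟩), ?_⟩
    simp [frobeniusEval, ht, frobenius_def]
  | add P P' _ _ h h' =>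
    obtain ⟨y, hy, h⟩ := h
    obtain ⟨y', hy', h'⟩ := h'
    exact ⟨y + y', add_mem hy hy', by rw [map_add, map_add, h, h']⟩
  | mul P P' _ _ h h' =>
    obtain ⟨y, hy, h⟩ := h
    obtain ⟨y', hy', h'⟩ := h'
    exact ⟨y * y', mul_mem hy hy', by rw [map_mul, map_mul, h, h']⟩

theorem exists_mem_ghostStage_sub_mem {I : Ideal R} {T : Set R} (hp : (p : R) ∈ I)
    (hT : ∀ x, ∃ y ∈ Subring.closure (Set.range (fun b : R ↦ b ^ p) ∪ T), x - y ∈ I) (n : ℕ)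
    (x : R) : ∃ y ∈ ghostStage p I T n, x - y ∈ I := by
  induction n with
  | zero => exact ⟨x, by simpa using pow_mem_ghostStage (p := p) (I := I) (T := T) 0 x, by simp⟩
  | succ n ih =>
    obtain ⟨y, hy, h⟩ := ih
    obtain ⟨y', hy', h'⟩ := ghostStage_exists_succ hp hT n hy
    refine ⟨y', hy', ?_⟩
    rw [← sub_add_sub_cancel x y y']
    exact add_mem h (Ideal.pow_le_self (Nat.succ_ne_zero n) h')

theorem ghostStage_exists_sub_mul_mem (ht : ∀ i, π (t i) = i) (hi : IsPIndependent k p s)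
    (hs : ∀ a, ∃ P ∈ supported k s, frobeniusEval k p P = a) (n : ℕ) {x : R}
    (hx : x ∈ ghostStage p (RingHom.ker π) (t '' s) n) (hx0 : x ∈ RingHom.ker π) :
    ∃ z ∈ ghostStage p (RingHom.ker π) (t '' s) n, x - p * z ∈ RingHom.ker π ^ (n + 1) := by
  induction n generalizing x with
  | zero => exact ⟨0, zero_mem _, by simpa using hx0⟩
  | succ n ih =>
  set I := RingHom.ker π with hI
  have hp : (p : R) ∈ I := natCast_mem_ker π
  have hT := exists_mem_closure_range_pow_sub_mem_ker ht hs
  set C := ghostStage p I (t '' s) (n + 1)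
  let J : Ideal C := Ideal.span {(p : C)} ⊔ (I ^ (n + 1 + 1)).comap C.subtype
  have hJp : ∀ z : C, p * z ∈ J := fun z ↦
    J.mul_mem_right _ (Ideal.mem_sup_left (Ideal.mem_span_singleton_self _))
  have hJI : ∀ z : C, (z : R) ∈ I ^ (n + 1 + 1) → z ∈ J := fun z hz ↦ Ideal.mem_sup_right hz
  have hJ : ∀ z : C, z ∈ J → ∃ w ∈ C, (z : R) - p * w ∈ I ^ (n + 1 + 1) := by
    intro z hz
    obtain ⟨a, ha, b, hb, rfl⟩ := Submodule.mem_sup.mp hz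
    obtain ⟨w, rfl⟩ := Ideal.mem_span_singleton'.mp ha
    refine ⟨w, w.2, ?_⟩
    have hb' : (b : R) ∈ I ^ (n + 1 + 1) := hb
    convert hb' using 1
    simp [mul_comm]
  let πC : C →+* k := π.comp C.subtype
  have hJk : ∀ z ∈ J, πC z = 0 := by
    intro z hz
    obtain ⟨w, -, h⟩ := hJ z hz
    have := Ideal.pow_le_self (Nat.succ_ne_zero _) h
    rw [hI, RingHom.mem_ker, map_sub, map_mul, map_natCast, CharP.cast_eq_zero, zero_mul,
      sub_zero] at this
    exact this
  have hsurj : Function.Surjective πC := by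
    intro a
    obtain ⟨y, hy, h⟩ := exists_mem_ghostStage_sub_mem hp hT (n + 1) (t a)
    rw [hI, RingHom.mem_ker, map_sub, ht, sub_eq_zero] at h
    exact ⟨⟨y, hy⟩, h.symm⟩
  let ρ : C ⧸ J →+* k := Ideal.Quotient.lift J πC hJk
  have : Nontrivial (C ⧸ J) := ρ.domain_nontrivial
  have : CharP (C ⧸ J) p := by
    refine (CharP.charP_iff_prime_eq_zero Fact.out).mpr ?_
    rw [← map_natCast (Ideal.Quotient.mk J), Ideal.Quotient.eq_zero_iff_mem]
    simpa using hJp 1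
  let θ : C →+* C ⧸ J := (frobenius (C ⧸ J) p).comp (Ideal.Quotient.mk J)
  have hθ : ∀ z : C, θ z = Ideal.Quotient.mk J (z ^ p) := fun z ↦ by
    simp [θ, frobenius_def]
  have hker : RingHom.ker πC ≤ RingHom.ker θ := by
    intro c hc
    obtain ⟨z, hz, h⟩ := ih (ghostStage_succ_le hp n c.2) hc
    obtain ⟨z', hz', h'⟩ := ghostStage_exists_succ hp hT n hz
    have he : (c : R) - p * z' ∈ I ^ (n + 1) := by
      convert add_mem h (Ideal.mul_mem_left _ (p : R) h') using 1
      ring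
    rw [RingHom.mem_ker, hθ, Ideal.Quotient.eq_zero_iff_mem]
    have hpp : ((p : C) * ⟨z', hz'⟩) ^ p ∈ J := Ideal.pow_mem_of_mem _ (hJp _) _
      (Fact.out : p.Prime).pos
    rw [← sub_add_cancel (c ^ p) (((p : C) * ⟨z', hz'⟩) ^ p)]
    refine add_mem (hJI _ ?_) hpp
    simpa using pow_prime_sub_pow_prime_mem hp he
  let σ : k →+* C ⧸ J := RingHom.liftOfSurjective πC hsurj ⟨θ, hker⟩
  have hσ : ∀ c, σ (πC c) = θ c := fun c ↦
    RingHom.liftOfRightInverse_comp_apply _ _ (Function.rightInverse_surjInv hsurj) ⟨θ, hker⟩ c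
  classical
  let τ : k → C ⧸ J := fun i ↦ if h : i ∈ s then
    Ideal.Quotient.mk J ⟨t i, mem_ghostStage_of_mem ⟨i, h, rfl⟩⟩ else 0
  let Φ : MvPolynomial k k →+* C ⧸ J := eval₂Hom σ τ
  have hΦρ : ∀ P ∈ supported k s, ρ (Φ P) = frobeniusEval k p P := by
    intro P hP
    induction hP using Algebra.adjoin_induction with
    | mem P hP =>
      obtain ⟨i, hi, rfl⟩ := hP
      simp [Φ, τ, hi, frobeniusEval, ρ, πC, ht]
    | algebraMap c =>
      obtain ⟨c, rfl⟩ := hsurj c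
      simp [Φ, frobeniusEval, hσ, hθ, frobenius_def, ρ]
    | add P P' _ _ h h' => simp only [map_add, h, h']
    | mul P P' _ _ h h' => simp only [map_mul, h, h']
  have hΦI : pthRootIdeal p s ≤ RingHom.ker Φ := by
    refine Ideal.span_le.mpr ?_
    rintro _ ⟨i, hi, rfl⟩
    have : πC ⟨t i, mem_ghostStage_of_mem ⟨i, hi, rfl⟩⟩ = i := ht i
    have h := hσ ⟨t i, mem_ghostStage_of_mem ⟨i, hi, rfl⟩⟩
    rw [this, hθ] at h
    rw [map_pow] at h
    rw [SetLike.mem_coe, RingHom.mem_ker, map_sub, map_pow]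
    simp only [Φ, coe_eval₂Hom, eval₂_X, eval₂_C, τ, dif_pos hi, h, sub_self]
  let D : Subring C := ((supported k s).toSubring.map Φ).comap (Ideal.Quotient.mk J)
  have hD : ∀ c : C, c ∈ D ↔ ∃ P ∈ supported k s, Φ P = Ideal.Quotient.mk J c := fun c ↦ Iff.rfl
  have hDJ : ∀ c ∈ J, c ∈ D := fun c hc ↦
    (hD c).mpr ⟨0, zero_mem _, by rw [map_zero, Ideal.Quotient.eq_zero_iff_mem.mpr hc]⟩
  have hDT : C ≤ D.map C.subtype := by
    refine Subring.closure_le.mpr ?_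
    rintro x ((⟨a, rfl⟩ | ⟨i, hi, rfl⟩) | hx)
    · rw [ghostComponent_succ_eq_shift]
      refine add_mem ?_ ?_
      · obtain ⟨y, hy, h⟩ := ghostStage_exists_succ hp hT n
          (pow_mem_ghostStage (I := I) (T := t '' s) n (a.coeff 0))
        have h2 := pow_prime_sub_pow_prime_mem hp h
        rw [← pow_mul, ← pow_succ] at h2
        rw [← add_sub_cancel (y ^ p) (a.coeff 0 ^ p ^ (n + 1))]
        refine add_mem ⟨⟨y, hy⟩ ^ p, (hD _).mpr ⟨MvPolynomial.C (πC ⟨y, hy⟩), ?_, ?_⟩, by simp⟩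
          ⟨⟨_, mem_ghostStage_of_mem_pow h2⟩, hDJ _ (hJI _ h2), rfl⟩
        · exact Subalgebra.algebraMap_mem _ _
        · rw [← hθ, ← hσ]
          simp [Φ]
      · obtain ⟨y, hy, h⟩ := ghostStage_exists_succ hp hT n
          (ghostComponent_mem_ghostStage (I := I) (T := t '' s) n (a.shift 1))
        have h2 : p * (ghostComponent n (a.shift 1) - y) ∈ I ^ (n + 1 + 1) := by
          rw [pow_succ' I (n + 1)]
          exact Ideal.mul_mem_mul hp h
        have h3 : p * ghostComponent n (a.shift 1) =
          p * y + p * (ghostComponent n (a.shift 1) - y) := by ring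
        rw [h3]
        exact add_mem ⟨p * ⟨y, hy⟩, hDJ _ (hJp _), by simp⟩
          ⟨⟨_, mem_ghostStage_of_mem_pow h2⟩, hDJ _ (hJI _ h2), rfl⟩
    · refine ⟨⟨t i, mem_ghostStage_of_mem ⟨i, hi, rfl⟩⟩, (hD _).mpr ⟨X i, ?_, ?_⟩, rfl⟩
      · exact Algebra.subset_adjoin ⟨i, hi, rfl⟩
      · simp [Φ, τ, hi]
    · exact ⟨⟨x, mem_ghostStage_of_mem_pow hx⟩, hDJ _ (hJI _ hx), rfl⟩
  obtain ⟨c, hc, rfl⟩ := hDT hx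
  obtain ⟨P, hP, h⟩ := (hD c).mp hc
  refine hJ c (Ideal.Quotient.eq_zero_iff_mem.mp ?_)
  rw [← h]
  refine hΦI (hi P hP ?_)
  rw [← hΦρ P hP, h]
  exact hx0

end GhostStagesResidue

theorem IsPrecomplete.exists_forall_sub_mem {A : Type*} [CommRing A] (I : Ideal A)
    [IsPrecomplete I A] (f : ℕ → A) (hf : ∀ n, f n - f (n + 1) ∈ I ^ n) :
    ∃ L, ∀ n, f n - L ∈ I ^ n := by
  have hle : ∀ {m n}, m ≤ n → f m - f n ∈ I ^ m := by
    intro m n hmn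
    induction n, hmn using Nat.le_induction with
    | base => simp
    | succ n hmn ih =>
      rw [← sub_add_sub_cancel _ (f n)]
      exact add_mem ih (Ideal.pow_le_pow_right hmn (hf n))
  obtain ⟨L, hL⟩ := IsPrecomplete.prec (I := I) inferInstance (f := f) fun {m n} hmn ↦ by
    rw [SModEq.sub_mem]
    simpa using hle hmn
  exact ⟨L, fun n ↦ by simpa [SModEq.sub_mem] using hL n⟩

theorem eq_zero_of_forall_mem_pow {A : Type*} [CommRing A] (I : Ideal A) [IsHausdorff I A] {x : A}
    (hx : ∀ n, x ∈ I ^ n) : x = 0 :=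
  IsHausdorff.haus (I := I) inferInstance x fun n ↦ by simpa [SModEq.sub_mem] using hx n

theorem Ideal.exists_mem_pow_of_mul_mem_pow {A : Type*} [CommRing A] [IsDomain A]
    [IsNoetherianRing A] (I : Ideal A) {p : A} (hp : p ≠ 0) :
    ∃ c, ∀ n x, p * x ∈ I ^ (n + c) → x ∈ I ^ n := by
  obtain ⟨c, hc⟩ := I.exists_pow_inf_eq_pow_smul (Ideal.span {p} : Submodule A A)
  refine ⟨c, fun n x hx ↦ ?_⟩
  have h1 : p * x ∈ I ^ (n + c) • (⊤ : Submodule A A) ⊓ Ideal.span {p} :=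
    ⟨by simpa using hx, Ideal.mul_mem_right _ _ (Ideal.mem_span_singleton_self p)⟩
  rw [hc _ (Nat.le_add_left c n), Nat.add_sub_cancel] at h1
  have h2 : p * x ∈ I ^ n * Ideal.span {p} := Ideal.mul_mono_right inf_le_right h1
  obtain ⟨y, hy, h⟩ := Ideal.mem_mul_span_singleton.mp h2
  rw [mul_comm] at h
  rwa [← mul_left_cancel₀ hp h]

theorem IsPrincipalIdealRing.of_isUnit_or_dvd {V : Type*} [CommRing V] [IsDomain V] (π : V)
    (h : ∀ v : V, IsUnit v ∨ π ∣ v) (h0 : ∀ v : V, (∀ n, π ^ n ∣ v) → v = 0) :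
    IsPrincipalIdealRing V := by
  have key : ∀ v : V, v ≠ 0 → ∃ n u, IsUnit u ∧ v = π ^ n * u := by
    classical
    intro v hv
    have hex : ∃ n, ¬ π ^ n ∣ v := by
      by_contra! hcon
      exact hv (h0 v hcon)
    obtain ⟨n, hn⟩ : ∃ n, Nat.find hex = n + 1 :=
      Nat.exists_eq_succ_of_ne_zero fun h ↦ by
        have := Nat.find_spec hex
        rw [h] at this
        simp at this
    have hdvd : π ^ n ∣ v := not_not.mp (Nat.find_min hex (hn ▸ Nat.lt_succ_self n))
    obtain ⟨u, rfl⟩ := hdvd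
    refine ⟨n, u, (h u).resolve_right fun hu ↦ ?_, rfl⟩
    refine Nat.find_spec hex ?_
    rw [hn, pow_succ]
    exact mul_dvd_mul_left _ hu
  classical
  refine ⟨fun I ↦ ?_⟩
  by_cases hI : I = ⊥
  · rw [hI]
    exact bot_isPrincipal
  have hpow : ∀ v ∈ I, v ≠ 0 → ∃ n, π ^ n ∈ I ∧ π ^ n ∣ v := by
    intro v hv hv0
    obtain ⟨n, u, hu, rfl⟩ := key v hv0
    exact ⟨n, (Ideal.mul_unit_mem_iff_mem I hu).mp hv, dvd_mul_right _ _⟩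
  obtain ⟨v, hv, hv0⟩ := Submodule.exists_mem_ne_zero_of_ne_bot hI
  have hex : ∃ n, π ^ n ∈ I := (hpow v hv hv0).imp fun _ h ↦ h.1
  refine ⟨π ^ Nat.find hex, le_antisymm (fun w hw ↦ ?_) ?_⟩
  · refine Ideal.mem_span_singleton.mpr ?_
    by_cases hw0 : w = 0
    · rw [hw0]
      exact dvd_zero _
    obtain ⟨m, hm, hmw⟩ := hpow w hw hw0
    exact (pow_dvd_pow _ (Nat.find_min' hex hm)).trans hmw
  · exact (Ideal.span_singleton_le_iff_mem I).mpr (Nat.find_spec hex)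

section CoefficientRing

open IsLocalRing

variable {R : Type*} [CommRing R] [IsLocalRing R] {C : ℕ → Subring R}

theorem exists_mem_iInf_sub_mem [IsPrecomplete (maximalIdeal R) R] (hC : Antitone C)
    (hCm : ∀ n, ∀ x ∈ maximalIdeal R ^ (n + 1), x ∈ C n)
    (hCs : ∀ n, ∀ x ∈ C n, ∃ y ∈ C (n + 1), x - y ∈ maximalIdeal R ^ (n + 1)) {n : ℕ} {x : R}
    (hx : x ∈ C n) : ∃ v ∈ ⨅ n, C n, x - v ∈ maximalIdeal R ^ (n + 1) := by
  choose! g hg hgm using hCs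
  let f : ℕ → R := fun j ↦ j.rec x fun j y ↦ g (n + j) y
  have hf : ∀ j, f j ∈ C (n + j) := fun j ↦ by
    induction j with
    | zero => exact hx
    | succ j ih => exact hg _ _ ih
  have hfm : ∀ j, f j - f (j + 1) ∈ maximalIdeal R ^ (n + j + 1) := fun j ↦ hgm _ _ (hf j)
  obtain ⟨L, hL⟩ := IsPrecomplete.exists_forall_sub_mem (maximalIdeal R) f fun j ↦
    Ideal.pow_le_pow_right (by omega) (hfm j)
  refine ⟨L, Subring.mem_iInf.mpr fun j ↦ ?_, ?_⟩
  · rw [← sub_sub_cancel (f (j + 1)) L]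
    exact sub_mem (hC (by omega) (hf (j + 1))) (hCm _ _ (hL (j + 1)))
  · have : ∀ j, x - f j ∈ maximalIdeal R ^ (n + 1) := fun j ↦ by
      induction j with
      | zero => simp [f]
      | succ j ih =>
        rw [← sub_add_sub_cancel _ (f j)]
        exact add_mem ih (Ideal.pow_le_pow_right (by omega) (hfm j))
    rw [← sub_add_sub_cancel _ (f (n + 1))]
    exact add_mem (this (n + 1)) (hL (n + 1))

theorem mem_iInf_of_forall_exists_sub_mem (hCm : ∀ n, ∀ x ∈ maximalIdeal R ^ (n + 1), x ∈ C n)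
    {z : R} (hz : ∀ n, ∃ w ∈ ⨅ n, C n, z - w ∈ maximalIdeal R ^ n) : z ∈ ⨅ n, C n := by
  refine Subring.mem_iInf.mpr fun n ↦ ?_
  obtain ⟨w, hw, h⟩ := hz (n + 1)
  rw [← sub_add_cancel z w]
  exact add_mem (hCm n _ h) (Subring.mem_iInf.mp hw n)

theorem mem_iInf_of_mul_eq_one (hCm : ∀ n, ∀ x ∈ maximalIdeal R ^ (n + 1), x ∈ C n)
    (hk : ∀ x, ∃ v ∈ ⨅ n, C n, x - v ∈ maximalIdeal R) {v u : R} (hv : v ∈ ⨅ n, C n)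
    (huv : v * u = 1) : u ∈ ⨅ n, C n := by
  obtain ⟨v', hv', h⟩ := hk u
  have hw : v * (u - v') ∈ maximalIdeal R := Ideal.mul_mem_left _ _ h
  have hwV : v * (u - v') ∈ ⨅ n, C n := by
    rw [mul_sub, huv]
    exact sub_mem (one_mem _) (mul_mem hv hv')
  refine mem_iInf_of_forall_exists_sub_mem hCm fun n ↦
    ⟨v' * ∑ i ∈ Finset.range n, (v * (u - v')) ^ i,
      mul_mem hv' (sum_mem fun i _ ↦ pow_mem hwV i), ?_⟩
  have h1 := mul_neg_geom_sum (v * (u - v')) n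
  have h2 : 1 - v * (u - v') = v * v' := by rw [mul_sub, huv, sub_sub_cancel]
  rw [h2] at h1
  have h3 : u - v' * ∑ i ∈ Finset.range n, (v * (u - v')) ^ i = u * (v * (u - v')) ^ n := by
    linear_combination (- u) * h1 +
      (v' * ∑ i ∈ Finset.range n, (v * (u - v')) ^ i) * huv
  rw [h3]
  exact Ideal.mul_mem_left _ _ (Ideal.pow_mem_pow hw n)

end CoefficientRing

theorem HasNormalSubring.of_antitone.{u} {R : Type u} [CommRing R] [IsDomain R]
    [IsNoetherianRing R] [IsLocalRing R] [IsAdicComplete (IsLocalRing.maximalIdeal R) R]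
    {C : ℕ → Subring R} (hC : Antitone C) (hC0 : C 0 = ⊤)
    (hCm : ∀ n, ∀ x ∈ IsLocalRing.maximalIdeal R ^ (n + 1), x ∈ C n)
    (hCs : ∀ n, ∀ x ∈ C n, ∃ y ∈ C (n + 1), x - y ∈ IsLocalRing.maximalIdeal R ^ (n + 1)) {p : R}
    (hpm : p ∈ IsLocalRing.maximalIdeal R) (hpC : ∀ n, p ∈ C n)
    (hCp : ∀ n, ∀ x ∈ C n, x ∈ IsLocalRing.maximalIdeal R →
      ∃ z ∈ C n, x - p * z ∈ IsLocalRing.maximalIdeal R ^ (n + 1)) :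
    HasNormalSubring.{u} R := by
  set m := IsLocalRing.maximalIdeal R
  let V := ⨅ n, C n
  have hk : ∀ x, ∃ v ∈ V, x - v ∈ m := fun x ↦ by
    obtain ⟨v, hv, h⟩ := exists_mem_iInf_sub_mem hC hCm hCs (n := 0) (x := x)
      (by rw [hC0]; trivial)
    exact ⟨v, hv, by rwa [zero_add, pow_one] at h⟩
  have hψ : ∀ x, ∃ v, x - V.subtype v ∈ m := fun x ↦ by
    obtain ⟨v, hv, h⟩ := hk x
    exact ⟨⟨v, hv⟩, h⟩
  have hunit : ∀ v : V, (v : R) ∉ m → IsUnit v := by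
    intro v hv
    obtain ⟨u, hu⟩ := isUnit_iff_exists_inv.mp (not_not.mp hv)
    exact isUnit_iff_exists_inv.mpr ⟨⟨u, mem_iInf_of_mul_eq_one hCm hk v.2 hu⟩, Subtype.ext hu⟩
  have hVp : ∀ v ∈ V, v ∈ m → ∀ n, ∃ z ∈ V, v - p * z ∈ m ^ (n + 1) := by
    intro v hv hvm n
    obtain ⟨z, hz, h⟩ := hCp n v (Subring.mem_iInf.mp hv n) hvm
    obtain ⟨w, hw, h'⟩ := exists_mem_iInf_sub_mem hC hCm hCs hz
    refine ⟨w, hw, ?_⟩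
    have : v - p * w = (v - p * z) + p * (z - w) := by ring
    rw [this]
    exact add_mem h (Ideal.mul_mem_left _ _ h')
  by_cases hp0 : p = 0
  · refine HasNormalSubring.of_field V.subtype ?_ hψ
    refine ⟨⟨0, 1, zero_ne_one⟩, mul_comm, fun {a} ha ↦ ?_⟩
    refine (hunit a fun h ↦ ha (Subtype.ext ?_)).exists_right_inv
    refine eq_zero_of_forall_mem_pow m fun n ↦ ?_
    obtain ⟨z, -, hz⟩ := hVp a a.2 h n
    rw [hp0, zero_mul, sub_zero] at hz
    exact Ideal.pow_le_pow_right n.le_succ hz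
  obtain ⟨c, hc⟩ := m.exists_mem_pow_of_mul_mem_pow hp0
  have hVm : ∀ v ∈ V, v ∈ m → ∃ w ∈ V, v = p * w := by
    intro v hv hvm
    choose z hz hzm using hVp v hv hvm
    obtain ⟨L, hL⟩ := IsPrecomplete.exists_forall_sub_mem m (fun n ↦ z (n + c)) fun n ↦ by
      refine hc _ _ ?_
      have h1 := Ideal.pow_le_pow_right (by omega : n + c ≤ n + c + 1) (hzm (n + c))
      have h2 := Ideal.pow_le_pow_right (by omega : n + c ≤ n + 1 + c + 1) (hzm (n + 1 + c))
      convert sub_mem h2 h1 using 1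
      ring
    refine ⟨L, mem_iInf_of_forall_exists_sub_mem hCm fun n ↦ ⟨z (n + c), hz _, ?_⟩, ?_⟩
    · rw [← neg_sub]
      exact neg_mem (hL n)
    · refine sub_eq_zero.mp (eq_zero_of_forall_mem_pow m fun n ↦ ?_)
      have : v - p * L = (v - p * z (n + c)) + p * (z (n + c) - L) := by ring
      rw [this]
      exact add_mem (Ideal.pow_le_pow_right (by omega) (hzm (n + c)))
        (Ideal.mul_mem_left _ _ (hL n))
  have hpV : p ∈ V := Subring.mem_iInf.mpr hpC
  let π : V := ⟨p, hpV⟩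
  have hT : ∀ n, ∃ N, ∀ v : V, (v : R) ∈ m ^ N → π ^ n ∣ v := by
    intro n
    induction n with
    | zero => exact ⟨0, fun v _ ↦ by simp⟩
    | succ n ih =>
      obtain ⟨N, hN⟩ := ih
      refine ⟨N + c + 1, fun v hv ↦ ?_⟩
      obtain ⟨w, hw, h⟩ := hVm v v.2 (Ideal.pow_le_self (by omega) hv)
      have h1 : v = π * ⟨w, hw⟩ := Subtype.ext h
      rw [h1, pow_succ']
      refine mul_dvd_mul_left _ (hN _ (hc _ _ ?_))
      rw [← h]
      exact Ideal.pow_le_pow_right (Nat.le_succ _) hv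
  have hπ : ∀ n (v : V), π ^ n ∣ v → (v : R) ∈ m ^ n := by
    rintro n _ ⟨w, rfl⟩
    exact Ideal.mul_mem_right _ _ (Ideal.pow_mem_pow hpm n)
  have : IsPrincipalIdealRing V := by
    refine .of_isUnit_or_dvd π (fun v ↦ ?_) fun v hv ↦ ?_
    · by_cases hvm : (v : R) ∈ m
      · obtain ⟨w, hw, h⟩ := hVm v v.2 hvm
        exact .inr ⟨⟨w, hw⟩, Subtype.ext h⟩
      · exact .inl (hunit v hvm)
    · exact Subtype.ext (eq_zero_of_forall_mem_pow m fun n ↦ hπ n v (hv n))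
  have : IsPrecomplete (Ideal.span {π}) V := by
    refine ⟨fun f hf ↦ ?_⟩
    have hf' : ∀ {i j}, i ≤ j → π ^ i ∣ f i - f j := fun {i j} hij ↦ by
      have := hf hij
      rw [SModEq.sub_mem, smul_eq_mul, Ideal.mul_top, Ideal.span_singleton_pow,
        Ideal.mem_span_singleton] at this
      exact this
    obtain ⟨L, hL⟩ := IsPrecomplete.exists_forall_sub_mem m (fun n ↦ (f n : R)) fun n ↦
      hπ n (f n - f (n + 1)) (hf' n.le_succ)
    have hLV : L ∈ V := mem_iInf_of_forall_exists_sub_mem hCm fun n ↦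
      ⟨f n, (f n).2, by rw [← neg_sub]; exact neg_mem (hL n)⟩
    refine ⟨⟨L, hLV⟩, fun n ↦ ?_⟩
    rw [SModEq.sub_mem, smul_eq_mul, Ideal.mul_top, Ideal.span_singleton_pow,
      Ideal.mem_span_singleton]
    obtain ⟨N, hN⟩ := hT n
    rw [← sub_add_sub_cancel _ (f (max N n))]
    exact dvd_add (hf' (le_max_right _ _))
      (hN _ (Ideal.pow_le_pow_right (le_max_left _ _) (hL (max N n))))
  exact HasNormalSubring.of_uniformizer V.subtype hψ (π := π) hpm hp0

theorem HasNormalSubring.of_charP_residueField.{u} {R : Type u} [CommRing R] [IsDomain R]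
    [IsNoetherianRing R] [IsLocalRing R] [IsAdicComplete (IsLocalRing.maximalIdeal R) R] (p : ℕ)
    [Fact p.Prime] [CharP (IsLocalRing.ResidueField R) p] : HasNormalSubring.{u} R := by
  obtain ⟨s, hi, hs⟩ := exists_pBasis (IsLocalRing.ResidueField R) p
  obtain ⟨t, ht⟩ := (IsLocalRing.residue_surjective (R := R)).hasRightInverse
  have hp : (p : R) ∈ IsLocalRing.maximalIdeal R := by
    rw [← IsLocalRing.ker_residue]
    exact natCast_mem_ker _
  have hT := exists_mem_closure_range_pow_sub_mem_ker ht hs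
  have hCp := fun n x ↦ ghostStage_exists_sub_mul_mem (R := R) ht hi hs n (x := x)
  rw [IsLocalRing.ker_residue] at hT hCp
  refine .of_antitone (C := ghostStage p (IsLocalRing.maximalIdeal R) (t '' s))
    (ghostStage_antitone hp) (eq_top_iff.mpr fun x _ ↦ ?_) (fun n x ↦ mem_ghostStage_of_mem_pow)
    (fun n x ↦ ghostStage_exists_succ hp hT n) hp (fun n ↦ natCast_mem _ p) hCp
  simpa using pow_mem_ghostStage (p := p) (T := t '' s) 0 x

theorem HasNormalSubring.of_isAdicComplete.{u} (R : Type u) [CommRing R] [IsDomain R]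
    [IsNoetherianRing R] [IsLocalRing R] [IsAdicComplete (IsLocalRing.maximalIdeal R) R] :
    HasNormalSubring.{u} R := by
  obtain ⟨p, hp⟩ := CharP.exists (IsLocalRing.ResidueField R)
  obtain hprime | rfl := CharP.char_is_prime_or_zero (IsLocalRing.ResidueField R) p
  · have : Fact p.Prime := ⟨hprime⟩
    exact .of_charP_residueField p
  · have : CharZero (R ⧸ IsLocalRing.maximalIdeal R) :=
      CharP.charP_to_charZero (IsLocalRing.ResidueField R)
    exact .of_charZero_residueField

/-- For a complete Noetherian local domain `R` with integral closure `B` in its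
fraction field, the contraction to `R` of a prime of `B` of height `d` also has
height `d`. -/
theorem stmt_8 {R : Type*} [CommRing R] [IsDomain R] [IsNoetherianRing R]
    [IsLocalRing R] [IsAdicComplete (IsLocalRing.maximalIdeal R) R]
    (𝔭 : Ideal (integralClosure R (FractionRing R))) (hp : 𝔭.IsPrime) (d : ℕ∞)
    (hd : Order.height
      (⟨𝔭, hp⟩ : PrimeSpectrum (integralClosure R (FractionRing R))) = d) :
    Order.height
      (⟨𝔭.comap (algebraMap R (integralClosure R (FractionRing R))),
        hp.comap _⟩ : PrimeSpectrum R) = d := by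
  rw [← hd]
  exact height_comap_integralClosure_of_hasNormalSubring (.of_isAdicComplete R) ⟨𝔭, hp⟩
end

section
/- Let R be a complete Noetherian local integral domain with maximal ideal m_R, let G be a group, and let T be a 2-dimensional pseudo-representation of G over R with respect to c ∈ G, with associated functions a, d, y. Assume y(σ, τ) ∈ m_R for all σ, τ ∈ G (i.e., T mod m_R is reducible). Let α ∈ G and let I_α be the ideal of R generated by the set {y(α, β) : β ∈ G}. Assume that every prime ideal of R which is minimal among the primes containing I_α has height at least 2. Then for every σ ∈ G there exists an element u of the fraction field of R which is integral over R and satisfies u · y(α, β) = y(σ, β) in Frac(R) for all β ∈ G. -/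
open TensorProduct

universe u

namespace LocalCoh

/-- The submodule of elements killed by a power of the ideal `I`. -/
def gamma {A : Type*} [CommRing A] (I : Ideal A) (N : Type*) [AddCommGroup N] [Module A N] :
    Submodule A N where
  carrier := {z | ∃ n : ℕ, ∀ a ∈ I ^ n, a • z = 0}
  zero_mem' := ⟨0, by simp⟩
  add_mem' := by
    rintro x y ⟨m, hm⟩ ⟨n, hn⟩
    refine ⟨m + n, fun a ha => ?_⟩
    rw [smul_add, hm a (Ideal.pow_le_pow_right (Nat.le_add_right m n) ha),
      hn a (Ideal.pow_le_pow_right (Nat.le_add_left n m) ha), add_zero]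
  smul_mem' := by
    rintro r x ⟨n, hn⟩
    exact ⟨n, fun a ha => by rw [smul_comm, hn a ha, smul_zero]⟩

section gamma

variable {A : Type*} [CommRing A] {I : Ideal A} {N N' : Type*} [AddCommGroup N] [Module A N]
  [AddCommGroup N'] [Module A N']

theorem map_mem_gamma (f : N →ₗ[A] N') {z : N} (hz : z ∈ gamma I N) : f z ∈ gamma I N' := by
  obtain ⟨n, hn⟩ := hz
  exact ⟨n, fun a ha => by rw [← map_smul, hn a ha, map_zero]⟩

theorem mem_gamma_of_injective (f : N →ₗ[A] N') (hf : Function.Injective f) {z : N}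
    (hz : f z ∈ gamma I N') : z ∈ gamma I N := by
  obtain ⟨n, hn⟩ := hz
  exact ⟨n, fun a ha => hf (by rw [map_smul, hn a ha, map_zero])⟩

theorem gamma_eq_top_of_surjective (f : N →ₗ[A] N') (hf : Function.Surjective f)
    (h : gamma I N = ⊤) : gamma I N' = ⊤ := by
  refine eq_top_iff.2 fun z _ => ?_
  obtain ⟨w, rfl⟩ := hf z
  exact map_mem_gamma f (h ▸ trivial)

theorem gamma_gamma : gamma I (gamma I N) = ⊤ :=
  eq_top_iff.2 fun z _ => mem_gamma_of_injective (gamma I N).subtype Subtype.val_injective z.2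

theorem gamma_eq_top_of_pow_smul {n : ℕ} (h : ∀ a ∈ I ^ n, ∀ z : N, a • z = 0) :
    gamma I N = ⊤ :=
  eq_top_iff.2 fun z _ => ⟨n, fun a ha => h a ha z⟩

theorem mem_gamma_of_fg (hI : I.FG) {z : N} (h : ∀ a ∈ I, ∃ n : ℕ, a ^ n • z = 0) :
    z ∈ gamma I N := by
  have : I ≤ Ideal.radical (LinearMap.ker (LinearMap.toSpanSingleton A N z)) := fun a ha => by
    obtain ⟨n, hn⟩ := h a ha
    exact ⟨n, by simpa using hn⟩
  obtain ⟨n, hn⟩ := Ideal.exists_pow_le_of_le_radical_of_fg this hI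
  exact ⟨n, fun a ha => by simpa using hn ha⟩

end gamma

/-- A flat algebra for which the kernel of `N → B ⊗ N` is the `I`-power torsion of `N`. -/
class IsDetecting {A : Type u} [CommRing A] (I : Ideal A) (B : Type u) [CommRing B]
    [Algebra A B] : Prop where
  flat : Module.Flat A B
  one_tmul_eq_zero_iff : ∀ (N : Type u) [AddCommGroup N] [Module A N] (z : N),
    (1 : B) ⊗ₜ[A] z = 0 ↔ z ∈ gamma I N

theorem isDetecting_pi {A : Type u} [CommRing A] (s : Finset A) :
    IsDetecting (Ideal.span (s : Set A)) (∀ j : s, Localization.Away (j : A)) := by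
  refine ⟨inferInstance, fun N _ _ z => ⟨fun h => ?_, ?_⟩⟩
  · have key : ∀ j : s, ∃ n : ℕ, (j : A) ^ n • z = 0 := fun j => by
      have h1 := congrArg (TensorProduct.map
        (LinearMap.proj (R := A) (φ := fun j : s => Localization.Away (j : A)) j)
        (LinearMap.id : N →ₗ[A] N)) h
      simp only [TensorProduct.map_tmul, map_zero, LinearMap.proj_apply, Pi.one_apply,
        LinearMap.id_apply] at h1
      have h2 : TensorProduct.mk A (Localization.Away (j : A)) N 1 z = 0 := h1
      obtain ⟨⟨_, n, rfl⟩, hn⟩ := (IsLocalizedModule.eq_zero_iff (Submonoid.powers (j : A)) _).1 h2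
      exact ⟨n, hn⟩
    refine mem_gamma_of_fg ⟨s, rfl⟩ fun a ha => ?_
    have h3 : Ideal.span (s : Set A) ≤
        Ideal.radical (LinearMap.ker (LinearMap.toSpanSingleton A N z)) := by
      rw [Ideal.span_le]
      intro j hj
      obtain ⟨n, hn⟩ := key ⟨j, hj⟩
      exact ⟨n, by simpa using hn⟩
    obtain ⟨n, hn⟩ := h3 ha
    exact ⟨n, by simpa using hn⟩
  · rintro ⟨n, hn⟩
    classical
    have h1 : (1 : ∀ j : s, Localization.Away (j : A)) = ∑ j, Pi.single j 1 := by
      rw [Finset.univ_sum_single (fun j : s => (1 : Localization.Away (j : A)))]; rfl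
    rw [h1, TensorProduct.sum_tmul]
    refine Finset.sum_eq_zero fun j _ => ?_
    have h2 : (Pi.single j 1 : ∀ j : s, Localization.Away (j : A)) =
        (j : A) ^ n • Pi.single j (Localization.mk 1 ⟨(j : A) ^ n, pow_mem (Submonoid.mem_powers _) n⟩) := by
      rw [← Pi.single_smul, Localization.smul_mk, smul_eq_mul, mul_one]
      congr 1
      exact (Localization.mk_self (⟨(j : A) ^ n, pow_mem (Submonoid.mem_powers _) n⟩ : Submonoid.powers (j : A))).symm
    rw [h2, TensorProduct.smul_tmul,
      hn _ (Ideal.pow_mem_pow (Ideal.subset_span j.2) n), TensorProduct.tmul_zero]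

open Function

/-- The map on `I`-power torsion induced by a linear map. -/
def gammaMap {A : Type*} [CommRing A] (I : Ideal A) {N N' : Type*} [AddCommGroup N] [Module A N]
    [AddCommGroup N'] [Module A N'] (f : N →ₗ[A] N') : gamma I N →ₗ[A] gamma I N' :=
  f.restrict fun _ hz => map_mem_gamma f hz

@[simp]
theorem gammaMap_coe {A : Type*} [CommRing A] (I : Ideal A) {N N' : Type*} [AddCommGroup N]
    [Module A N] [AddCommGroup N'] [Module A N'] (f : N →ₗ[A] N') (z : gamma I N) :
    (gammaMap I f z : N') = f z := rfl

/-- The cokernel of the structure map of an algebra. -/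
abbrev Coker (A : Type u) [CommRing A] (B : Type u) [CommRing B] [Algebra A B] : Type u :=
  B ⧸ LinearMap.range (Algebra.linearMap A B)

section step

variable {A : Type u} [CommRing A] (I : Ideal A) (B : Type u) [CommRing B] [Algebra A B]

theorem exact_mk_coker (N : Type u) [AddCommGroup N] [Module A N] :
    Exact (TensorProduct.mk A B N 1)
      (LinearMap.rTensor N (LinearMap.range (Algebra.linearMap A B)).mkQ) := by
  have h := rTensor_exact N (LinearMap.exact_map_mkQ_range (Algebra.linearMap A B))
    (Submodule.mkQ_surjective _)
  have h2 : TensorProduct.mk A B N 1 =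
      LinearMap.rTensor N (Algebra.linearMap A B) ∘ₗ (TensorProduct.lid A N).symm := by
    ext z; simp
  intro z
  rw [h z, h2]
  constructor
  · rintro ⟨w, rfl⟩
    exact ⟨TensorProduct.lid A N w, by simp⟩
  · rintro ⟨w, rfl⟩
    exact ⟨(TensorProduct.lid A N).symm w, by simp⟩

variable [IsDetecting I B]

theorem exact_gamma_mk (N : Type u) [AddCommGroup N] [Module A N] :
    Exact (gamma I N).subtype (TensorProduct.mk A B N 1) := fun z => by
  have := IsDetecting.one_tmul_eq_zero_iff (I := I) (B := B) N z
  simpa using this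

theorem subsingleton_tensor_of_gamma_eq_top {N : Type u} [AddCommGroup N] [Module A N]
    (h : gamma I N = ⊤) : Subsingleton (B ⊗[A] N) := by
  refine subsingleton_of_forall_eq 0 fun x => ?_
  induction x with
  | zero => rfl
  | add x y hx hy => rw [hx, hy, add_zero]
  | tmul b z =>
    have h1 := (IsDetecting.one_tmul_eq_zero_iff (I := I) (B := B) N z).2 (h ▸ trivial)
    have h2 := congrArg (b • ·) h1
    simpa [TensorProduct.smul_tmul'] using h2

theorem subsingleton_coker_of_gamma_eq_top {N : Type u} [AddCommGroup N] [Module A N]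
    (h : gamma I N = ⊤) : Subsingleton (Coker A B ⊗[A] N) := by
  have := subsingleton_tensor_of_gamma_eq_top I B h
  exact (LinearMap.rTensor_surjective N
    (Submodule.mkQ_surjective (LinearMap.range (Algebra.linearMap A B)))).subsingleton

variable {N₁ N₂ N₃ : Type u} [AddCommGroup N₁] [Module A N₁] [AddCommGroup N₂] [Module A N₂]
  [AddCommGroup N₃] [Module A N₃] (f : N₁ →ₗ[A] N₂) (g : N₂ →ₗ[A] N₃)

theorem lTensor_injective_of_ker_le_gamma (hf : LinearMap.ker f ≤ gamma I N₁) :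
    Injective (LinearMap.lTensor B f) := by
  have := IsDetecting.flat (I := I) (B := B)
  have h1 : Exact (LinearMap.ker f).subtype f := LinearMap.exact_subtype_ker_map f
  have h2 := Module.Flat.lTensor_exact B h1
  have h3 : gamma I (LinearMap.ker f) = ⊤ := eq_top_iff.2 fun z _ =>
    mem_gamma_of_injective (LinearMap.ker f).subtype Subtype.val_injective (hf z.2)
  have := subsingleton_tensor_of_gamma_eq_top I B h3
  refine (injective_iff_map_eq_zero _).2 fun x hx => ?_
  obtain ⟨y, rfl⟩ := (h2 x).1 hx
  rw [Subsingleton.elim y 0, map_zero]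

/-- One step of the long exact sequence. -/
theorem exists_connecting (hfg : Exact f g) (hg : Surjective g)
    (hf : LinearMap.ker f ≤ gamma I N₁) :
    Exact (gammaMap I f) (gammaMap I g) ∧
    (∃ δ : gamma I N₃ →ₗ[A] gamma I (Coker A B ⊗[A] N₁),
      Exact (gammaMap I g) δ ∧ Exact δ (gammaMap I (LinearMap.lTensor (Coker A B) f))) ∧
    LinearMap.ker (LinearMap.lTensor (Coker A B) f) ≤ gamma I (Coker A B ⊗[A] N₁) := by
  have hinj := lTensor_injective_of_ker_le_gamma I B f hf
  have c1 : LinearMap.lTensor B f ∘ₗ TensorProduct.mk A B N₁ 1 =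
      TensorProduct.mk A B N₂ 1 ∘ₗ f := by ext; simp
  have c2 : LinearMap.lTensor B g ∘ₗ TensorProduct.mk A B N₂ 1 =
      TensorProduct.mk A B N₃ 1 ∘ₗ g := by ext; simp
  have hbot : Exact (LinearMap.lTensor B f) (LinearMap.lTensor B g) := lTensor_exact B hfg hg
  set δ := SnakeLemma.δ' (TensorProduct.mk A B N₁ 1) (TensorProduct.mk A B N₂ 1)
    (TensorProduct.mk A B N₃ 1) f g hfg (LinearMap.lTensor B f) (LinearMap.lTensor B g) hbot
    c1 c2 (gamma I N₃).subtype (exact_gamma_mk I B N₃) _ (exact_mk_coker B N₁) hg hinj with hδ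
  have e1 : Exact (gammaMap I g) δ := by
    refine SnakeLemma.exact_δ'_right (TensorProduct.mk A B N₁ 1) (TensorProduct.mk A B N₂ 1)
      (TensorProduct.mk A B N₃ 1) f g hfg (LinearMap.lTensor B f) (LinearMap.lTensor B g) hbot
      c1 c2 (gamma I N₂).subtype (exact_gamma_mk I B N₂) (gamma I N₃).subtype
      (exact_gamma_mk I B N₃) _ (exact_mk_coker B N₁) hg hinj (gammaMap I g) ?_
      Subtype.val_injective
    ext; rfl
  have e2 : Exact δ (LinearMap.lTensor (Coker A B) f) := by
    refine SnakeLemma.exact_δ'_left (TensorProduct.mk A B N₁ 1) (TensorProduct.mk A B N₂ 1)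
      (TensorProduct.mk A B N₃ 1) f g hfg (LinearMap.lTensor B f) (LinearMap.lTensor B g) hbot
      c1 c2 (gamma I N₃).subtype (exact_gamma_mk I B N₃) _ (exact_mk_coker B N₁)
      _ (exact_mk_coker B N₂) hg hinj _ ?_
      (LinearMap.rTensor_surjective N₁ (Submodule.mkQ_surjective _))
    rw [LinearMap.lTensor_comp_rTensor, LinearMap.rTensor_comp_lTensor]
  have hmem : ∀ z, δ z ∈ gamma I (Coker A B ⊗[A] N₁) := fun z =>
    map_mem_gamma δ (by rw [gamma_gamma]; trivial)
  refine ⟨fun z => ⟨fun hz => ?_, ?_⟩, ⟨δ.codRestrict _ hmem, fun z => ?_, fun z => ?_⟩, ?_⟩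
  · obtain ⟨w, hw⟩ := (hfg z).1 (congrArg Subtype.val hz)
    refine ⟨⟨w, (IsDetecting.one_tmul_eq_zero_iff (I := I) (B := B) N₁ w).1 (hinj ?_)⟩,
      Subtype.ext hw⟩
    rw [LinearMap.lTensor_tmul, hw, map_zero]
    exact (IsDetecting.one_tmul_eq_zero_iff (I := I) (B := B) N₂ _).2 z.2
  · rintro ⟨w, rfl⟩
    exact Subtype.ext (hfg.apply_apply_eq_zero _)
  · rw [← e1 z, ← Subtype.coe_inj]; rfl
  · rw [← Subtype.coe_inj]
    refine (e2 z).trans ⟨?_, ?_⟩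
    · rintro ⟨w, hw⟩
      exact ⟨w, Subtype.ext hw⟩
    · rintro ⟨w, hw⟩
      exact ⟨w, congrArg Subtype.val hw⟩
  · intro z hz
    obtain ⟨w, rfl⟩ := (e2 z).1 hz
    exact hmem w

end step

/-- Iterated tensor product with the cokernel of `A → B`. -/
noncomputable def iterCoker {A : Type u} [CommRing A] (B : Type u) [CommRing B] [Algebra A B] :
    ℕ → ModuleCat.{u} A → ModuleCat.{u} A
  | 0, M => M
  | n + 1, M => ModuleCat.of A (Coker A B ⊗[A] iterCoker B n M)

section cohomology

variable {A : Type u} [CommRing A] (I : Ideal A) (B : Type u) [CommRing B] [Algebra A B]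
  (n : ℕ) (M M' M'' : Type u) [AddCommGroup M] [Module A M] [AddCommGroup M'] [Module A M']
  [AddCommGroup M''] [Module A M'']

/-- The underlying module of the iterated tensor product with the cokernel of `A → B`. -/
abbrev Iter : Type u := iterCoker (A := A) B n (ModuleCat.of A M)

variable {M M' M''}

/-- The map induced on iterated tensor products. -/
noncomputable def iterMap (f : M →ₗ[A] M') : ∀ n : ℕ, Iter (A := A) B n M →ₗ[A] Iter (A := A) B n M'
  | 0 => f
  | n + 1 => LinearMap.lTensor (Coker A B) (iterMap f n)

theorem iterMap_succ (f : M →ₗ[A] M') (n : ℕ) :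
    iterMap B f (n + 1) = LinearMap.lTensor (Coker A B) (iterMap B f n) := rfl

theorem iterMap_id : iterMap B (LinearMap.id : M →ₗ[A] M) n = LinearMap.id := by
  induction n with
  | zero => rfl
  | succ n ih => rw [iterMap_succ, ih]; exact LinearMap.lTensor_id _ _

theorem iterMap_comp (g : M' →ₗ[A] M'') (f : M →ₗ[A] M') :
    iterMap B (g ∘ₗ f) n = iterMap B g n ∘ₗ iterMap B f n := by
  induction n with
  | zero => rfl
  | succ n ih => rw [iterMap_succ, ih]; exact LinearMap.lTensor_comp _ _ _

theorem iterMap_add (f g : M →ₗ[A] M') :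
    iterMap B (f + g) n = iterMap B f n + iterMap B g n := by
  induction n with
  | zero => rfl
  | succ n ih => rw [iterMap_succ, ih]; exact LinearMap.lTensor_add _ _ _

theorem iterMap_smul (a : A) (f : M →ₗ[A] M') :
    iterMap B (a • f) n = a • iterMap B f n := by
  induction n with
  | zero => rfl
  | succ n ih => rw [iterMap_succ, ih]; exact LinearMap.lTensor_smul _ _ _

variable (M) in
/-- The `n`-th local cohomology module of `M` with support in `I`, computed with an algebra `B`
which detects the `I`-power torsion. -/
abbrev H : Type u := gamma I (Iter (A := A) B n M)

/-- The map induced on local cohomology. -/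
noncomputable def Hmap (f : M →ₗ[A] M') : H I B n M →ₗ[A] H I B n M' :=
  gammaMap I (iterMap B f n)

theorem Hmap_id : Hmap I B n (LinearMap.id : M →ₗ[A] M) = LinearMap.id := by
  ext z; simp [Hmap, iterMap_id]

theorem Hmap_comp (g : M' →ₗ[A] M'') (f : M →ₗ[A] M') :
    Hmap I B n (g ∘ₗ f) = Hmap I B n g ∘ₗ Hmap I B n f := by
  ext z; simp [Hmap, iterMap_comp]

theorem Hmap_add (f g : M →ₗ[A] M') :
    Hmap I B n (f + g) = Hmap I B n f + Hmap I B n g := by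
  ext z; simp [Hmap, iterMap_add]

theorem Hmap_smul (a : A) (f : M →ₗ[A] M') : Hmap I B n (a • f) = a • Hmap I B n f := by
  ext z; simp [Hmap, iterMap_smul]

theorem gamma_H (M : Type u) [AddCommGroup M] [Module A M] : gamma I (H I B n M) = ⊤ :=
  gamma_gamma

variable [IsDetecting I B]

theorem subsingleton_H_succ (h : gamma I M = ⊤) : Subsingleton (H I B (n + 1) M) := by
  have : Subsingleton (Iter (A := A) B (n + 1) M) := by
    induction n with
    | zero => exact subsingleton_coker_of_gamma_eq_top I B h
    | succ n ih =>
      exact subsingleton_coker_of_gamma_eq_top I B (Subsingleton.elim _ _)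
  infer_instance

variable {n} {f : M →ₗ[A] M'} {g : M' →ₗ[A] M''}

theorem iter_exact (hf : Injective f) (hfg : Exact f g) (hg : Surjective g) (n : ℕ) :
    Exact (iterMap B f n) (iterMap B g n) ∧ Surjective (iterMap B g n) ∧
      LinearMap.ker (iterMap B f n) ≤ gamma I (Iter (A := A) B n M) := by
  induction n with
  | zero =>
    refine ⟨hfg, hg, ?_⟩
    change LinearMap.ker f ≤ _
    rw [LinearMap.ker_eq_bot.2 hf]
    exact bot_le
  | succ n ih =>
    obtain ⟨h1, h2, h3⟩ := ih
    exact ⟨lTensor_exact _ h1 h2, LinearMap.lTensor_surjective _ h2,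
      (exists_connecting I B _ _ h1 h2 h3).2.2⟩

theorem H_exact (hf : Injective f) (hfg : Exact f g) (hg : Surjective g) :
    Exact (Hmap I B n f) (Hmap I B n g) := by
  obtain ⟨h1, h2, h3⟩ := iter_exact I B hf hfg hg n
  exact (exists_connecting I B _ _ h1 h2 h3).1

theorem exists_H_connecting (n : ℕ) (hf : Injective f) (hfg : Exact f g) (hg : Surjective g) :
    ∃ δ : H I B n M'' →ₗ[A] H I B (n + 1) M,
      Exact (Hmap I B n g) δ ∧ Exact δ (Hmap I B (n + 1) f) := by
  obtain ⟨h1, h2, h3⟩ := iter_exact I B hf hfg hg n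
  exact (exists_connecting I B _ _ h1 h2 h3).2.1

end cohomology

section hull

variable {A : Type u} [CommRing A] (Q : Type u) [AddCommGroup Q] [Module A Q]

theorem exists_maximal_essential (K : Submodule A Q) : ∃ E : Submodule A Q, K ≤ E ∧
    Maximal (fun E : Submodule A Q => ∀ x ∈ E, x ≠ 0 → ∃ a : A, a • x ≠ 0 ∧ a • x ∈ K) E := by
  refine zorn_le_nonempty₀ {E : Submodule A Q | ∀ x ∈ E, x ≠ 0 → ∃ a : A, a • x ≠ 0 ∧ a • x ∈ K}
    (fun c hc hch y hy => ⟨sSup c, fun x hx hx0 => ?_, fun z hz => le_sSup hz⟩) K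
    fun x hx hx0 => ⟨1, by simpa using hx0, by simpa using hx⟩
  obtain ⟨e, he, hxe⟩ := (Submodule.mem_sSup_of_directed ⟨y, hy⟩ hch.directedOn).1 hx
  exact hc he x hxe hx0

theorem exists_maximal_disjoint (E : Submodule A Q) : ∃ C : Submodule A Q,
    Maximal (fun C : Submodule A Q => ∀ x ∈ C, x ∈ E → x = 0) C := by
  have h : ∀ c ⊆ {C : Submodule A Q | ∀ x ∈ C, x ∈ E → x = 0}, IsChain (· ≤ ·) c → ∀ y ∈ c,
      ∃ ub ∈ {C : Submodule A Q | ∀ x ∈ C, x ∈ E → x = 0}, ∀ z ∈ c, z ≤ ub :=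
    fun c hc hch y hy => ⟨sSup c, fun x hx hxE => by
      obtain ⟨e, he, hxe⟩ := (Submodule.mem_sSup_of_directed ⟨y, hy⟩ hch.directedOn).1 hx
      exact hc he x hxe hxE, fun z hz => le_sSup hz⟩
  obtain ⟨C, -, hC⟩ := zorn_le_nonempty₀ _ h ⊥ fun x hx _ => by simpa using hx
  exact ⟨C, hC⟩

variable {Q} in
theorem injective_of_maximal_essential [hQ : Module.Injective A Q] (K : Submodule A Q)
    {E : Submodule A Q} (hE : Maximal
      (fun E : Submodule A Q => ∀ x ∈ E, x ≠ 0 → ∃ a : A, a • x ≠ 0 ∧ a • x ∈ K) E) :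
    Module.Injective A E := by
  obtain ⟨C, hC⟩ := exists_maximal_disjoint Q E
  have hinj : Injective (C.mkQ ∘ₗ E.subtype) := (injective_iff_map_eq_zero _).2 fun x hx => by
    have : (x : Q) ∈ C := by simpa using hx
    exact Subtype.ext (hC.prop _ this x.2)
  obtain ⟨ψ, hψ⟩ := hQ.out (C.mkQ ∘ₗ E.subtype) hinj E.subtype
  set π : Q →ₗ[A] Q := ψ ∘ₗ C.mkQ with hπ
  have hπE : ∀ x ∈ E, π x = x := fun x hx => hψ ⟨x, hx⟩
  have hπC : ∀ x ∈ C, π x = 0 := fun x hx => by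
    simp [hπ, (Submodule.Quotient.mk_eq_zero C).2 hx]
  have hrange : LinearMap.range π ≤ E := by
    refine hE.le_of_ge ?_ fun x hx => ⟨x, hπE x hx⟩
    rintro _ ⟨q, rfl⟩ hq
    have hqC : q ∉ C := fun h => hq (hπC q h)
    have hlt : ¬ ∀ x ∈ C ⊔ A ∙ q, x ∈ E → x = 0 := fun h =>
      hqC (hC.le_of_ge h le_sup_left (Submodule.mem_sup_right (Submodule.mem_span_singleton_self q)))
    push Not at hlt
    obtain ⟨x, hx, hxE, hx0⟩ := hlt
    obtain ⟨y, hy, z, hz, rfl⟩ := Submodule.mem_sup.1 hx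
    obtain ⟨a, rfl⟩ := Submodule.mem_span_singleton.1 hz
    have h1 : a • π q = y + a • q := by
      rw [← hπE _ hxE, map_add, hπC y hy, map_smul, zero_add]
    obtain ⟨b, hb, hbK⟩ := hE.prop _ hxE hx0
    exact ⟨b * a, by rwa [mul_smul, h1], by rwa [mul_smul, h1]⟩
  refine ⟨fun X Y _ _ _ _ i hi f => ?_⟩
  obtain ⟨h, hh⟩ := hQ.out i hi (E.subtype ∘ₗ f)
  refine ⟨π.codRestrict E (fun x => hrange ⟨x, rfl⟩) ∘ₗ h, fun x => Subtype.ext ?_⟩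
  simpa [hh x] using hπE _ (f x).2

/-- Every module has an injective hull. -/
theorem exists_injective_hull (k : Type u) [AddCommGroup k] [Module A k] :
    ∃ (E : Type u) (_ : AddCommGroup E) (_ : Module A E), Module.Injective A E ∧
      ∃ ι : k →ₗ[A] E, Injective ι ∧
        ∀ x : E, x ≠ 0 → ∃ a : A, a • x ≠ 0 ∧ a • x ∈ LinearMap.range ι := by
  obtain ⟨P⟩ := CategoryTheory.EnoughInjectives.presentation (ModuleCat.of A k)
  have := P.injective
  have hQ : Module.Injective A P.J := Module.injective_module_of_injective_object A P.J
  have hf : Injective P.f := (ModuleCat.mono_iff_injective P.f).1 P.mono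
  obtain ⟨E, hKE, hE⟩ := exists_maximal_essential P.J (LinearMap.range P.f.hom)
  refine ⟨E, inferInstance, inferInstance, injective_of_maximal_essential _ hE,
    P.f.hom.codRestrict E fun x => hKE ⟨x, rfl⟩, fun x y h => hf (congrArg Subtype.val h),
    fun x hx => ?_⟩
  obtain ⟨a, ha, z, hz⟩ := hE.prop x x.2 (by simpa using hx)
  exact ⟨a, fun h => ha (congrArg Subtype.val h), z, Subtype.ext hz⟩

end hull

open IsLocalRing

theorem isPrecomplete_pi {A : Type*} [CommRing A] (I : Ideal A) [IsPrecomplete I A] (n : ℕ) :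
    IsPrecomplete I (Fin n → A) := by
  have key : ∀ (m : ℕ) (x : Fin n → A), x ∈ (I ^ m • ⊤ : Submodule A (Fin n → A)) ↔
      ∀ j, x j ∈ (I ^ m • ⊤ : Ideal A) := fun m x => by
    refine ⟨fun hx j => ?_, fun hx => ?_⟩
    · have h : LinearMap.proj (R := A) (φ := fun _ : Fin n => A) j x ∈
          (I ^ m • ⊤ : Submodule A (Fin n → A)).map (LinearMap.proj j) :=
        Submodule.mem_map_of_mem hx
      rw [Submodule.map_smul''] at h
      exact Submodule.smul_mono le_rfl le_top h
    · rw [pi_eq_sum_univ x]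
      refine Submodule.sum_mem _ fun j _ => Submodule.smul_mem_smul ?_ trivial
      simpa using hx j
  refine ⟨fun f hf => ?_⟩
  have h : ∀ j, ∃ L : A, ∀ m, f m j ≡ L [SMOD (I ^ m • ⊤ : Ideal A)] := fun j =>
    IsPrecomplete.prec inferInstance (f := fun m => f m j) fun {m k} hmk => by
      have := hf hmk
      rw [SModEq.sub_mem, key] at this
      rw [SModEq.sub_mem]
      exact this j
  choose L hL using h
  refine ⟨L, fun m => ?_⟩
  rw [SModEq.sub_mem, key]
  intro j
  exact SModEq.sub_mem.1 (hL j m)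

section duality

/-- An injective module with finite, non-zero socle over a local ring. -/
class IsDualizing (A : Type u) [CommRing A] [IsLocalRing A] (E : Type u) [AddCommGroup E]
    [Module A E] : Prop where
  injective : Module.Injective A E
  finite : Module.Finite A (A ⧸ maximalIdeal A →ₗ[A] E)
  exists_injective : ∃ ι : A ⧸ maximalIdeal A →ₗ[A] E, Injective ι

theorem exists_isDualizing (A : Type u) [CommRing A] [IsNoetherianRing A] [IsLocalRing A] :
    ∃ (E : Type u) (_ : AddCommGroup E) (_ : Module A E), IsDualizing A E := by
  obtain ⟨E, i1, i2, hE, ι, hι, hess⟩ := exists_injective_hull (A := A) (A ⧸ maximalIdeal A)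
  refine ⟨E, i1, i2, hE, ?_, ι, hι⟩
  have hsoc : ∀ x : E, (∀ a ∈ maximalIdeal A, a • x = 0) → x ∈ LinearMap.range ι := fun x hx => by
    by_cases h0 : x = 0
    · rw [h0]; exact zero_mem _
    obtain ⟨a, ha, z, hz⟩ := hess x h0
    have hau : IsUnit a := by
      by_contra h
      exact ha (hx a ((mem_maximalIdeal a).2 h))
    obtain ⟨b, rfl⟩ := hau
    refine ⟨(↑b⁻¹ : A) • z, ?_⟩
    rw [map_smul, hz, smul_smul, Units.inv_mul, one_smul]
  let ev : (A ⧸ maximalIdeal A →ₗ[A] E) →ₗ[A] LinearMap.range ι :=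
    (LinearMap.applyₗ (R := A) (M := A ⧸ maximalIdeal A) (M₂ := E)
      (Submodule.Quotient.mk 1)).codRestrict _ fun φ => hsoc _ fun a ha => by
        rw [LinearMap.applyₗ_apply_apply, ← map_smul, ← Submodule.Quotient.mk_smul,
          (Submodule.Quotient.mk_eq_zero _).2 (by simpa using ha), map_zero]
  refine Module.Finite.of_injective ev fun φ ψ h => ?_
  have h1 : φ (Submodule.Quotient.mk 1) = ψ (Submodule.Quotient.mk 1) := congrArg Subtype.val h
  refine Submodule.linearMap_qext _ (LinearMap.ext_ring ?_)
  exact h1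

variable {A : Type u} [CommRing A] [IsLocalRing A] (E : Type u) [AddCommGroup E] [Module A E]
  [hE : IsDualizing A E] {N N' N'' : Type u} [AddCommGroup N] [Module A N]
  [AddCommGroup N'] [Module A N'] [AddCommGroup N''] [Module A N'']

/-- A nonzero element killed by a power of the maximal ideal has a nonzero multiple killed by the
maximal ideal. -/
theorem exists_smul_ne_zero {z : N} (hz : z ≠ 0) (ht : z ∈ gamma (maximalIdeal A) N) :
    ∃ a : A, a • z ≠ 0 ∧ ∀ b ∈ maximalIdeal A, b • a • z = 0 := by
  classical
  have hex : ∃ n : ℕ, ∀ a ∈ maximalIdeal A ^ n, a • z = 0 := ht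
  have h1 := Nat.find_spec hex
  obtain ⟨n, hn⟩ : ∃ n, Nat.find hex = n + 1 := Nat.exists_eq_succ_of_ne_zero fun h0 => hz (by
    simpa using h1 1 (by rw [h0]; simp))
  have h2 := Nat.find_min hex (m := n) (by omega)
  push Not at h2
  obtain ⟨a, ha, haz⟩ := h2
  refine ⟨a, haz, fun b hb => ?_⟩
  rw [smul_smul]
  refine h1 _ ?_
  rw [hn, pow_succ, mul_comm b a]
  exact Ideal.mul_mem_mul ha hb

theorem exists_dual_ne_zero {z : N} (hz : z ≠ 0) (ht : z ∈ gamma (maximalIdeal A) N) :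
    ∃ φ : N →ₗ[A] E, φ z ≠ 0 := by
  obtain ⟨a, ha, hm⟩ := exists_smul_ne_zero hz ht
  have hle : maximalIdeal A ≤ LinearMap.ker (LinearMap.toSpanSingleton A N (a • z)) :=
    fun b hb => by simpa using hm b hb
  let q : A ⧸ maximalIdeal A →ₗ[A] N := (maximalIdeal A).liftQ _ hle
  have hker : LinearMap.ker (LinearMap.toSpanSingleton A N (a • z)) = maximalIdeal A := by
    refine ((maximalIdeal.isMaximal A).eq_of_le (fun h => ha ?_) hle).symm
    have h1 : (1 : A) ∈ LinearMap.ker (LinearMap.toSpanSingleton A N (a • z)) := by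
      rw [h]; trivial
    simpa using h1
  have hq : Injective q := by
    rw [← LinearMap.ker_eq_bot]
    exact Submodule.ker_liftQ_eq_bot _ _ hle hker.le
  obtain ⟨ι, hι⟩ := hE.exists_injective
  obtain ⟨φ, hφ⟩ := hE.injective.out q hq ι
  refine ⟨φ, fun h => ?_⟩
  have h1 : q (Submodule.Quotient.mk 1) = a • z :=
    ((maximalIdeal A).liftQ_apply _ 1).trans (one_smul A _)
  have h2 : ι (Submodule.Quotient.mk 1) = 0 := by rw [← hφ, h1, map_smul, h, smul_zero]
  have h3 := hι (h2.trans (map_zero ι).symm)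
  rw [Submodule.Quotient.mk_eq_zero] at h3
  exact (Ideal.ne_top_iff_one _).1 (maximalIdeal.isMaximal A).ne_top h3

theorem exists_dual_extension (i : N' →ₗ[A] N) (hi : Injective i) (φ : N' →ₗ[A] E) :
    ∃ ψ : N →ₗ[A] E, ψ ∘ₗ i = φ := by
  obtain ⟨ψ, hψ⟩ := hE.injective.out i hi φ
  exact ⟨ψ, LinearMap.ext hψ⟩

/-- A functional vanishing on the kernel of `g` factors through `g`. -/
theorem exists_dual_factor (g : N →ₗ[A] N'') (φ : N →ₗ[A] E)
    (h : LinearMap.ker g ≤ LinearMap.ker φ) : ∃ ψ : N'' →ₗ[A] E, ψ ∘ₗ g = φ := by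
  obtain ⟨ψ, hψ⟩ := exists_dual_extension E ((LinearMap.ker g).liftQ g le_rfl)
    (by rw [← LinearMap.ker_eq_bot]; exact Submodule.ker_liftQ_eq_bot _ _ le_rfl le_rfl)
    ((LinearMap.ker g).liftQ φ h)
  refine ⟨ψ, LinearMap.ext fun x => ?_⟩
  simpa using LinearMap.congr_fun hψ (Submodule.Quotient.mk x)

variable [IsNoetherianRing A]

omit [IsLocalRing A] hE in
theorem finite_dual_of_surjective (g : N →ₗ[A] N'') (hg : Surjective g)
    (h : Module.Finite A (N →ₗ[A] E)) : Module.Finite A (N'' →ₗ[A] E) :=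
  Module.Finite.of_injective (LinearMap.lcomp A E g) fun φ ψ hφ => by
    ext z
    obtain ⟨w, rfl⟩ := hg z
    exact LinearMap.congr_fun hφ w

theorem finite_dual_of_exact {f : N' →ₗ[A] N} {g : N →ₗ[A] N''} (hfg : Exact f g)
    (h' : Module.Finite A (N' →ₗ[A] E)) (h'' : Module.Finite A (N'' →ₗ[A] E)) :
    Module.Finite A (N →ₗ[A] E) := by
  have h1 : LinearMap.range (LinearMap.lcomp A E g) = LinearMap.ker (LinearMap.lcomp A E f) := by
    ext φ
    constructor
    · rintro ⟨ψ, rfl⟩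
      ext z
      simp [hfg.apply_apply_eq_zero]
    · intro hφ
      obtain ⟨ψ, hψ⟩ := exists_dual_factor E g φ fun x hx => by
        obtain ⟨y, rfl⟩ := (hfg x).1 hx
        exact LinearMap.congr_fun hφ y
      exact ⟨ψ, hψ⟩
  have := isNoetherian_of_range_eq_ker _ _ h1
  infer_instance

omit [IsNoetherianRing A] in
theorem finite_dual_of_injective (i : N' →ₗ[A] N) (hi : Injective i)
    (h : Module.Finite A (N →ₗ[A] E)) : Module.Finite A (N' →ₗ[A] E) :=
  Module.Finite.of_surjective (LinearMap.lcomp A E i) fun φ => exists_dual_extension E i hi φ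

/-- The dual of a torsion module is finite as soon as the dual of its socle is. -/
theorem finite_dual_of_socle [IsAdicComplete (maximalIdeal A) A]
    (ht : gamma (maximalIdeal A) N = ⊤)
    (h : Module.Finite A (Submodule.torsionBySet A N (maximalIdeal A : Set A) →ₗ[A] E)) :
    Module.Finite A (N →ₗ[A] E) := by
  set S := Submodule.torsionBySet A N (maximalIdeal A : Set A) with hS
  obtain ⟨s, hs⟩ := IsNoetherian.noetherian (maximalIdeal A)
  have hker : ∀ φ : N →ₗ[A] E, LinearMap.lcomp A E S.subtype φ = 0 →
      φ ∈ (maximalIdeal A • ⊤ : Submodule A (N →ₗ[A] E)) := fun φ hφ => by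
    let mult : N →ₗ[A] (s → N) := LinearMap.pi fun j : s => (j : A) • LinearMap.id
    have hle : LinearMap.ker mult ≤ LinearMap.ker φ := fun z hz => by
      have hzS : z ∈ S := by
        rw [hS, ← hs]
        change z ∈ Submodule.torsionBySet A N (Ideal.span (s : Set A))
        rw [← Submodule.torsionBySet_eq_torsionBySet_span]
        rw [Submodule.mem_torsionBySet_iff]
        intro j
        exact congrFun hz j
      exact LinearMap.congr_fun hφ ⟨z, hzS⟩
    obtain ⟨ψ, hψ⟩ := exists_dual_factor E mult φ hle
    classical
    have hsum : φ = ∑ j : s, (j : A) • (ψ ∘ₗ LinearMap.single A (fun _ : s => N) j) := by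
      ext z
      rw [← hψ, LinearMap.comp_apply, ← Finset.univ_sum_single (mult z), map_sum,
        LinearMap.sum_apply]
      refine Finset.sum_congr rfl fun j _ => ?_
      simp [mult, Pi.single_smul]
    rw [hsum]
    refine Submodule.sum_mem _ fun j _ => Submodule.smul_mem_smul ?_ trivial
    rw [← hs]
    exact Submodule.subset_span j.2
  have hfin : Module.Finite A ((N →ₗ[A] E) ⧸ (maximalIdeal A • ⊤ : Submodule A (N →ₗ[A] E))) := by
    have h1 : Module.Finite A ((N →ₗ[A] E) ⧸ LinearMap.ker (LinearMap.lcomp A E S.subtype)) :=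
      Module.Finite.of_injective _
        (LinearMap.ker_eq_bot.1 (Submodule.ker_liftQ_eq_bot _ (LinearMap.lcomp A E S.subtype)
          le_rfl le_rfl))
    exact Module.Finite.of_surjective (Submodule.factor (show LinearMap.ker
      (LinearMap.lcomp A E S.subtype) ≤ maximalIdeal A • ⊤ from fun φ hφ => hker φ hφ))
      (Submodule.factor_surjective _)
  obtain ⟨n, q, hq⟩ := Module.Finite.exists_fin' A
    ((N →ₗ[A] E) ⧸ (maximalIdeal A • ⊤ : Submodule A (N →ₗ[A] E)))
  obtain ⟨f, hf⟩ := Module.projective_lifting_property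
    (maximalIdeal A • ⊤ : Submodule A (N →ₗ[A] E)).mkQ q (Submodule.mkQ_surjective _)
  have hhaus : IsHausdorff (maximalIdeal A) (N →ₗ[A] E) := ⟨fun φ hφ => by
    ext z
    have hz : z ∈ gamma (maximalIdeal A) N := ht ▸ trivial
    obtain ⟨m, hm⟩ := hz
    have h1 := hφ m
    rw [SModEq.zero] at h1
    refine Submodule.smul_induction_on h1 (fun a ha ψ _ => ?_) fun ψ ψ' h h' => ?_
    · rw [LinearMap.smul_apply, ← map_smul, hm a ha, map_zero]; rfl
    · rw [LinearMap.add_apply, h, h', LinearMap.zero_apply, add_zero]⟩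
  have hpre := isPrecomplete_pi (maximalIdeal A) n
  exact Module.Finite.of_surjective f (surjective_of_mkQ_comp_surjective (I := maximalIdeal A)
    (by rw [hf]; exact hq))

end duality

/-- A property of finite modules which is stable under extensions holds for all finite modules
killed by `J` once it holds for the quotients by the primes containing `J`. -/
theorem devissage {A : Type u} [CommRing A] [IsNoetherianRing A] (J : Ideal A)
    (P : ∀ (N : Type u) [AddCommGroup N] [Module A N], Prop)
    (h0 : ∀ (N : Type u) [AddCommGroup N] [Module A N] [Subsingleton N], P N)
    (hq : ∀ p : PrimeSpectrum A, J ≤ p.asIdeal → P (A ⧸ p.asIdeal))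
    (hex : ∀ (N₁ N₂ N₃ : Type u) [AddCommGroup N₁] [Module A N₁] [AddCommGroup N₂] [Module A N₂]
      [AddCommGroup N₃] [Module A N₃] (f : N₁ →ₗ[A] N₂) (g : N₂ →ₗ[A] N₃), Injective f →
      Exact f g → Surjective g → P N₁ → P N₃ → P N₂)
    (M : Type u) [AddCommGroup M] [Module A M] (hM : Module.Finite A M)
    (hJ : ∀ a ∈ J, ∀ z : M, a • z = 0) : P M := by
  revert hJ
  induction hM using IsNoetherianRing.induction_on_isQuotientEquivQuotientPrime A with
  | subsingleton N => exact fun _ => h0 N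
  | quotient N p e =>
    intro hJ
    refine hex (A ⧸ p.1) N PUnit.{u + 1} e.symm 0 e.symm.injective
      ((e.symm.exact_zero_iff_surjective _).2 e.symm.surjective)
      (surjective_to_subsingleton _) (hq p fun a ha => ?_) (h0 _)
    have h := hJ a ha (e.symm (Submodule.Quotient.mk 1))
    rw [← map_smul, LinearEquiv.map_eq_zero_iff, ← Submodule.Quotient.mk_smul,
      Submodule.Quotient.mk_eq_zero] at h
    simpa using h
  | exact N₁ N₂ N₃ f g hf hg hfg h₁ h₃ =>
    intro hJ
    refine hex N₁ N₂ N₃ f g hf hfg hg (h₁ fun a ha z => hf ?_) (h₃ fun a ha z => ?_)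
    · rw [map_smul, hJ a ha, map_zero]
    · obtain ⟨w, rfl⟩ := hg z
      rw [← map_smul, hJ a ha, map_zero]

section general

variable {A : Type u} [CommRing A] (I : Ideal A) (B : Type u) [CommRing B] [Algebra A B]
  (n : ℕ) {M M' M'' : Type u} [AddCommGroup M] [Module A M] [AddCommGroup M'] [Module A M']
  [AddCommGroup M''] [Module A M'']

theorem H_smul_eq_zero {a : A} (ha : ∀ z : M, a • z = 0) (z : H I B n M) : a • z = 0 := by
  have h : a • (LinearMap.id : M →ₗ[A] M) = (0 : A) • LinearMap.id := by
    ext z; simp [ha]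
  have h1 := congrArg (Hmap I B n) h
  rw [Hmap_smul, Hmap_smul, Hmap_id, zero_smul] at h1
  exact LinearMap.congr_fun h1 z

theorem subsingleton_H [Subsingleton M] : Subsingleton (H I B n M) :=
  subsingleton_of_forall_eq 0 fun z => by
    rw [← one_smul A z]
    exact H_smul_eq_zero I B n (fun z : M => Subsingleton.elim _ _) z

/-- `Hmap` as a linear map. -/
noncomputable def HmapLinear : (M →ₗ[A] M') →ₗ[A] (H I B n M →ₗ[A] H I B n M') where
  toFun := Hmap I B n
  map_add' := Hmap_add I B n
  map_smul' := Hmap_smul I B n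

variable {I} in
theorem subsingleton_of_smul_injective {N : Type*} [AddCommGroup N] [Module A N]
    (hN : gamma I N = ⊤) {x : A} (hx : x ∈ I) (h : ∀ z : N, x • z = 0 → z = 0) :
    Subsingleton N := by
  refine subsingleton_of_forall_eq 0 fun z => ?_
  have hz : z ∈ gamma I N := hN ▸ trivial
  obtain ⟨k, hk⟩ := hz
  have h1 : ∀ k : ℕ, x ^ k • z = 0 → z = 0 := fun k => by
    induction k with
    | zero => simp
    | succ k ih => exact fun h2 => ih (h _ (by rwa [smul_smul, ← pow_succ']))
  exact h1 k (hk _ (Ideal.pow_mem_pow hx k))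

variable [IsDetecting I B]

theorem subsingleton_H_of_exact {f : M →ₗ[A] M'} {g : M' →ₗ[A] M''} (hf : Injective f)
    (hfg : Exact f g) (hg : Surjective g) (h : Subsingleton (H I B n M))
    (h'' : Subsingleton (H I B n M'')) : Subsingleton (H I B n M') := by
  refine subsingleton_of_forall_eq 0 fun z => ?_
  obtain ⟨w, rfl⟩ := (H_exact I B hf hfg hg z).1 (Subsingleton.elim _ _)
  rw [Subsingleton.elim w 0, map_zero]

variable (M) in
/-- The long exact sequence for multiplication by a nonzerodivisor on `M`. -/
theorem exact_smul (x : A) (hx : Injective (x • (LinearMap.id : M →ₗ[A] M))) :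
    Exact (x • (LinearMap.id : H I B n M →ₗ[A] H I B n M))
      (Hmap I B n (LinearMap.range (x • (LinearMap.id : M →ₗ[A] M))).mkQ) ∧
    ∃ δ : H I B n (M ⧸ LinearMap.range (x • (LinearMap.id : M →ₗ[A] M))) →ₗ[A] H I B (n + 1) M,
      Exact δ (x • (LinearMap.id : H I B (n + 1) M →ₗ[A] H I B (n + 1) M)) := by
  have h1 : ∀ n, Hmap I B n (x • (LinearMap.id : M →ₗ[A] M)) = x • LinearMap.id := fun n => by
    rw [Hmap_smul, Hmap_id]
  have h2 := LinearMap.exact_map_mkQ_range (x • (LinearMap.id : M →ₗ[A] M))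
  refine ⟨?_, ?_⟩
  · rw [← h1 n]
    exact H_exact I B hx h2 (Submodule.mkQ_surjective _)
  · obtain ⟨δ, -, h⟩ := exists_H_connecting I B n hx h2 (Submodule.mkQ_surjective _)
    exact ⟨δ, by rwa [h1] at h⟩

/-- If `H^{n+1}` vanishes on finite modules killed by `J`, then `H^n` preserves surjections
between them. -/
theorem Hmap_surjective [IsNoetherianRing A] (J : Ideal A)
    (hJ : ∀ (N : Type u) [AddCommGroup N] [Module A N], Module.Finite A N →
      (∀ a ∈ J, ∀ z : N, a • z = 0) → Subsingleton (H I B (n + 1) N))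
    (hM : Module.Finite A M) (hJM : ∀ a ∈ J, ∀ z : M, a • z = 0) (g : M →ₗ[A] M')
    (hg : Surjective g) : Surjective (Hmap I B n g) := by
  obtain ⟨δ, h, -⟩ := exists_H_connecting I B n (LinearMap.ker g).injective_subtype
    (LinearMap.exact_subtype_ker_map g) hg
  have := hJ (LinearMap.ker g) inferInstance fun a ha z => Subtype.ext (hJM a ha z)
  exact fun z => (h z).1 (Subsingleton.elim _ _)

end general

section vanishing

variable {A : Type u} [CommRing A] [IsLocalRing A] [IsNoetherianRing A] (B : Type u) [CommRing B]
  [Algebra A B] [IsDetecting (maximalIdeal A) B]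

omit [IsNoetherianRing A] in
theorem exists_mem_notMem {p : PrimeSpectrum A} (hp : p.asIdeal ≠ maximalIdeal A) :
    ∃ x ∈ maximalIdeal A, x ∉ p.asIdeal := by
  by_contra! h
  exact hp (le_antisymm (le_maximalIdeal p.isPrime.ne_top) h)

omit [IsLocalRing A] [IsNoetherianRing A] in
theorem smul_injective_quotient (p : PrimeSpectrum A) {x : A} (hx : x ∉ p.asIdeal) :
    Injective (x • (LinearMap.id : A ⧸ p.asIdeal →ₗ[A] A ⧸ p.asIdeal)) := by
  refine (injective_iff_map_eq_zero _).2 fun z hz => ?_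
  obtain ⟨a, rfl⟩ := Submodule.Quotient.mk_surjective _ z
  rw [LinearMap.smul_apply, LinearMap.id_apply, ← Submodule.Quotient.mk_smul,
    Submodule.Quotient.mk_eq_zero, smul_eq_mul] at hz
  rw [Submodule.Quotient.mk_eq_zero]
  exact (p.isPrime.mem_or_mem hz).resolve_left hx

omit [IsNoetherianRing A] in
theorem gamma_residue : gamma (maximalIdeal A) (A ⧸ maximalIdeal A) = ⊤ :=
  gamma_eq_top_of_pow_smul (n := 1) fun a ha z => by
    obtain ⟨b, rfl⟩ := Submodule.Quotient.mk_surjective _ z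
    rw [← Submodule.Quotient.mk_smul, Submodule.Quotient.mk_eq_zero]
    exact Ideal.mul_mem_right _ _ (by simpa using ha)

theorem subsingleton_H_of_coheight (i : ℕ) : ∀ (J : Ideal A)
    (_ : ∀ p : PrimeSpectrum A, J ≤ p.asIdeal → Order.coheight p < i)
    (M : Type u) [AddCommGroup M] [Module A M] (_ : Module.Finite A M)
    (_ : ∀ a ∈ J, ∀ z : M, a • z = 0), Subsingleton (H (maximalIdeal A) B i M) := by
  induction i with
  | zero =>
    intro J hJ M _ _ hM hJM
    refine devissage J (fun N _ _ => Subsingleton (H (maximalIdeal A) B 0 N))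
      (fun N _ _ _ => subsingleton_H _ B 0) (fun p hp => absurd (hJ p hp) (by simp))
      (fun N₁ N₂ N₃ _ _ _ _ _ _ f g hf hfg hg h₁ h₃ =>
        subsingleton_H_of_exact _ B 0 hf hfg hg h₁ h₃) M hM hJM
  | succ i ih =>
    intro J hJ M _ _ hM hJM
    refine devissage J (fun N _ _ => Subsingleton (H (maximalIdeal A) B (i + 1) N))
      (fun N _ _ _ => subsingleton_H _ B _) (fun p hp => ?_)
      (fun N₁ N₂ N₃ _ _ _ _ _ _ f g hf hfg hg h₁ h₃ =>
        subsingleton_H_of_exact _ B _ hf hfg hg h₁ h₃) M hM hJM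
    by_cases hpm : p.asIdeal = maximalIdeal A
    · rw [hpm]
      exact subsingleton_H_succ _ B i gamma_residue
    obtain ⟨x, hxm, hxp⟩ := exists_mem_notMem hpm
    obtain ⟨-, δ, hδ⟩ := exact_smul (maximalIdeal A) B i (A ⧸ p.asIdeal) x
      (smul_injective_quotient p hxp)
    have h1 := ih (p.asIdeal ⊔ Ideal.span {x}) (fun q hq => by
        have hpq : p < q := by
          refine lt_of_le_of_ne (le_sup_left.trans hq) ?_
          rintro rfl
          exact hxp (hq (Submodule.mem_sup_right (Ideal.mem_span_singleton_self x)))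
        have h2 := hJ p hp
        have h3 : Order.coheight p ≠ ⊤ := ne_top_of_lt h2
        have h4 := Order.coheight_add_one_le hpq
        push_cast at h2
        refine lt_of_lt_of_le ?_ (Order.lt_add_one_iff_of_not_isMax (by simp) |>.1 h2)
        exact (ENat.add_one_le_iff (ne_top_of_le_ne_top h3 (le_self_add.trans h4))).1 h4)
      ((A ⧸ p.asIdeal) ⧸ LinearMap.range
        (x • (LinearMap.id : A ⧸ p.asIdeal →ₗ[A] A ⧸ p.asIdeal))) inferInstance (by
        intro a ha z
        obtain ⟨z, rfl⟩ := Submodule.Quotient.mk_surjective _ z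
        obtain ⟨z, rfl⟩ := Submodule.Quotient.mk_surjective _ z
        obtain ⟨b, hb, c, hc, rfl⟩ := Submodule.mem_sup.1 ha
        obtain ⟨c, rfl⟩ := Ideal.mem_span_singleton.1 hc
        rw [← Submodule.Quotient.mk_smul, Submodule.Quotient.mk_eq_zero]
        refine ⟨Submodule.Quotient.mk (c * z), ?_⟩
        rw [LinearMap.smul_apply, LinearMap.id_apply, ← Submodule.Quotient.mk_smul,
          ← Submodule.Quotient.mk_smul, Submodule.Quotient.eq]
        have : x • (c * z) - (b + x * c) • z = -(z * b) := by simp only [smul_eq_mul]; ring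
        rw [this]
        exact neg_mem (Ideal.mul_mem_left _ _ hb))
    refine subsingleton_of_smul_injective (gamma_H _ B _ _) hxm fun z hz => ?_
    obtain ⟨w, rfl⟩ := (hδ z).1 hz
    rw [Subsingleton.elim w 0, map_zero]

variable [IsAdicComplete (maximalIdeal A) A] (E : Type u) [AddCommGroup E] [Module A E]
  [hE : IsDualizing A E]

theorem finite_dual_H (n : ℕ) : ∀ (M : Type u) [AddCommGroup M] [Module A M]
    (_ : Module.Finite A M), Module.Finite A (H (maximalIdeal A) B n M →ₗ[A] E) := by
  have hfin : ∀ (N : Type u) [AddCommGroup N] [Module A N] [Subsingleton N],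
      Module.Finite A (N →ₗ[A] E) := fun N _ _ _ => by
    have : Subsingleton (N →ₗ[A] E) := ⟨fun f g => by
      ext z; rw [Subsingleton.elim z 0, map_zero, map_zero]⟩
    infer_instance
  induction n with
  | zero =>
    intro M _ _ hM
    refine devissage ⊥ (fun N _ _ => Module.Finite A (H (maximalIdeal A) B 0 N →ₗ[A] E))
      (fun N _ _ _ => ?_) (fun p hp => ?_)
      (fun N₁ N₂ N₃ _ _ _ _ _ _ f g hf hfg hg h₁ h₃ =>
        finite_dual_of_exact E (H_exact _ B hf hfg hg) h₁ h₃) M hM (by simp)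
    · have := subsingleton_H (maximalIdeal A) B 0 (M := N)
      exact hfin _
    · by_cases hpm : p.asIdeal = maximalIdeal A
      · rw [hpm]
        exact finite_dual_of_injective E (N := A ⧸ maximalIdeal A) (Submodule.subtype _)
          Subtype.val_injective hE.finite
      · obtain ⟨x, hxm, hxp⟩ := exists_mem_notMem hpm
        have : Subsingleton (H (maximalIdeal A) B 0 (A ⧸ p.asIdeal)) :=
          subsingleton_of_smul_injective (gamma_H _ B _ _) hxm fun z hz => Subtype.ext
            (smul_injective_quotient p hxp
              ((congrArg Subtype.val hz).trans (map_zero _).symm))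
        exact hfin _
  | succ n ih =>
    intro M _ _ hM
    refine devissage ⊥ (fun N _ _ => Module.Finite A (H (maximalIdeal A) B (n + 1) N →ₗ[A] E))
      (fun N _ _ _ => ?_) (fun p hp => ?_)
      (fun N₁ N₂ N₃ _ _ _ _ _ _ f g hf hfg hg h₁ h₃ =>
        finite_dual_of_exact E (H_exact _ B hf hfg hg) h₁ h₃) M hM (by simp)
    · have := subsingleton_H (maximalIdeal A) B (n + 1) (M := N)
      exact hfin _
    · by_cases hpm : p.asIdeal = maximalIdeal A
      · rw [hpm]
        have := subsingleton_H_succ (maximalIdeal A) B n (gamma_residue (A := A))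
        exact hfin _
      · obtain ⟨x, hxm, hxp⟩ := exists_mem_notMem hpm
        obtain ⟨-, δ, hδ⟩ := exact_smul (maximalIdeal A) B n (A ⧸ p.asIdeal) x
          (smul_injective_quotient p hxp)
        refine finite_dual_of_socle E (gamma_H _ B _ _) ?_
        have hle : Submodule.torsionBySet A (H (maximalIdeal A) B (n + 1) (A ⧸ p.asIdeal))
            (maximalIdeal A : Set A) ≤ LinearMap.range δ := fun z hz =>
          (hδ z).1 ((Submodule.mem_torsionBySet_iff _ _).1 hz ⟨x, hxm⟩)
        exact finite_dual_of_injective E (Submodule.inclusion hle)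
          (Submodule.inclusion_injective hle) (finite_dual_of_surjective E δ.rangeRestrict
            δ.surjective_rangeRestrict (ih _ inferInstance))

end vanishing

theorem ringKrullDim_quotient_le_add_one {A : Type u} [CommRing A] [IsLocalRing A]
    [IsNoetherianRing A] (J : Ideal A) {s : A} (hs : s ∈ maximalIdeal A) :
    ringKrullDim (A ⧸ J) ≤ ringKrullDim (A ⧸ (J ⊔ Ideal.span {s})) + 1 := by
  have hj : ({Ideal.Quotient.mk J s} : Set (A ⧸ J)) ⊆ Ring.jacobson (A ⧸ J) := by
    rw [Set.singleton_subset_iff, SetLike.mem_coe, ← Ideal.jacobson_bot, Ideal.mem_jacobson_bot]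
    intro y
    obtain ⟨y, rfl⟩ := Ideal.Quotient.mk_surjective y
    rw [← map_mul, ← map_one (Ideal.Quotient.mk J), ← map_add]
    refine IsUnit.map _ ?_
    by_contra h
    have h1 := (mem_maximalIdeal _).2 h
    have h2 := sub_mem h1 (Ideal.mul_mem_right y _ hs)
    rw [add_sub_cancel_left] at h2
    exact (Ideal.ne_top_iff_one _).1 (maximalIdeal.isMaximal A).ne_top h2
  have h := ringKrullDim_le_ringKrullDim_quotient_add_encard _ hj
  rw [Set.encard_singleton] at h
  have e := DoubleQuot.quotQuotEquivQuotSup J (Ideal.span {s})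
  rw [Ideal.map_span, Set.image_singleton] at e
  rwa [ringKrullDim_eq_of_ringEquiv e] at h

section nonvanishing

variable {A : Type u} [CommRing A] [IsLocalRing A] [IsNoetherianRing A] (B : Type u) [CommRing B]
  [Algebra A B] [IsDetecting (maximalIdeal A) B]

omit [IsLocalRing A] in
/-- If `H^{n+1}` vanishes on finite modules killed by `J` and `H^n(A/J) = 0`, then `H^n` vanishes
on finite modules killed by `J`. -/
theorem subsingleton_H_of_quotient (I : Ideal A) [IsDetecting I B] (n : ℕ) (J : Ideal A)
    (hJ : ∀ (N : Type u) [AddCommGroup N] [Module A N], Module.Finite A N →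
      (∀ a ∈ J, ∀ z : N, a • z = 0) → Subsingleton (H I B (n + 1) N))
    (h : Subsingleton (H I B n (A ⧸ J))) (M : Type u) [AddCommGroup M] [Module A M]
    (hM : Module.Finite A M) (hJM : ∀ a ∈ J, ∀ z : M, a • z = 0) :
    Subsingleton (H I B n M) := by
  refine devissage J (fun N _ _ => Subsingleton (H I B n N)) (fun N _ _ _ => subsingleton_H _ B _)
    (fun p hp => ?_) (fun N₁ N₂ N₃ _ _ _ _ _ _ f g hf hfg hg h₁ h₃ =>
      subsingleton_H_of_exact _ B _ hf hfg hg h₁ h₃) M hM hJM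
  refine (Hmap_surjective I B n J hJ inferInstance (fun a ha z => ?_)
    (Submodule.factor hp) (Submodule.factor_surjective hp)).subsingleton
  obtain ⟨z, rfl⟩ := Submodule.Quotient.mk_surjective _ z
  rw [← Submodule.Quotient.mk_smul, Submodule.Quotient.mk_eq_zero]
  exact J.mul_mem_right z ha

theorem ringKrullDim_quotient_le_zero (J : Ideal A)
    (hJ : ∀ (N : Type u) [AddCommGroup N] [Module A N], Module.Finite A N →
      (∀ a ∈ J, ∀ z : N, a • z = 0) → Subsingleton (H (maximalIdeal A) B 1 N)) :
    ringKrullDim (A ⧸ J) ≤ (0 : ℕ) := by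
  rw [← Ring.krullDimLE_iff, Ring.krullDimLE_zero_iff]
  intro P hP
  have hJm : J ≤ maximalIdeal A := le_maximalIdeal fun h => hP.ne_top <| by
    have : Subsingleton (A ⧸ J) := Ideal.Quotient.subsingleton_iff.2 h
    exact Subsingleton.elim _ _
  obtain ⟨z, hz⟩ := Hmap_surjective (maximalIdeal A) B 0 J hJ
    (M := A ⧸ J) (M' := A ⧸ maximalIdeal A) inferInstance (fun a ha z => by
      obtain ⟨z, rfl⟩ := Submodule.Quotient.mk_surjective _ z
      rw [← Submodule.Quotient.mk_smul, Submodule.Quotient.mk_eq_zero]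
      exact J.mul_mem_right z ha) (Submodule.factor hJm) (Submodule.factor_surjective hJm)
    (⟨Submodule.Quotient.mk 1, (gamma_residue (A := A)).symm ▸ trivial⟩ :
      gamma (maximalIdeal A) (A ⧸ maximalIdeal A))
  obtain ⟨z, n, hn⟩ := z
  obtain ⟨b, rfl⟩ := Submodule.Quotient.mk_surjective J z
  have h1 : (Submodule.Quotient.mk b : A ⧸ maximalIdeal A) = Submodule.Quotient.mk 1 :=
    congrArg Subtype.val hz
  rw [Submodule.Quotient.eq] at h1
  have hb : IsUnit b := by
    by_contra h
    have h2 := sub_mem ((mem_maximalIdeal _).2 h) h1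
    rw [sub_sub_cancel] at h2
    exact (Ideal.ne_top_iff_one _).1 (maximalIdeal.isMaximal A).ne_top h2
  have hpow : maximalIdeal A ^ n ≤ J := fun a ha => by
    have h2 : a • (Submodule.Quotient.mk b : A ⧸ J) = 0 := hn a ha
    rw [← Submodule.Quotient.mk_smul, Submodule.Quotient.mk_eq_zero] at h2
    exact (Ideal.mul_unit_mem_iff_mem J hb).1 h2
  have hcomap : P.comap (Ideal.Quotient.mk J) = maximalIdeal A := by
    have hp : (P.comap (Ideal.Quotient.mk J)).IsPrime := inferInstance
    refine le_antisymm (le_maximalIdeal hp.ne_top) (hp.le_of_pow_le (n := n) ?_)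
    refine hpow.trans fun a ha => ?_
    rw [Ideal.mem_comap, Ideal.Quotient.eq_zero_iff_mem.2 ha]
    exact zero_mem _
  have := maximalIdeal.isMaximal A
  rw [← hcomap] at this
  rw [← Ideal.map_comap_of_surjective _ Ideal.Quotient.mk_surjective P]
  refine (Ideal.map_eq_top_or_isMaximal_of_surjective _ Ideal.Quotient.mk_surjective
    this).resolve_left ?_
  rw [Ideal.map_comap_of_surjective _ Ideal.Quotient.mk_surjective P]
  exact hP.ne_top

omit [IsLocalRing A] [IsNoetherianRing A] in
theorem smul_quotient_eq_zero (J : Ideal A) : ∀ a ∈ J, ∀ z : A ⧸ J, a • z = 0 := fun a ha z => by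
  obtain ⟨z, rfl⟩ := Submodule.Quotient.mk_surjective _ z
  rw [← Submodule.Quotient.mk_smul, Submodule.Quotient.mk_eq_zero]
  exact J.mul_mem_right z ha

/-- A torsion module whose dual is finite and has no socle is divisible by an element of the
maximal ideal. -/
theorem exists_smul_surjective (E : Type u) [AddCommGroup E] [Module A E] [IsDualizing A E]
    {N : Type u} [AddCommGroup N] [Module A N] (hN : gamma (maximalIdeal A) N = ⊤)
    [Module.Finite A (N →ₗ[A] E)]
    (hsoc : ∀ φ : N →ₗ[A] E, (∀ a ∈ maximalIdeal A, a • φ = 0) → φ = 0) :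
    ∃ s ∈ maximalIdeal A, ∀ z : N, ∃ w : N, s • w = z := by
  obtain ⟨s, hsm, hreg⟩ : ∃ s ∈ maximalIdeal A, ∀ φ : N →ₗ[A] E, s • φ = 0 → φ = 0 := by
    by_contra! hcon
    have h1 : (maximalIdeal A : Set A) ⊆
        ⋃ p ∈ ((associatedPrimes.finite A (N →ₗ[A] E)).toFinset : Set (Ideal A)), (p : Set A) := by
      rw [Set.Finite.coe_toFinset, biUnion_associatedPrimes_eq_zero_divisors]
      intro s hs
      obtain ⟨φ, h1, h2⟩ := hcon s hs
      exact ⟨φ, h2, h1⟩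
    rw [Ideal.subset_union_prime ⊤ ⊤ fun p hp _ _ =>
      ((Set.Finite.mem_toFinset _).1 hp).isPrime] at h1
    obtain ⟨p, hp, hle⟩ := h1
    have hp := (Set.Finite.mem_toFinset _).1 hp
    obtain ⟨hpp, φ, hφ⟩ := (isAssociatedPrime_iff_exists_injective_linearMap _ _).1 hp
    have h2 : φ (Submodule.Quotient.mk 1) = 0 := hsoc _ fun a ha => by
      rw [← map_smul, ← Submodule.Quotient.mk_smul,
        (Submodule.Quotient.mk_eq_zero _).2 (by simpa using hle ha), map_zero]
    have h3 := hφ (h2.trans (map_zero φ).symm)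
    rw [Submodule.Quotient.mk_eq_zero] at h3
    exact (Ideal.ne_top_iff_one _).1 hpp.ne_top h3
  refine ⟨s, hsm, fun z => ?_⟩
  by_contra hz
  let K : Submodule A N := LinearMap.range (s • (LinearMap.id : N →ₗ[A] N))
  have h1 : K.mkQ z ≠ 0 := fun h => hz ((Submodule.Quotient.mk_eq_zero _).1 h)
  have h2 := gamma_eq_top_of_surjective K.mkQ K.mkQ_surjective hN
  have h4 : K.mkQ z ∈ gamma (maximalIdeal A) (N ⧸ K) := by rw [h2]; trivial
  obtain ⟨φ, hφ⟩ := exists_dual_ne_zero E h1 h4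
  refine hφ (LinearMap.congr_fun (hreg (φ ∘ₗ K.mkQ) ?_) z)
  ext w
  have h3 : K.mkQ (s • w) = 0 := (Submodule.Quotient.mk_eq_zero K).2 ⟨w, rfl⟩
  rw [LinearMap.smul_apply, ← map_smul, LinearMap.comp_apply, h3, map_zero, LinearMap.zero_apply]

/-- If `H^{n+2}` vanishes on finite modules killed by `J`, then the dual of `H^{n+1}(A/J)` has
no socle. -/
theorem dual_socle_eq_zero (n : ℕ) (J : Ideal A)
    (hJ : ∀ (N : Type u) [AddCommGroup N] [Module A N], Module.Finite A N →
      (∀ a ∈ J, ∀ z : N, a • z = 0) → Subsingleton (H (maximalIdeal A) B (n + 2) N))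
    {E : Type u} [AddCommGroup E] [Module A E]
    (φ : H (maximalIdeal A) B (n + 1) (A ⧸ J) →ₗ[A] E) (hφ : ∀ a ∈ maximalIdeal A, a • φ = 0) :
    φ = 0 := by
  obtain ⟨s, hs⟩ := IsNoetherian.noetherian (maximalIdeal A)
  let f : (s → A ⧸ J) →ₗ[A] (A ⧸ J) :=
    ∑ j : s, (j : A) • LinearMap.proj (R := A) (φ := fun _ : s => A ⧸ J) j
  have hf1 : Surjective (Hmap (maximalIdeal A) B (n + 1) f.rangeRestrict) :=
    Hmap_surjective (maximalIdeal A) B (n + 1) J hJ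
      (inferInstance : Module.Finite A (s → A ⧸ J))
      (fun a ha z => funext fun j => smul_quotient_eq_zero J a ha (z j)) f.rangeRestrict
      f.surjective_rangeRestrict
  have hf2 : Surjective (Hmap (maximalIdeal A) B (n + 1) (LinearMap.range f).subtype) := by
    have : Subsingleton (H (maximalIdeal A) B (n + 1) ((A ⧸ J) ⧸ LinearMap.range f)) := by
      refine subsingleton_H_succ _ B n (gamma_eq_top_of_pow_smul (n := 1) fun a ha z => ?_)
      rw [pow_one, ← hs] at ha
      obtain ⟨z, rfl⟩ := Submodule.Quotient.mk_surjective _ z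
      rw [← Submodule.Quotient.mk_smul, Submodule.Quotient.mk_eq_zero]
      refine Submodule.span_induction (fun x hx => ?_) (by rw [zero_smul]; exact zero_mem _)
        (fun x y _ _ hx hy => by rw [add_smul]; exact add_mem hx hy)
        (fun r x _ hx => by rw [smul_assoc]; exact Submodule.smul_mem _ _ hx) ha
      classical
      refine ⟨Pi.single ⟨x, hx⟩ z, ?_⟩
      simp only [f, LinearMap.sum_apply, LinearMap.smul_apply, LinearMap.proj_apply]
      rw [Finset.sum_eq_single ⟨x, hx⟩]
      · rw [Pi.single_eq_same]
      · intro j _ hj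
        rw [Pi.single_eq_of_ne hj, smul_zero]
      · simp
    exact fun z => (H_exact (maximalIdeal A) B (LinearMap.range f).injective_subtype
      (LinearMap.exact_subtype_mkQ _) (Submodule.mkQ_surjective _) z).1
      (Subsingleton.elim _ _)
  have hf3 : Surjective (Hmap (maximalIdeal A) B (n + 1) f) := by
    have : f = (LinearMap.range f).subtype ∘ₗ f.rangeRestrict := rfl
    rw [this, Hmap_comp]
    exact hf2.comp hf1
  refine LinearMap.ext fun z => ?_
  obtain ⟨w, rfl⟩ := hf3 z
  have h1 : Hmap (maximalIdeal A) B (n + 1) f = ∑ j : s, (j : A) •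
      Hmap (maximalIdeal A) B (n + 1)
        (LinearMap.proj (R := A) (φ := fun _ : s => A ⧸ J) j) := by
    change HmapLinear (maximalIdeal A) B (n + 1) f = _
    simp only [f, map_sum, map_smul]
    rfl
  rw [h1, LinearMap.sum_apply, map_sum]
  refine Finset.sum_eq_zero fun j _ => ?_
  rw [LinearMap.smul_apply, map_smul, ← LinearMap.smul_apply,
    hφ j (hs ▸ Submodule.subset_span j.2), LinearMap.zero_apply]

variable [IsAdicComplete (maximalIdeal A) A]

theorem ringKrullDim_quotient_le (c : ℕ) : ∀ (J : Ideal A)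
    (_ : ∀ i > c, ∀ (N : Type u) [AddCommGroup N] [Module A N], Module.Finite A N →
      (∀ a ∈ J, ∀ z : N, a • z = 0) → Subsingleton (H (maximalIdeal A) B i N)),
    ringKrullDim (A ⧸ J) ≤ c := by
  induction c with
  | zero => exact fun J hJ => ringKrullDim_quotient_le_zero B J (hJ 1 one_pos)
  | succ c ih =>
    intro J hJ
    obtain ⟨E, _, _, _⟩ := exists_isDualizing A
    have hvan : ∀ (N : Type u) [AddCommGroup N] [Module A N], Module.Finite A N →
      (∀ a ∈ J, ∀ z : N, a • z = 0) → Subsingleton (H (maximalIdeal A) B (c + 2) N) :=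
      hJ (c + 2) (Nat.lt_succ_self _)
    have hω : Module.Finite A (H (maximalIdeal A) B (c + 1) (A ⧸ J) →ₗ[A] E) :=
      finite_dual_H B E (c + 1) (A ⧸ J) (inferInstance : Module.Finite A (A ⧸ J))
    obtain ⟨s, hsm, hdiv⟩ := exists_smul_surjective E (gamma_H (maximalIdeal A) B (c + 1) (A ⧸ J))
      (dual_socle_eq_zero B c J hvan)
    have hle : J ≤ J ⊔ Ideal.span {s} := le_sup_left
    have hzero : Subsingleton (H (maximalIdeal A) B (c + 1) (A ⧸ (J ⊔ Ideal.span {s}))) := by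
      refine subsingleton_of_forall_eq 0 fun z => ?_
      obtain ⟨w, rfl⟩ := Hmap_surjective (maximalIdeal A) B (c + 1) J hvan
        (inferInstance : Module.Finite A (A ⧸ J))
        (smul_quotient_eq_zero J) (Submodule.factor hle) (Submodule.factor_surjective hle) z
      obtain ⟨w, rfl⟩ := hdiv w
      rw [map_smul]
      exact H_smul_eq_zero _ B _
        (smul_quotient_eq_zero _ s (Submodule.mem_sup_right (Ideal.mem_span_singleton_self s))) _
    have hvan' : ∀ i > c, ∀ (N : Type u) [AddCommGroup N] [Module A N], Module.Finite A N →
        (∀ a ∈ J ⊔ Ideal.span {s}, ∀ z : N, a • z = 0) →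
        Subsingleton (H (maximalIdeal A) B i N) := by
      intro i hi N _ _ hNf hNk
      obtain rfl | hi := (Nat.succ_le_of_lt hi).eq_or_lt
      · exact subsingleton_H_of_quotient B (maximalIdeal A) (c + 1) (J ⊔ Ideal.span {s})
          (fun N _ _ h h' => hvan N h fun a ha => h' a (hle ha)) hzero N hNf hNk
      · exact hJ i hi N hNf fun a ha => hNk a (hle ha)
    refine (ringKrullDim_quotient_le_add_one J hsm).trans ?_
    push_cast
    gcongr
    exact ih _ hvan'

end nonvanishing

theorem aeval_lcomp_apply {A N E : Type*} [CommRing A] [AddCommGroup N] [Module A N]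
    [AddCommGroup E] [Module A E] (U : Module.End A N) (p : Polynomial A) :
    ∀ (φ : N →ₗ[A] E) (z : N),
      Polynomial.aeval (LinearMap.lcomp A E U : Module.End A (N →ₗ[A] E)) p φ z =
        φ (Polynomial.aeval U p z) := by
  induction p using Polynomial.induction_on' with
  | add p q hp hq =>
    intro φ z
    rw [map_add, map_add, LinearMap.add_apply, LinearMap.add_apply, hp, hq, LinearMap.add_apply,
      map_add]
  | monomial n a =>
    induction n with
    | zero => simp
    | succ n ih =>
      intro φ z
      rw [← Polynomial.monomial_mul_X, map_mul, map_mul, Polynomial.aeval_X, Polynomial.aeval_X,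
        Module.End.mul_apply, Module.End.mul_apply, ih, LinearMap.lcomp_apply]
      have h := LinearMap.congr_fun (congrArg (Polynomial.aeval U)
        (Polynomial.X_mul (p := Polynomial.monomial n a))) z
      rw [map_mul, map_mul, Polynomial.aeval_X] at h
      exact congrArg φ h

section domain

variable {A : Type u} [CommRing A] [IsLocalRing A] [IsNoetherianRing A]
  (B : Type u) [CommRing B] [Algebra A B] [IsDetecting (maximalIdeal A) B]

omit [IsNoetherianRing A] in
theorem height_add_coheight_le {d : ℕ} (hd : ringKrullDim A = d) (p : PrimeSpectrum A) :
    Order.height p + Order.coheight p ≤ d := by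
  rw [ringKrullDim, Order.krullDim_eq_iSup_height_add_coheight_of_nonempty] at hd
  have h : ⨆ a : PrimeSpectrum A, Order.height a + Order.coheight a = (d : ℕ∞) := by
    exact_mod_cast hd
  rw [← h]
  exact le_iSup (fun a : PrimeSpectrum A => Order.height a + Order.coheight a) p

/-- Finite modules have no cohomology above the dimension. -/
theorem subsingleton_H_of_ringKrullDim_lt {d i : ℕ} (hd : ringKrullDim A = d) (hi : d < i)
    (M : Type u) [AddCommGroup M] [Module A M] (hM : Module.Finite A M) :
    Subsingleton (H (maximalIdeal A) B i M) := by
  refine subsingleton_H_of_coheight B i ⊥ (fun p _ => ?_) M hM fun a ha z => by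
    rw [(Submodule.mem_bot A).1 ha, zero_smul]
  exact ((le_add_self.trans (height_add_coheight_le hd p)).trans_lt (by exact_mod_cast hi))

/-- Quotients by ideals of positive height have no cohomology in the top degree. -/
theorem subsingleton_H_of_height {d k : ℕ} (hd : ringKrullDim A = (d + k : ℕ)) (J : Ideal A)
    (hJ : ∀ p : PrimeSpectrum A, J ≤ p.asIdeal → k < Order.height p)
    (M : Type u) [AddCommGroup M] [Module A M] (hM : Module.Finite A M)
    (hJM : ∀ a ∈ J, ∀ z : M, a • z = 0) :
    Subsingleton (H (maximalIdeal A) B d M) := by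
  refine subsingleton_H_of_coheight B d J (fun p hp => ?_) M hM hJM
  have h1 := height_add_coheight_le hd p
  have h2 := hJ p hp
  by_contra! h3
  have h4 : (k : ℕ∞) + 1 + d ≤ (d + k : ℕ) :=
    (add_le_add (Order.add_one_le_of_lt h2) h3).trans h1
  have h5 : k + 1 + d ≤ d + k := by exact_mod_cast h4
  omega

variable [IsDomain A] [IsAdicComplete (maximalIdeal A) A]

/-- The top local cohomology of a complete local domain is faithful. -/
theorem eq_zero_of_smul_H_eq_zero {c : ℕ} (hd : ringKrullDim A = (c + 1 : ℕ)) {s : A}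
    (hs : ∀ z : H (maximalIdeal A) B (c + 1) A, s • z = 0) : s = 0 := by
  by_contra h0
  have hbot : ∀ (N : Type u) [AddCommGroup N] [Module A N], ∀ a ∈ (⊥ : Ideal A), ∀ z : N,
      a • z = 0 := fun N _ _ a ha z => by rw [(Submodule.mem_bot A).1 ha, zero_smul]
  have hinj : Injective (s • (LinearMap.id : A →ₗ[A] A)) := fun x y h => mul_left_cancel₀ h0 h
  have h1 : Subsingleton (H (maximalIdeal A) B (c + 1)
      (A ⧸ LinearMap.range (s • (LinearMap.id : A →ₗ[A] A)))) := by
    refine subsingleton_H_of_height B (k := 0) hd (Ideal.span {s}) (fun p hp => ?_) _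
      inferInstance fun a ha z => ?_
    · rw [Nat.cast_zero, Order.height_pos]
      intro hmin
      have h2 : (⟨⊥, Ideal.isPrime_bot⟩ : PrimeSpectrum A) ≤ p :=
        (bot_le : (⊥ : Ideal A) ≤ p.asIdeal)
      have h3 : p.asIdeal ≤ ⊥ := hmin h2
      exact h0 (h3 (hp (Ideal.mem_span_singleton_self s)))
    · obtain ⟨b, rfl⟩ := Ideal.mem_span_singleton'.1 ha
      obtain ⟨z, rfl⟩ := Submodule.Quotient.mk_surjective _ z
      rw [← Submodule.Quotient.mk_smul, Submodule.Quotient.mk_eq_zero]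
      exact ⟨b • z, by simp [mul_assoc, mul_left_comm]⟩
  have h2 : Subsingleton (H (maximalIdeal A) B (c + 1) A) := by
    refine subsingleton_of_forall_eq 0 fun z => ?_
    obtain ⟨w, rfl⟩ := ((exact_smul (maximalIdeal A) B (c + 1) A s hinj).1 z).1
      (Subsingleton.elim _ _)
    exact hs w
  have hvan : ∀ i > c + 1, ∀ (N : Type u) [AddCommGroup N] [Module A N], Module.Finite A N →
      Subsingleton (H (maximalIdeal A) B i N) := fun i hi N _ _ hN =>
    subsingleton_H_of_ringKrullDim_lt B hd hi N hN
  have h3 : Subsingleton (H (maximalIdeal A) B (c + 1) (A ⧸ (⊥ : Ideal A))) :=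
    (Hmap_surjective (maximalIdeal A) B (c + 1) ⊥ (fun N _ _ h _ => hvan _ (Nat.lt_succ_self _) N h)
      (inferInstance : Module.Finite A A) (hbot A) (Submodule.mkQ ⊥)
      (Submodule.mkQ_surjective _)).subsingleton
  have h4 := ringKrullDim_quotient_le B c ⊥ fun i hi N _ _ hN hk => by
    obtain rfl | hi := (Nat.succ_le_of_lt hi).eq_or_lt
    · exact subsingleton_H_of_quotient B (maximalIdeal A) (c + 1) ⊥
        (fun N _ _ h _ => hvan _ (Nat.lt_succ_self _) N h) h3 N hN hk
    · exact hvan i hi N hN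
  rw [ringKrullDim_eq_of_ringEquiv (RingEquiv.quotientBot A), hd] at h4
  have h5 : c + 1 ≤ c := by exact_mod_cast h4
  omega

end domain

theorem exists_isDetecting (A : Type u) [CommRing A] [IsNoetherianRing A] (I : Ideal A) :
    ∃ (B : Type u) (_ : CommRing B) (_ : Algebra A B), IsDetecting I B := by
  obtain ⟨s, hs⟩ := IsNoetherian.noetherian I
  have h := isDetecting_pi s
  rw [show Ideal.span (s : Set A) = I from hs] at h
  exact ⟨_, _, _, h⟩

/-- If the endomorphism `U` of a faithful torsion module with finite dual satisfies `a U = b`,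
then `b / a` is integral. -/
theorem isIntegral_div_of_smul_eq {A : Type u} [CommRing A] [IsDomain A] [IsLocalRing A]
    (K : Type*) [Field K] [Algebra A K] [IsFractionRing A K] (E : Type u) [AddCommGroup E]
    [Module A E] [IsDualizing A E] {N : Type u} [AddCommGroup N] [Module A N]
    (hN : gamma (maximalIdeal A) N = ⊤) [Module.Finite A (N →ₗ[A] E)]
    (hf : ∀ s : A, (∀ z : N, s • z = 0) → s = 0) (U : Module.End A N) {a b : A} (ha : a ≠ 0)
    (hU : ∀ z : N, a • U z = b • z) : IsIntegral A (algebraMap A K b / algebraMap A K a) := by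
  obtain ⟨f, hfm, hf0⟩ := LinearMap.exists_monic_and_aeval_eq_zero A
    (LinearMap.lcomp A E U : Module.End A (N →ₗ[A] E))
  have h1 : Polynomial.aeval U f = 0 := by
    ext z
    by_contra hz
    obtain ⟨φ, hφ⟩ := exists_dual_ne_zero E hz (by rw [hN]; trivial)
    refine hφ ?_
    rw [← aeval_lcomp_apply, hf0]
    rfl
  have h2 : algebraMap A (Module.End A N) a * U = algebraMap A (Module.End A N) b := by
    ext z
    exact hU z
  have h3 := Polynomial.scaleRoots_eval₂_mul_of_commute (p := f) (algebraMap A (Module.End A N))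
    U a (Algebra.commutes a U) fun x y => Algebra.commutes x _
  rw [h2, ← Polynomial.aeval_def, ← Polynomial.aeval_def, h1, mul_zero,
    Polynomial.aeval_algebraMap_apply] at h3
  have h4 : Polynomial.aeval b (f.scaleRoots a) = 0 := hf _ fun z => LinearMap.congr_fun h3 z
  have ha' : algebraMap A K a ≠ 0 := fun h =>
    ha (IsFractionRing.injective A K (h.trans (map_zero _).symm))
  have h5 := Polynomial.scaleRoots_eval₂_mul (p := f) (algebraMap A K)
    (algebraMap A K b / algebraMap A K a) a
  rw [mul_div_cancel₀ _ ha', ← Polynomial.aeval_def, Polynomial.aeval_algebraMap_apply, h4,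
    map_zero] at h5
  exact ⟨f, hfm, (mul_eq_zero.1 h5.symm).resolve_left (pow_ne_zero _ ha')⟩

/-- An element of the fraction field which multiplies an ideal of height at least two into a
complete local domain is integral. -/
theorem isIntegral_div {A : Type u} [CommRing A] [IsDomain A] [IsLocalRing A] [IsNoetherianRing A]
    [IsAdicComplete (maximalIdeal A) A] (K : Type*) [Field K] [Algebra A K] [IsFractionRing A K]
    (I : Ideal A) (hI : I ≤ maximalIdeal A)
    (hht : ∀ p : PrimeSpectrum A, I ≤ p.asIdeal → 2 ≤ Order.height p) (μ : I →ₗ[A] A) (a : I)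
    (ha : a ≠ 0) : IsIntegral A (algebraMap A K (μ a) / algebraMap A K a) := by
  obtain ⟨B, _, _, _⟩ := exists_isDetecting A (maximalIdeal A)
  obtain ⟨E, _, _, _⟩ := exists_isDualizing A
  obtain ⟨c, hd⟩ : ∃ c : ℕ, ringKrullDim A = (c + 1 : ℕ) := by
    have hd : ringKrullDim A = (LTSeries.longestOf (PrimeSpectrum A)).length :=
      Order.krullDim_eq_length_of_finiteDimensionalOrder
    refine ⟨_, hd.trans (congrArg _ (Nat.succ_pred_eq_of_pos ?_).symm)⟩
    have h := (hht ⟨maximalIdeal A, inferInstance⟩ hI).trans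
      (le_self_add.trans (height_add_coheight_le hd _))
    have h : 2 ≤ (LTSeries.longestOf (PrimeSpectrum A)).length := by exact_mod_cast h
    omega
  have hAI : Subsingleton (H (maximalIdeal A) B c (A ⧸ I)) :=
    subsingleton_H_of_height B (k := 1) hd I
      (fun p hp => lt_of_lt_of_le (by norm_num) (hht p hp)) _ inferInstance
      (smul_quotient_eq_zero I)
  have hAI' : Subsingleton (H (maximalIdeal A) B (c + 1) (A ⧸ I)) :=
    subsingleton_H_of_height B (k := 0) hd I
      (fun p hp => lt_of_lt_of_le (by norm_num) (hht p hp)) _ inferInstance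
      (smul_quotient_eq_zero I)
  have hinj : Injective (Hmap (maximalIdeal A) B (c + 1) I.subtype) := by
    obtain ⟨δ, -, h⟩ := exists_H_connecting (maximalIdeal A) B c I.injective_subtype
      (LinearMap.exact_subtype_mkQ I) I.mkQ_surjective
    refine (injective_iff_map_eq_zero _).2 fun z hz => ?_
    obtain ⟨w, rfl⟩ := (h z).1 hz
    rw [Subsingleton.elim w 0, map_zero]
  have hsurj : Surjective (Hmap (maximalIdeal A) B (c + 1) I.subtype) := fun z =>
    (H_exact (maximalIdeal A) B I.injective_subtype (LinearMap.exact_subtype_mkQ I)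
      I.mkQ_surjective z).1 (Subsingleton.elim _ _)
  let e := LinearEquiv.ofBijective (Hmap (maximalIdeal A) B (c + 1) I.subtype) ⟨hinj, hsurj⟩
  have hω : Module.Finite A (H (maximalIdeal A) B (c + 1) A →ₗ[A] E) :=
    finite_dual_H B E (c + 1) A (inferInstance : Module.Finite A A)
  refine isIntegral_div_of_smul_eq K E (gamma_H (maximalIdeal A) B (c + 1) A)
    (fun s hs => eq_zero_of_smul_H_eq_zero B hd hs)
    (Hmap (maximalIdeal A) B (c + 1) μ ∘ₗ e.symm.toLinearMap) (fun h => ha (Subtype.ext h))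
    fun z => ?_
  obtain ⟨w, rfl⟩ := e.surjective z
  have h1 : (a : A) • μ = μ a • I.subtype := by
    ext i
    have h2 : (a : A) • i = (i : A) • a := Subtype.ext (mul_comm _ _)
    rw [LinearMap.smul_apply, ← map_smul, h2, map_smul]
    exact mul_comm _ _
  have h2 := LinearMap.congr_fun (congrArg (Hmap (maximalIdeal A) B (c + 1)) h1) w
  rw [Hmap_smul, Hmap_smul] at h2
  rw [LinearMap.comp_apply, LinearEquiv.coe_coe, e.symm_apply_apply]
  exact h2

end LocalCoh

namespace PseudoRep

section trace

variable {S R : Type*} [Ring S] [CommRing R] (L : S →+ R)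

/-- A two-dimensional trace is multiplicative on the corner cut out by an idempotent whose
complement has trace one. -/
theorem corner_mul (hcomm : ∀ x z, L (x * z) = L (z * x))
    (hrel : ∀ p q r : S, L (p * q * r) + L (p * r * q) - L (p * r) * L q - L (r * q) * L p
      - L (q * p) * L r + L p * L q * L r = 0)
    {e f : S} (he : e * e = e) (hef : e * f = 0) (hfe : f * e = 0) (hf : L f = 1)
    (p q : S) : L (e * p * e * q) = L (e * p) * L (e * q) := by
  have h1 : ∀ x, L (e * x * e) = L (e * x) := fun x => by
    rw [hcomm, ← mul_assoc, he]
  have h := hrel (e * p * e) (e * q * e) f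
  have h2 : e * p * e * (e * q * e) * f = 0 := by simp only [mul_assoc, hef, mul_zero]
  have h3 : e * p * e * f = 0 := by simp only [mul_assoc, hef, mul_zero]
  have h4 : f * (e * q * e) = 0 := by simp only [← mul_assoc, hfe, zero_mul]
  have h5 : L (e * q * e * (e * p * e)) = L (e * p * e * q) := by
    rw [hcomm, show e * p * e * (e * q * e) = e * (p * (e * e) * q) * e by
      simp only [mul_assoc], h1, he]
    simp only [mul_assoc]
  rw [h2, h3, h4, zero_mul, map_zero, hf, h5, h1, h1] at h
  linear_combination -h

theorem corner_mul_corner_swap (hcomm : ∀ x z, L (x * z) = L (z * x))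
    (hrel : ∀ p q r : S, L (p * q * r) + L (p * r * q) - L (p * r) * L q - L (r * q) * L p
      - L (q * p) * L r + L p * L q * L r = 0)
    {e f : S} (he : e * e = e) (hff : f * f = f) (hef : e * f = 0)
    (hfe : f * e = 0) (hLe : L e = 1) (hLf : L f = 1) (p q r s : S) :
    L (e * p * f * q) * L (e * r * f * s) = L (e * p * f * s) * L (e * r * f * q) := by
  have h1 := corner_mul L hcomm hrel he hef hfe hLf (p * f * q) (r * f * s)
  have h2 := corner_mul L hcomm hrel hff hfe hef hLe (q * e * r) (s * e * p)
  have h3 : L (e * (p * f * q) * e * (r * f * s)) = L (f * (q * e * r) * f * (s * e * p)) := by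
    have h := hcomm (e * p * f) (f * q * e * r * f * s * e)
    rw [show e * p * f * (f * q * e * r * f * s * e) = e * p * (f * f) * q * e * r * f * s * e by
      simp only [mul_assoc], hff, hcomm _ e,
      show e * (e * p * f * q * e * r * f * s) = (e * e) * p * f * q * e * r * f * s by
      simp only [mul_assoc], he,
      show f * q * e * r * f * s * e * (e * p * f) = f * q * e * r * f * s * (e * e) * p * f by
      simp only [mul_assoc], he, hcomm _ f,
      show f * (f * q * e * r * f * s * e * p) = (f * f) * q * e * r * f * s * e * p by
      simp only [mul_assoc], hff] at h
    simpa only [mul_assoc] using h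
  have h4 : L (f * (q * e * r)) = L (e * r * f * q) := by
    rw [show f * (q * e * r) = (f * q) * (e * r) by simp only [mul_assoc], hcomm]
    simp only [mul_assoc]
  have h5 : L (f * (s * e * p)) = L (e * p * f * s) := by
    rw [show f * (s * e * p) = (f * s) * (e * p) by simp only [mul_assoc], hcomm]
    simp only [mul_assoc]
  rw [h3, h2, h4, h5] at h1
  simp only [← mul_assoc] at h1
  linear_combination -h1

end trace

theorem y_mul_y_swap {R : Type*} [CommRing R] [Invertible (2 : R)] {G : Type*} [Group G]
    (T : G → R) (c : G) (hc : c ^ 2 = 1) (hT1 : T 1 = 2) (hTc : T c = 0)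
    (hcomm : ∀ σ τ : G, T (σ * τ) = T (τ * σ))
    (hrel : ∀ γ δ η : G, T (γ * δ * η) + T (γ * η * δ) - T (γ * η) * T δ - T (η * δ) * T γ
        - T (δ * γ) * T η + T γ * T δ * T η = 0)
    (a : G → R) (y : G → G → R) (ha : ∀ σ : G, 2 * a σ = T (c * σ) + T σ)
    (hy : ∀ σ τ : G, y σ τ = a (σ * τ) - a σ * a τ) (σ τ σ' τ' : G) :
    y σ τ * y σ' τ' = y σ τ' * y σ' τ := by
  let ι := MonoidAlgebra.of R G
  let L : MonoidAlgebra R G →ₗ[R] R := (MonoidAlgebra.basis G R).constr R T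
  have hL : ∀ g, L (ι g) = T g := fun g => by
    have h : MonoidAlgebra.basis G R g = ι g := by simp [ι]
    rw [← h, Module.Basis.constr_basis]
  have hind : ∀ (P : MonoidAlgebra R G → Prop), (∀ g, P (ι g)) →
      (∀ x z, P x → P z → P (x + z)) → (∀ (r : R) x, P x → P (r • x)) → ∀ x, P x :=
    fun P h1 h2 h3 x => MonoidAlgebra.induction_on x h1 h2 h3
  have hLcomm : ∀ x z, L (x * z) = L (z * x) := by
    refine hind _ (fun σ => hind _ (fun τ => ?_) (fun x z hx hz => ?_) fun r x hx => ?_)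
      (fun x z hx hz w => ?_) fun r x hx w => ?_
    · rw [← map_mul, ← map_mul, hL, hL, hcomm]
    · rw [mul_add, add_mul, map_add, map_add, hx, hz]
    · rw [mul_smul_comm, smul_mul_assoc, map_smul, map_smul, hx]
    · rw [mul_add, add_mul, map_add, map_add, hx, hz]
    · rw [mul_smul_comm, smul_mul_assoc, map_smul, map_smul, hx]
  have hLrel : ∀ p q r, L (p * q * r) + L (p * r * q) - L (p * r) * L q - L (r * q) * L p
      - L (q * p) * L r + L p * L q * L r = 0 := by
    refine hind _ (fun γ => hind _ (fun δ => hind _ (fun η => ?_) (fun x z hx hz => ?_)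
      fun r x hx => ?_) (fun x z hx hz w => ?_) fun r x hx w => ?_)
      (fun x z hx hz v w => ?_) fun r x hx v w => ?_
    · simp only [← map_mul, hL, hrel]
    · simp only [mul_add, add_mul, map_add]
      linear_combination hx + hz
    · simp only [mul_smul_comm, smul_mul_assoc, map_smul, smul_eq_mul]
      linear_combination r * hx
    · have h1 := hx w
      have h2 := hz w
      simp only [mul_add, add_mul, map_add]
      linear_combination h1 + h2
    · have h1 := hx w
      simp only [mul_smul_comm, smul_mul_assoc, map_smul, smul_eq_mul]
      linear_combination r * h1
    · have h1 := hx v w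
      have h2 := hz v w
      simp only [mul_add, add_mul, map_add]
      linear_combination h1 + h2
    · have h1 := hx v w
      simp only [mul_smul_comm, smul_mul_assoc, map_smul, smul_eq_mul]
      linear_combination r * h1
  have hcc : ι c * ι c = 1 := by rw [← map_mul, ← sq, hc, map_one]
  have h2 : (⅟2 : R) * 2 = 1 := invOf_mul_self 2
  have h4 : (⅟2 : R) * ⅟2 + ⅟2 * ⅟2 = ⅟2 := by linear_combination ⅟2 * h2
  let e : MonoidAlgebra R G := (⅟2 : R) • (1 + ι c)
  let f : MonoidAlgebra R G := (⅟2 : R) • (1 - ι c)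
  have he : e * e = e := by
    simp only [e, smul_mul_smul_comm]
    rw [show (1 + ι c) * (1 + ι c) = (1 + ι c) + (ι c * ι c + ι c) by noncomm_ring, hcc, smul_add,
      ← add_smul, h4]
  have hff : f * f = f := by
    simp only [f, smul_mul_smul_comm]
    rw [show (1 - ι c) * (1 - ι c) = (1 - ι c) + (ι c * ι c - ι c) by noncomm_ring, hcc, smul_add,
      ← add_smul, h4]
  have hef : e * f = 0 := by
    simp only [e, f, smul_mul_smul_comm]
    rw [show (1 + ι c) * (1 - ι c) = 1 - ι c * ι c by noncomm_ring, hcc, sub_self, smul_zero]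
  have hfe : f * e = 0 := by
    simp only [e, f, smul_mul_smul_comm]
    rw [show (1 - ι c) * (1 + ι c) = 1 - ι c * ι c by noncomm_ring, hcc, sub_self, smul_zero]
  have hLone : L 1 = 2 := by rw [← map_one ι, hL, hT1]
  have hLe : L e = 1 := by
    simp only [e, map_smul, map_add, hLone, hL, hTc, smul_eq_mul, add_zero, h2]
  have hLf : L f = 1 := by
    simp only [f, map_smul, map_sub, hLone, hL, hTc, smul_eq_mul, sub_zero, h2]
  have hsum : e + f = 1 := by
    simp only [e, f, ← smul_add]
    rw [show (1 + ι c) + (1 - ι c) = (2 : R) • (1 : MonoidAlgebra R G) by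
      rw [two_smul]; abel, smul_smul, h2, one_smul]
  have ha' : ∀ σ, a σ = L (e * ι σ) := fun σ => by
    simp only [e, smul_mul_assoc, add_mul, one_mul, map_smul, map_add, ← map_mul, hL, smul_eq_mul]
    linear_combination (⅟2 : R) * ha σ - a σ * h2
  have hy' : ∀ σ τ, y σ τ = L (e * ι σ * f * ι τ) := fun σ τ => by
    have h5 := corner_mul L.toAddMonoidHom hLcomm hLrel he hef hfe hLf (ι σ) (ι τ)
    have h6 : e * ι (σ * τ) = e * ι σ * e * ι τ + e * ι σ * f * ι τ := by
      rw [← add_mul, ← mul_add, hsum, mul_one, map_mul, mul_assoc]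
    rw [hy, ha', ha', ha', h6, map_add]
    exact sub_eq_of_eq_add' (congrArg (· + _) h5)
  simp only [hy']
  exact corner_mul_corner_swap L.toAddMonoidHom hLcomm hLrel he hff hef hfe hLe hLf _ _ _ _

end PseudoRep

/-- Over a complete Noetherian local domain, if the residual pseudo-representation is
reducible and every minimal prime over the ideal `I_α = (y α β : β ∈ G)` has height
at least `2`, then for every `σ` the ratio `u(σ, α)` is well-defined and integral
over `R`. -/
theorem stmt_9 {R : Type*} [CommRing R] [IsDomain R] [IsNoetherianRing R]
    [IsLocalRing R] [IsAdicComplete (IsLocalRing.maximalIdeal R) R]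
    [Invertible (2 : R)] {G : Type*} [Group G]
    (T : G → R) (c : G)
    (hc : c ^ 2 = 1) (hT1 : T 1 = 2) (hTc : T c = 0)
    (hcomm : ∀ σ τ : G, T (σ * τ) = T (τ * σ))
    (hrel : ∀ γ δ η : G,
      T (γ * δ * η) + T (γ * η * δ) - T (γ * η) * T δ - T (η * δ) * T γ
        - T (δ * γ) * T η + T γ * T δ * T η = 0)
    (a d : G → R) (y : G → G → R)
    (ha : ∀ σ : G, 2 * a σ = T (c * σ) + T σ)
    (hd : ∀ σ : G, 2 * d σ = T σ - T (c * σ))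
    (hy : ∀ σ τ : G, y σ τ = a (σ * τ) - a σ * a τ)
    (hred : ∀ σ τ : G, y σ τ ∈ IsLocalRing.maximalIdeal R)
    (α : G)
    (hht : ∀ 𝔭 ∈ (Ideal.span (Set.range (y α))).minimalPrimes, ∀ (h𝔭 : 𝔭.IsPrime),
      2 ≤ Order.height (⟨𝔭, h𝔭⟩ : PrimeSpectrum R)) :
    ∀ σ : G, ∃ u : FractionRing R, IsIntegral R u ∧
      ∀ β : G, u * algebraMap R (FractionRing R) (y α β) =
        algebraMap R (FractionRing R) (y σ β) := by
  intro σ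
  have hswap : ∀ β γ : G, y σ β * y α γ = y σ γ * y α β := fun β γ =>
    PseudoRep.y_mul_y_swap T c hc hT1 hTc hcomm hrel a y ha hy σ β α γ
  set I := Ideal.span (Set.range (y α)) with hIdef
  have hIm : I ≤ IsLocalRing.maximalIdeal R := Ideal.span_le.2 <| by
    rintro _ ⟨β, rfl⟩
    exact hred α β
  have hheight : ∀ p : PrimeSpectrum R, I ≤ p.asIdeal → 2 ≤ Order.height p := fun p hp => by
    obtain ⟨q, hq, hqp⟩ := Ideal.exists_minimalPrimes_le hp
    exact (hht q hq hq.1.1).trans (Order.height_mono (show ⟨q, hq.1.1⟩ ≤ p from hqp))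
  obtain ⟨β₀, hβ₀⟩ : ∃ β, y α β ≠ 0 := by
    by_contra! h
    have hI : I ≤ ⊥ := Ideal.span_le.2 <| by
      rintro _ ⟨β, rfl⟩
      exact h β
    have h1 := hheight ⟨⊥, Ideal.isPrime_bot⟩ hI
    have h2 : Order.height (⟨⊥, Ideal.isPrime_bot⟩ : PrimeSpectrum R) = 0 :=
      Order.height_eq_zero.2 fun q _ => (bot_le : (⊥ : Ideal R) ≤ q.asIdeal)
    rw [h2] at h1
    exact absurd h1 (by norm_num)
  have hinj := IsFractionRing.injective R (FractionRing R)
  have hne : algebraMap R (FractionRing R) (y α β₀) ≠ 0 := fun h =>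
    hβ₀ (hinj (h.trans (map_zero _).symm))
  have hmul : ∀ β, algebraMap R (FractionRing R) (y σ β₀) / algebraMap R (FractionRing R) (y α β₀) *
      algebraMap R (FractionRing R) (y α β) = algebraMap R (FractionRing R) (y σ β) := fun β => by
    rw [div_mul_eq_mul_div, div_eq_iff hne, ← map_mul, ← map_mul, hswap]
  refine ⟨algebraMap R (FractionRing R) (y σ β₀) / algebraMap R (FractionRing R) (y α β₀), ?_, hmul⟩
  have hex : ∀ i : I, ∃ r : R, algebraMap R (FractionRing R) (y σ β₀) /
      algebraMap R (FractionRing R) (y α β₀) * algebraMap R (FractionRing R) i =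
        algebraMap R (FractionRing R) r := by
    rintro ⟨i, hi⟩
    refine Submodule.span_induction (fun x hx => ?_) ⟨0, by simp⟩ (fun x z _ _ hx hz => ?_)
      (fun r x _ hx => ?_) hi
    · obtain ⟨β, rfl⟩ := hx
      exact ⟨_, hmul β⟩
    · obtain ⟨r, hr⟩ := hx
      obtain ⟨s, hs⟩ := hz
      exact ⟨r + s, by simp only [map_add, mul_add] at *; rw [hr, hs]⟩
    · obtain ⟨s, hs⟩ := hx
      exact ⟨r * s, by simp only [smul_eq_mul, map_mul] at *; rw [mul_left_comm, hs]⟩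
  choose μ hμ using hex
  let μ' : I →ₗ[R] R :=
    { toFun := μ
      map_add' := fun i j => hinj <| by
        rw [map_add, ← hμ, ← hμ, ← hμ, Submodule.coe_add, map_add, mul_add]
      map_smul' := fun r i => hinj <| by
        rw [RingHom.id_apply, smul_eq_mul, map_mul, ← hμ, ← hμ, Submodule.coe_smul, smul_eq_mul,
          map_mul, mul_left_comm] }
  have h := LocalCoh.isIntegral_div (FractionRing R) I hIm hheight μ'
    ⟨y α β₀, Ideal.subset_span ⟨β₀, rfl⟩⟩ fun h => hβ₀ (congrArg Subtype.val h)
  have h1 : μ' ⟨y α β₀, Ideal.subset_span ⟨β₀, rfl⟩⟩ = y σ β₀ := hinj <| (hμ _).symm.trans (hmul β₀)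
  rwa [h1] at h
end
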